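/- arXiv:2205.12826 — 3 statements merged into one kernel-verified Lean document; each statement's English description precedes it below -/
import Mathlib

section
/- For every tree T, every integer r ≥ 2 and every t ∈ ℕ, there exists a number f = f(T, r, t) ∈ ℕ (depending only on T, r and t) such that for every graph G with G →ᵣ T, every r-colouring of the edges of the f-blowup G[f] contains a monochromatic canonical copy of T[t]; equivalently, B(G →ᵣ T; t) ≤ f for every G with G →ᵣ T. -/
/-- `Arrows G H r` : every `r`-colouring of the edges of `G` contains a
monochromatic copy of `H`. -/
def Arrows {α β : Type*} (G : SimpleGraph α) (H : SimpleGraph β) (r : ℕ) : Prop :=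
  ∀ c : Sym2 α → Fin r, ∃ f : β → α, Function.Injective f ∧
    ∃ k : Fin r, ∀ u v : β, H.Adj u v → G.Adj (f u) (f v) ∧ c s(f u, f v) = k

/-- `HasMonoCanonCopy G H n t r c` : the colouring `c` of the edges of the
`n`-blowup `G[n]` contains a monochromatic canonical copy of the `t`-blowup
`H[t]`. -/
def HasMonoCanonCopy {α β : Type*} (G : SimpleGraph α) (H : SimpleGraph β)
    (n t r : ℕ) (c : Sym2 (α × Fin n) → Fin r) : Prop :=
  ∃ f : β → α, Function.Injective f ∧
    ∃ g : β → Fin t → Fin n, (∀ u, Function.Injective (g u)) ∧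
      ∃ k : Fin r, ∀ u v : β, H.Adj u v →
        G.Adj (f u) (f v) ∧ ∀ i j, c s((f u, g u i), (f v, g v j)) = k

/-- The total map `φ` extends the partial map `ψ`. -/
def ExtendsPartial {ι V : Type*} (φ : ι → V) (ψ : ι → Option V) : Prop :=
  ∀ i z, ψ i = some z → φ i = z

/-- The family `(ω a)` for `a ∈ F` robustly extends the partial map `ψ` on `W`: any set of
at most `q` values can be avoided, outside the domain of `ψ`, by a member extending `ψ`. -/
def Robust {α ι V : Type*} (W : Finset ι) (q : ℕ) (F : Set α) (ω : α → ι → V)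
    (ψ : ι → Option V) : Prop :=
  ∀ Q : Finset V, Q.card ≤ q →
    ∃ a ∈ F, ExtendsPartial (ω a) ψ ∧ ∀ i ∈ W, ψ i = none → ω a i ∉ Q

theorem Robust.mono {α ι V : Type*} {W : Finset ι} {q q' : ℕ} {F F' : Set α} {ω : α → ι → V}
    {ψ : ι → Option V} (h : Robust W q F ω ψ) (hq : q' ≤ q) (hF : F ⊆ F') :
    Robust W q' F' ω ψ := fun Q hQ => by
  obtain ⟨a, ha, h'⟩ := h Q (hQ.trans hq)
  exact ⟨a, hF ha, h'⟩

theorem exists_kernel_extending {α ι V : Type*} (W : Finset ι) (q : ℕ) (ω : α → ι → V) (n : ℕ) :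
    ∀ (ψ : ι → Option V) (F : Set α), (∀ a ∈ F, ExtendsPartial (ω a) ψ) →
      (∀ i z, ψ i = some z → i ∈ W) → {i ∈ W | ψ i = none}.card = n →
      ∃ L : Finset (ι → Option V), L.card ≤ (W.card * q + 1) ^ n ∧
        (∀ π ∈ L, Robust W q F ω π ∧ ∀ i z, π i = some z → i ∈ W) ∧
        ∀ a ∈ F, ∃ π ∈ L, ExtendsPartial (ω a) π := by
  classical
  induction n with
  | zero =>
    intro ψ F hF hψ hn
    by_cases h : Robust W q F ω ψ
    · exact ⟨{ψ}, by simp, by simpa using ⟨h, hψ⟩, fun a ha => ⟨ψ, by simp, hF a ha⟩⟩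
    · simp only [Robust, not_forall, not_exists, not_and, not_not] at h
      obtain ⟨Q, -, hQ⟩ := h
      refine ⟨∅, by simp, by simp, fun a ha => ?_⟩
      obtain ⟨i, hi, hi', -⟩ := hQ a ha (hF a ha)
      have : i ∈ ({i ∈ W | ψ i = none} : Finset ι) := by simp [hi, hi']
      rw [Finset.card_eq_zero.1 hn] at this
      simp at this
  | succ n ih =>
    intro ψ F hF hψ hn
    by_cases h : Robust W q F ω ψ
    · exact ⟨{ψ}, by simpa using Nat.one_le_pow _ _ (Nat.succ_pos _), by simpa using ⟨h, hψ⟩,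
        fun a ha => ⟨ψ, by simp, hF a ha⟩⟩
    · simp only [Robust, not_forall, not_exists, not_and, not_not] at h
      obtain ⟨Q, hQc, hQ⟩ := h
      have key : ∀ i z, ∃ L : Finset (ι → Option V), i ∈ W → ψ i = none →
          L.card ≤ (W.card * q + 1) ^ n ∧
          (∀ π ∈ L, Robust W q F ω π ∧ ∀ i z, π i = some z → i ∈ W) ∧
          ∀ a ∈ F, ω a i = z → ∃ π ∈ L, ExtendsPartial (ω a) π := by
        intro i z
        by_cases hi : i ∈ W ∧ ψ i = none
        · obtain ⟨L, h1, h2, h3⟩ := ih (Function.update ψ i (some z)) {a ∈ F | ω a i = z}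
            (by
              rintro a ⟨ha, haz⟩ j y hj
              by_cases hji : j = i
              · subst hji
                simp at hj
                rw [haz, hj]
              · rw [Function.update_of_ne hji] at hj
                exact hF a ha j y hj)
            (by
              intro j y hj
              by_cases hji : j = i
              · exact hji ▸ hi.1
              · rw [Function.update_of_ne hji] at hj
                exact hψ j y hj)
            (by
              have : ({j ∈ W | Function.update ψ i (some z) j = none} : Finset ι) =
                  ({j ∈ W | ψ j = none} : Finset ι).erase i := by
                ext j
                by_cases hji : j = i
                · subst hji; simp
                · simp [hji]
              rw [this, Finset.card_erase_of_mem (by simp [hi.1, hi.2]), hn]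
              rfl)
          exact ⟨L, fun _ _ => ⟨h1, fun π hπ => ⟨(h2 π hπ).1.mono le_rfl (fun a ha => ha.1),
            (h2 π hπ).2⟩, fun a ha haz => h3 a ⟨ha, haz⟩⟩⟩
        · exact ⟨∅, fun h1 h2 => absurd ⟨h1, h2⟩ hi⟩
      choose L hL using key
      refine ⟨(({i ∈ W | ψ i = none} : Finset ι) ×ˢ Q).biUnion fun x => L x.1 x.2, ?_, ?_, ?_⟩
      · refine (Finset.card_biUnion_le_card_mul _ _ ((W.card * q + 1) ^ n) ?_).trans ?_
        · rintro ⟨i, z⟩ hx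
          simp only [Finset.mem_product, Finset.mem_filter] at hx
          exact (hL i z hx.1.1 hx.1.2).1
        · rw [pow_succ', Finset.card_product]
          gcongr
          exact (Nat.mul_le_mul (Finset.card_filter_le _ _) hQc).trans (Nat.le_succ _)
      · intro π hπ
        simp only [Finset.mem_biUnion, Finset.mem_product, Finset.mem_filter] at hπ
        obtain ⟨⟨i, z⟩, hx, hπ⟩ := hπ
        exact (hL i z hx.1.1 hx.1.2).2.1 π hπ
      · intro a ha
        obtain ⟨i, hi, hi', hz⟩ := hQ a ha (hF a ha)
        obtain ⟨π, hπ, hπ'⟩ := (hL i (ω a i) hi hi').2.2 a ha rfl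
        refine ⟨π, ?_, hπ'⟩
        simp only [Finset.mem_biUnion, Finset.mem_product, Finset.mem_filter]
        exact ⟨(i, ω a i), ⟨⟨hi, hi'⟩, hz⟩, hπ⟩

/-- Every family of maps has a boundedly large set of robust partial maps such that
each member of the family extends one of them. -/
theorem exists_kernel {α ι V : Type*} (W : Finset ι) (q : ℕ) (ω : α → ι → V) (F : Set α) :
    ∃ L : Finset (ι → Option V), L.card ≤ (W.card * q + 1) ^ W.card ∧
      (∀ π ∈ L, Robust W q F ω π ∧ ∀ i z, π i = some z → i ∈ W) ∧
      ∀ a ∈ F, ∃ π ∈ L, ExtendsPartial (ω a) π :=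
  exists_kernel_extending W q ω W.card (fun _ => none) F (fun _ _ _ _ h => by simp at h)
    (fun _ _ h => by simp at h) (by simp)

/-- A robust family contains a small robust subfamily. -/
theorem Robust.exists_small {α ι V : Type*} [Fintype ι] {F : Set α} {ω : α → ι → V}
    {ψ : ι → Option V} (q : ℕ) (h : Robust Finset.univ (q * Fintype.card ι) F ω ψ) :
    ∃ R : Finset α, ↑R ⊆ F ∧ R.card ≤ q + 1 ∧ Robust Finset.univ q (R : Set α) ω ψ := by
  classical
  induction q with
  | zero =>
    obtain ⟨a, ha, hψ, -⟩ := h ∅ (by simp)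
    refine ⟨{a}, by simpa using ha, by simp, fun Q hQ => ⟨a, by simp, hψ, ?_⟩⟩
    have : Q = ∅ := by simpa using hQ
    simp [this]
  | succ q ih =>
    obtain ⟨R, hRF, hRc, hR⟩ := ih (h.mono (by gcongr; omega) subset_rfl)
    obtain ⟨a, ha, hψ, hav⟩ := h (R.biUnion fun b => Finset.univ.image (ω b)) (by
      refine (Finset.card_biUnion_le_card_mul _ _ (Fintype.card ι) fun b _ =>
        Finset.card_image_le.trans (by simp)).trans ?_
      gcongr)
    refine ⟨insert a R, ?_, (Finset.card_insert_le _ _).trans (by omega), fun Q hQ => ?_⟩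
    · simpa [Set.insert_subset_iff] using ⟨ha, hRF⟩
    by_cases hex : ∃ i, ψ i = none ∧ ω a i ∈ Q
    · obtain ⟨i, hi, hiQ⟩ := hex
      obtain ⟨b, hb, hbψ, hbQ⟩ := hR (Q.erase (ω a i)) (by
        rw [Finset.card_erase_of_mem hiQ]; omega)
      refine ⟨b, by simp at hb ⊢; exact Or.inr hb, hbψ, fun j _ hj hjQ => ?_⟩
      refine hbQ j (by simp) hj (Finset.mem_erase.2 ⟨fun heq => ?_, hjQ⟩)
      refine hav i (by simp) hi ?_
      rw [← heq]
      simp only [Finset.mem_biUnion]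
      exact ⟨b, by simpa using hb, by simp⟩
    · push Not at hex
      exact ⟨a, by simp, hψ, fun i _ hi => hex i hi⟩

theorem exists_const_subset {α P : Type*} {r : ℕ} (hr : 0 < r) (R : Finset P)
    (g : α → P → Fin r) (X : Finset α) (m : ℕ) (h : m * r ^ R.card ≤ X.card) :
    ∃ A ⊆ X, A.card = m ∧ ∃ v : P → Fin r, ∀ a ∈ A, ∀ x ∈ R, g a x = v x := by
  classical
  have : Nonempty (Fin r) := ⟨⟨0, hr⟩⟩
  obtain ⟨y, -, hy⟩ := Finset.exists_le_card_fiber_of_mul_le_card_of_maps_to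
    (s := X) (t := (Finset.univ : Finset (R → Fin r))) (n := m)
    (f := fun a x => g a x) (by simp) Finset.univ_nonempty (by simpa [mul_comm] using h)
  obtain ⟨A, hA, hAc⟩ := Finset.exists_subset_card_eq hy
  refine ⟨A, hA.trans (Finset.filter_subset _ _), hAc,
    fun x => if hx : x ∈ R then y ⟨x, hx⟩ else ⟨0, hr⟩, fun a ha x hx => ?_⟩
  simp only [dif_pos hx, ← (Finset.mem_filter.1 (hA ha)).2]

/-- Given vertices `v ∈ I` carrying a type `θ v`, a tuple `ω v` and a colour vector `w v` on a
large set `X`, there are a large `A ⊆ X` and a colour `h v` for each `v` such that `v` may be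
replaced robustly by some `v'` of the same type whose vector is constantly `h v` on `A`. -/
theorem exists_colour_selection {Θ : Type*} [Fintype Θ] (N q t : ℕ) {r : ℕ} (hr : 0 < r) :
    ∃ m : ℕ, ∀ {V α : Type} (I : Set V) (θ : V → Θ) (ω : V → Fin N → V)
      (w : V → α → Fin r) (X : Finset α), m ≤ X.card →
      ∃ A ⊆ X, A.card = t ∧ ∃ h : V → Fin r, ∀ v ∈ I, ∃ ψ : Fin N → Option V,
        ExtendsPartial (ω v) ψ ∧
        Robust Finset.univ q {v' ∈ I | θ v' = θ v ∧ ∀ a ∈ A, w v' a = h v} ω ψ := by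
  classical
  set q' := r * q with hq'
  set b := (N * (q' * N) + 1) ^ N with hb
  refine ⟨t * r ^ (Fintype.card Θ * (b * (q' + 1))), fun {V α} I θ ω w X hX => ?_⟩
  have hker := fun x : Θ => exists_kernel Finset.univ (q' * N) ω {v ∈ I | θ v = x}
  choose L hLc hLr hLe using hker
  simp only [Finset.card_univ, Fintype.card_fin] at hLc
  have hrep : ∀ (x : Θ) (ψ : Fin N → Option V), ∃ R : Finset V, R.card ≤ q' + 1 ∧
      (ψ ∈ L x → (R : Set V) ⊆ {v ∈ I | θ v = x} ∧
        Robust Finset.univ q' (R : Set V) ω ψ) := by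
    intro x ψ
    by_cases hψ : ψ ∈ L x
    · obtain ⟨R, h1, h2, h3⟩ := Robust.exists_small q' (F := {v ∈ I | θ v = x}) (ω := ω)
        (ψ := ψ) (by rw [Fintype.card_fin]; exact (hLr x ψ hψ).1)
      exact ⟨R, h2, fun _ => ⟨h1, h3⟩⟩
    · exact ⟨∅, by simp, fun h => absurd h hψ⟩
  choose R hRc hR using hrep
  set S : Finset V := Finset.univ.biUnion fun x => (L x).biUnion fun ψ => R x ψ with hS
  have hSc : S.card ≤ Fintype.card Θ * (b * (q' + 1)) := by
    refine Finset.card_biUnion_le_card_mul _ _ _ fun x _ => ?_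
    refine (Finset.card_biUnion_le_card_mul _ _ _ fun ψ _ => hRc x ψ).trans ?_
    gcongr
    exact hLc x
  obtain ⟨A, hAX, hAt, g, hg⟩ := exists_const_subset hr S (fun a v => w v a) X t
    (le_trans (by gcongr) hX)
  refine ⟨A, hAX, hAt, ?_⟩
  have hcol : ∀ v, ∃ k : Fin r, v ∈ I → ∃ ψ : Fin N → Option V, ExtendsPartial (ω v) ψ ∧
      Robust Finset.univ q {v' ∈ I | θ v' = θ v ∧ ∀ a ∈ A, w v' a = k} ω ψ := by
    intro v
    by_cases hv : v ∈ I
    · obtain ⟨ψ, hψL, hψ⟩ := hLe (θ v) v ⟨hv, rfl⟩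
      obtain ⟨hRI, hRr⟩ := hR (θ v) ψ hψL
      by_contra hcon
      push Not at hcon
      have : ∀ k, ∃ Q : Finset V, Q.card ≤ q ∧
          ∀ a ∈ {v' ∈ I | θ v' = θ v ∧ ∀ a ∈ A, w v' a = k}, ExtendsPartial (ω a) ψ →
            ∃ i, ψ i = none ∧ ω a i ∈ Q := by
        intro k
        have := (hcon k).2 ψ hψ
        simpa only [Robust, not_forall, not_exists, not_and, not_not, Finset.mem_univ,
          true_and, exists_prop, forall_true_left] using this
      choose Q hQc hQ using this
      obtain ⟨a, haR, haψ, haQ⟩ := hRr (Finset.univ.biUnion Q) (by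
        refine (Finset.card_biUnion_le_card_mul _ _ q fun k _ => hQc k).trans ?_
        simp [hq'])
      have haS : a ∈ S := by
        simp only [hS, Finset.mem_biUnion, Finset.mem_univ, true_and]
        exact ⟨θ v, ψ, hψL, haR⟩
      obtain ⟨i, hi, hiQ⟩ := hQ (g a) a
        ⟨(hRI haR).1, (hRI haR).2, fun x hx => hg x hx a haS⟩ haψ
      exact haQ i (by simp) hi (by simpa using ⟨_, hiQ⟩)
    · exact ⟨⟨0, hr⟩, fun h => absurd h hv⟩
  choose h hh using hcol
  exact ⟨h, hh⟩

/-- `RootedBranch T x W` : the vertex set `W` spans a subtree of `T` containing `x`, presented by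
successively joining two disjoint rooted subtrees by the edge between their roots. -/
inductive RootedBranch {β : Type*} [DecidableEq β] (T : SimpleGraph β) : β → Finset β → Prop
  | single (x : β) : RootedBranch T x {x}
  | graft {x y : β} {W₁ W₂ : Finset β} : RootedBranch T x W₁ → RootedBranch T y W₂ →
      Disjoint W₁ W₂ → T.Adj x y → (∀ a ∈ W₁, ∀ b ∈ W₂, T.Adj a b → a = x ∧ b = y) →
      RootedBranch T x (W₁ ∪ W₂)

namespace RootedBranch

variable {β : Type*} [DecidableEq β] {T : SimpleGraph β} {x : β} {W : Finset β}

theorem root_mem (h : RootedBranch T x W) : x ∈ W := by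
  induction h with
  | single x => simp
  | graft _ _ _ _ _ ih₁ _ => exact Finset.mem_union_left _ ih₁

theorem attach_leaf (h : RootedBranch T x W) {y z : β} (hy : y ∈ W) (hz : z ∉ W)
    (hyz : T.Adj y z) (huniq : ∀ a ∈ W, T.Adj a z → a = y) : RootedBranch T x (insert z W) := by
  induction h with
  | single x =>
    obtain rfl : y = x := by simpa using hy
    rw [Finset.insert_eq, Finset.union_comm]
    refine graft (single y) (single z) (by simpa using hyz.ne) hyz ?_
    simp
  | @graft x w W₁ W₂ h₁ h₂ hd hxw hu ih₁ ih₂ =>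
    simp only [Finset.mem_union, not_or] at hy hz huniq
    rcases hy with hy | hy
    · rw [← Finset.insert_union]
      refine graft (ih₁ hy hz.1 fun a ha => huniq a (Or.inl ha)) h₂ ?_ hxw ?_
      · exact Finset.disjoint_insert_left.2 ⟨hz.2, hd⟩
      · intro a ha b hb hab
        rcases Finset.mem_insert.1 ha with rfl | ha
        · have := huniq b (Or.inr hb) hab.symm
          subst this
          exact absurd hb (Finset.disjoint_left.1 hd hy)
        · exact hu a ha b hb hab
    · rw [← Finset.union_insert]
      refine graft h₁ (ih₂ hy hz.2 fun a ha => huniq a (Or.inr ha)) ?_ hxw ?_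
      · exact Finset.disjoint_insert_right.2 ⟨hz.1, hd⟩
      · intro a ha b hb hab
        rcases Finset.mem_insert.1 hb with rfl | hb
        · have := huniq a (Or.inl ha) hab
          subst this
          exact absurd hy (Finset.disjoint_left.1 hd ha)
        · exact hu a ha b hb hab

theorem reachable (h : RootedBranch T x W) {H : SimpleGraph β}
    (hH : ∀ a ∈ W, ∀ b ∈ W, T.Adj a b → H.Adj a b) : ∀ a ∈ W, H.Reachable x a := by
  induction h with
  | single x => simp
  | @graft x w W₁ W₂ h₁ h₂ hd hxw hu ih₁ ih₂ =>
    intro a ha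
    rcases Finset.mem_union.1 ha with ha | ha
    · exact ih₁ (fun a ha b hb => hH a (Finset.mem_union_left _ ha) b
        (Finset.mem_union_left _ hb)) a ha
    · refine SimpleGraph.Reachable.trans (SimpleGraph.Adj.reachable ?_)
        (ih₂ (fun a ha b hb => hH a (Finset.mem_union_right _ ha) b
          (Finset.mem_union_right _ hb)) a ha)
      exact hH x (Finset.mem_union_left _ h₁.root_mem) w
        (Finset.mem_union_right _ h₂.root_mem) hxw

theorem univ_of_isTree [Fintype β] (hT : T.IsTree) (x : β) :
    RootedBranch T x Finset.univ := by
  classical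
  obtain ⟨W, hW, hmax⟩ := Finset.exists_max_image
    (Finset.univ.filter fun W : Finset β => RootedBranch T x W) Finset.card
    ⟨{x}, by simpa using single x⟩
  have hW : RootedBranch T x W := by simpa using hW
  by_cases huniv : W = Finset.univ
  · exact huniv ▸ hW
  exfalso
  obtain ⟨z₀, hz₀⟩ : ∃ z, z ∉ W := by
    by_contra h
    push Not at h
    exact huniv (Finset.eq_univ_of_forall h)
  obtain ⟨p⟩ := hT.connected.preconnected x z₀
  obtain ⟨d, -, hd₁, hd₂⟩ := p.exists_boundary_dart (W : Set β)
    (by simpa using hW.root_mem) (by simpa using hz₀)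
  have hz : d.snd ∉ W := by simpa using hd₂
  have hnew := hW.attach_leaf (y := d.fst) (z := d.snd) (by simpa using hd₁) hz d.adj (by
    intro a ha haz
    by_contra hne
    have hbr := SimpleGraph.isAcyclic_iff_forall_adj_isBridge.1 hT.isAcyclic d.adj
    rw [SimpleGraph.isBridge_iff] at hbr
    refine hbr ?_
    have hreach := hW.reachable (H := T \ SimpleGraph.fromEdgeSet {s(d.fst, d.snd)}) (by
      intro a ha b hb hab
      rw [SimpleGraph.sdiff_adj]
      refine ⟨hab, fun h => ?_⟩
      have h := (SimpleGraph.fromEdgeSet_adj _).1 h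
      rcases Sym2.eq_iff.1 (Set.mem_singleton_iff.1 h.1) with h | h
      · exact hz (h.2 ▸ hb)
      · exact hz (h.1 ▸ ha))
    refine ((hreach _ (by simpa using hd₁)).symm.trans (hreach a ha)).trans
      (SimpleGraph.Adj.reachable ?_)
    rw [SimpleGraph.sdiff_adj]
    refine ⟨haz, fun h => ?_⟩
    have h := (SimpleGraph.fromEdgeSet_adj _).1 h
    rcases Sym2.eq_iff.1 (Set.mem_singleton_iff.1 h.1) with h | h
    · exact hne h.1
    · exact hz (h.1 ▸ ha))
  have := hmax (insert d.snd W) (by simpa using hnew)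
  rw [Finset.card_insert_of_notMem hz] at this
  omega

end RootedBranch

/-- `σ` and `B` form a `k`-coloured canonical copy of a blowup of `T[W]`, where the vertex `s`
is blown up to the set `B s ⊆ X (σ s)` of size at least `t`. -/
structure IsMonoBlowup {β V : Type*} {f r : ℕ} (T : SimpleGraph β) (G : SimpleGraph V)
    (c : Sym2 (V × Fin f) → Fin r) (X : V → Finset (Fin f)) (t : ℕ) (W : Finset β) (k : Fin r)
    (σ : β → V) (B : β → Finset (Fin f)) : Prop where
  card_le : ∀ s ∈ W, t ≤ (B s).card
  subset : ∀ s ∈ W, B s ⊆ X (σ s)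
  injOn : Set.InjOn σ W
  adj : ∀ s ∈ W, ∀ s' ∈ W, T.Adj s s' → G.Adj (σ s) (σ s')
  colour : ∀ s ∈ W, ∀ s' ∈ W, T.Adj s s' → ∀ a ∈ B s, ∀ b ∈ B s', c s((σ s, a), (σ s', b)) = k

theorem IsMonoBlowup.hasMonoCanonCopy {β V : Type*} [Fintype β] {f r t : ℕ} {T : SimpleGraph β}
    {G : SimpleGraph V} {c : Sym2 (V × Fin f) → Fin r} {X : V → Finset (Fin f)} {k : Fin r}
    {σ : β → V} {B : β → Finset (Fin f)} (h : IsMonoBlowup T G c X t Finset.univ k σ B) :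
    HasMonoCanonCopy G T f t r c := by
  have hB : ∀ s, ∃ g : Fin t ↪ Fin f, ∀ i, g i ∈ B s := fun s =>
    ⟨(Fin.castLEEmb (h.card_le s (by simp))).trans
      ((B s).orderEmbOfFin rfl).toEmbedding, fun i => by simp⟩
  choose g hg using hB
  exact ⟨σ, fun a b hab => h.injOn (by simp) (by simp) hab, fun s => g s,
    fun s => (g s).injective, k, fun u v huv => ⟨h.adj u (by simp) v (by simp) huv,
      fun i j => h.colour u (by simp) v (by simp) huv _ (hg u i) _ (hg v j)⟩⟩

theorem IsMonoBlowup.graft {β V : Type*} [DecidableEq β] {f r t : ℕ} {T : SimpleGraph β}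
    {G : SimpleGraph V} {c : Sym2 (V × Fin f) → Fin r} {X : V → Finset (Fin f)} {k : Fin r}
    {W₁ W₂ : Finset β} {x y : β}
    {σ₁ σ₂ : β → V} {B₁ B₂ : β → Finset (Fin f)} (h₁ : IsMonoBlowup T G c X t W₁ k σ₁ B₁)
    (h₂ : IsMonoBlowup T G c X t W₂ k σ₂ B₂) (hd : Disjoint W₁ W₂)
    (hu : ∀ a ∈ W₁, ∀ b ∈ W₂, T.Adj a b → a = x ∧ b = y)
    (hdis : ∀ a ∈ W₁, ∀ b ∈ W₂, σ₁ a ≠ σ₂ b) (hadj : G.Adj (σ₁ x) (σ₂ y))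
    (hcol : ∀ a ∈ B₁ x, ∀ b ∈ B₂ y, c s((σ₁ x, a), (σ₂ y, b)) = k) :
    IsMonoBlowup T G c X t (W₁ ∪ W₂) k (fun s => if s ∈ W₁ then σ₁ s else σ₂ s)
      (fun s => if s ∈ W₁ then B₁ s else B₂ s) := by
  have hn : ∀ b ∈ W₂, b ∉ W₁ := fun b hb hb' => Finset.disjoint_left.1 hd hb' hb
  constructor
  · intro s hs
    rcases Finset.mem_union.1 hs with hs | hs
    · simpa [hs] using h₁.card_le s hs
    · simpa [hn s hs] using h₂.card_le s hs
  · intro s hs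
    rcases Finset.mem_union.1 hs with hs | hs
    · simpa [hs] using h₁.subset s hs
    · simpa [hn s hs] using h₂.subset s hs
  · intro a ha b hb hab
    simp only [Finset.coe_union, Set.mem_union, Finset.mem_coe] at ha hb
    rcases ha with ha | ha <;> rcases hb with hb | hb
    · simp only [ha, hb, if_true] at hab
      exact h₁.injOn ha hb hab
    · simp only [ha, hn b hb, if_true, if_false] at hab
      exact absurd hab (hdis a ha b hb)
    · simp only [hb, hn a ha, if_true, if_false] at hab
      exact absurd hab.symm (hdis b hb a ha)
    · simp only [hn a ha, hn b hb, if_false] at hab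
      exact h₂.injOn ha hb hab
  · intro a ha b hb hab
    rcases Finset.mem_union.1 ha with ha | ha <;> rcases Finset.mem_union.1 hb with hb | hb
    · simpa only [ha, hb, if_true] using h₁.adj a ha b hb hab
    · obtain ⟨rfl, rfl⟩ := hu a ha b hb hab
      simpa only [ha, hn b hb, if_true, if_false] using hadj
    · obtain ⟨rfl, rfl⟩ := hu b hb a ha hab.symm
      simpa only [hb, hn a ha, if_true, if_false] using hadj.symm
    · simpa only [hn a ha, hn b hb, if_false] using h₂.adj a ha b hb hab
  · intro a ha b hb hab
    rcases Finset.mem_union.1 ha with ha | ha <;> rcases Finset.mem_union.1 hb with hb | hb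
    · simpa only [ha, hb, if_true] using h₁.colour a ha b hb hab
    · obtain ⟨rfl, rfl⟩ := hu a ha b hb hab
      simpa only [ha, hn b hb, if_true, if_false] using hcol
    · obtain ⟨rfl, rfl⟩ := hu b hb a ha hab.symm
      simp only [hb, hn a ha, if_true, if_false]
      intro i hi j hj
      rw [Sym2.eq_swap]
      exact hcol j hj i hi
    · simpa only [hn a ha, hn b hb, if_false] using h₂.colour a ha b hb hab

theorem isMonoBlowup_singleton {β V : Type*} {f r t : ℕ} {T : SimpleGraph β}
    {G : SimpleGraph V} {c : Sym2 (V × Fin f) → Fin r} {X : V → Finset (Fin f)} {k : Fin r}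
    (x : β) {σ : β → V} {B : β → Finset (Fin f)} (hc : t ≤ (B x).card) (hs : B x ⊆ X (σ x)) :
    IsMonoBlowup T G c X t {x} k σ B := by
  constructor <;> simp_all

/-- A relation with many pairs contains a nonempty part of large minimum degree on both sides. -/
theorem exists_bipartite_core {V : Type*} [DecidableEq V] (E : V → V → Prop)
    [∀ u v, Decidable (E u v)] (K : ℕ) (n : ℕ) : ∀ P Q : Finset V, P.card + Q.card = n →
    K * n < ∑ u ∈ P, (Q.filter fun v => E u v).card →
    ∃ P' Q' : Finset V, P'.Nonempty ∧ (∀ u ∈ P', K < (Q'.filter fun v => E u v).card) ∧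
      ∀ v ∈ Q', K < (P'.filter fun u => E u v).card := by
  induction n with
  | zero =>
    intro P Q h hlt
    have : P = ∅ := Finset.card_eq_zero.1 (by omega)
    simp [this] at hlt
  | succ n ih =>
    intro P Q h hlt
    by_cases h₁ : ∃ u ∈ P, (Q.filter fun v => E u v).card ≤ K
    · obtain ⟨u, hu, huK⟩ := h₁
      refine ih (P.erase u) Q (by
        have := Finset.card_erase_add_one hu
        omega) ?_
      rw [← Finset.add_sum_erase P _ hu, Nat.mul_succ] at hlt
      omega
    by_cases h₂ : ∃ v ∈ Q, (P.filter fun u => E u v).card ≤ K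
    · obtain ⟨v, hv, hvK⟩ := h₂
      refine ih P (Q.erase v) (by
        have := Finset.card_erase_add_one hv
        omega) ?_
      have hswap : ∀ R : Finset V, ∑ u ∈ P, (R.filter fun v => E u v).card =
          ∑ v ∈ R, (P.filter fun u => E u v).card := fun R =>
        Finset.sum_card_bipartiteAbove_eq_sum_card_bipartiteBelow E
      rw [hswap, ← Finset.add_sum_erase Q _ hv, Nat.mul_succ] at hlt
      rw [hswap]
      omega
    push Not at h₁ h₂
    refine ⟨P, Q, ?_, h₁, h₂⟩
    rw [Finset.nonempty_iff_ne_empty]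
    rintro rfl
    simp at hlt

/-- A tree blowup embeds greedily into a bipartite relation of large minimum degree all of whose
edges are completely `k`-coloured between the fixed sets `A` and `B`. -/
theorem RootedBranch.exists_isMonoBlowup_of_core {β V : Type*} [DecidableEq β] {f r : ℕ}
    {T : SimpleGraph β} {G : SimpleGraph V} {c : Sym2 (V × Fin f) → Fin r} {t : ℕ} {k : Fin r}
    {x : β} {W : Finset β} (h : RootedBranch T x W) [DecidableEq V] (K : ℕ) :
    ∀ (A B : Finset (Fin f)) (P Q : Finset V) (E : V → V → Prop) [∀ u v, Decidable (E u v)],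
    t ≤ A.card → t ≤ B.card →
    (∀ u v, E u v → G.Adj u v ∧ ∀ a ∈ A, ∀ b ∈ B, c s((u, a), (v, b)) = k) →
    (∀ u ∈ P, K < (Q.filter fun v => E u v).card) →
    (∀ v ∈ Q, K < (P.filter fun u => E u v).card) →
    ∀ u ∈ P, ∀ Z : Finset V, Z.card + W.card ≤ K →
    ∃ σ g, IsMonoBlowup T G c (fun _ => Finset.univ) t W k σ g ∧ σ x = u ∧ g x = A ∧
      ∀ s ∈ W, s ≠ x → σ s ∉ Z := by
  induction h with
  | single x =>
    intro A B P Q E _ hA hB hE hP hQ u hu Z hZ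
    exact ⟨fun _ => u, fun _ => A, isMonoBlowup_singleton x hA (by simp), rfl, rfl, by simp⟩
  | @graft x y W₁ W₂ h₁ h₂ hd hxy huniq ih₁ ih₂ =>
    intro A B P Q E _ hA hB hE hP hQ u hu Z hZ
    rw [Finset.card_union_of_disjoint hd] at hZ
    obtain ⟨σ₁, g₁, hm₁, hσ₁, hg₁, hZ₁⟩ := ih₁ A B P Q E hA hB hE hP hQ u hu Z (by omega)
    have hZ' : (Z ∪ W₁.image σ₁).card ≤ Z.card + W₁.card :=
      (Finset.card_union_le _ _).trans (by gcongr; exact Finset.card_image_le)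
    obtain ⟨v, hv, hvZ⟩ := Finset.exists_mem_notMem_of_card_lt_card
      (s := Z ∪ W₁.image σ₁) (t := Q.filter fun v => E u v)
      (lt_of_le_of_lt (by omega) (hP u hu))
    rw [Finset.mem_filter] at hv
    obtain ⟨σ₂, g₂, hm₂, hσ₂, hg₂, hZ₂⟩ := ih₂ B A Q P (fun v u => E u v) hB hA
      (fun v u huv => ⟨(hE u v huv).1.symm, fun b hb a ha => by
        rw [Sym2.eq_swap]; exact (hE u v huv).2 a ha b hb⟩) hQ hP v hv.1 (Z ∪ W₁.image σ₁)
      (by omega)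
    have hout : ∀ s ∈ W₂, σ₂ s ∉ Z ∪ W₁.image σ₁ := by
      intro s hs
      by_cases hsy : s = y
      · rw [hsy, hσ₂]; exact hvZ
      · exact hZ₂ s hs hsy
    have hx := h₁.root_mem
    refine ⟨_, _, hm₁.graft hm₂ hd huniq ?_ ?_ ?_, by simpa [hx] using hσ₁,
      by simpa [hx] using hg₁, ?_⟩
    · intro a ha b hb hab
      exact hout b hb (Finset.mem_union_right _ (hab ▸ Finset.mem_image_of_mem _ ha))
    · rw [hσ₁, hσ₂]; exact (hE u v hv.2).1
    · rw [hσ₁, hσ₂, hg₁, hg₂]; exact (hE u v hv.2).2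
    · intro s hs hsx
      by_cases hs₁ : s ∈ W₁
      · simpa [hs₁] using hZ₁ s hs₁ hsx
      · have hs₂ : s ∈ W₂ := by simpa [hs₁] using hs
        simp only [hs₁, if_false]
        exact fun hh => hout s hs₂ (Finset.mem_union_left _ hh)

/-- Every `r`-colouring of a large complete bipartite graph contains a monochromatic
complete bipartite graph with parts of size `t`. -/
theorem exists_mono_biclique {r : ℕ} (hr : 0 < r) (t : ℕ) :
    ∃ m : ℕ, ∀ d : Fin m → Fin m → Fin r, ∃ A B : Finset (Fin m), ∃ k : Fin r,
      A.card = t ∧ B.card = t ∧ ∀ a ∈ A, ∀ b ∈ B, d a b = k := by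
  refine ⟨t * r + t * r ^ (t * r), fun d => ?_⟩
  obtain ⟨A₀, -, hA₀⟩ := Finset.exists_subset_card_eq
    (s := (Finset.univ : Finset (Fin (t * r + t * r ^ (t * r))))) (n := t * r) (by simp)
  obtain ⟨B, -, hB, v, hv⟩ := exists_const_subset hr A₀ (fun b a => d a b) Finset.univ t
    (by rw [hA₀]; simp)
  obtain ⟨A, hA, hAc, k, hk⟩ := exists_const_subset hr ({()} : Finset Unit)
    (fun a _ => v a) A₀ t (by rw [hA₀]; simp)
  refine ⟨A, B, k (), hAc, hB, fun a ha b hb => ?_⟩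
  rw [hv b hb a (hA ha)]
  exact hk a ha () (by simp)

/-- If `G` has a nonempty vertex set inducing a subgraph of large minimum degree then every
colouring of a large blowup of `G` contains a monochromatic canonical blowup of a tree. -/
theorem exists_hasMonoCanonCopy_of_dense {β : Type*} [Fintype β] {T : SimpleGraph β}
    (hT : T.IsTree) {r : ℕ} (hr : 0 < r) (t : ℕ) :
    ∃ m D : ℕ, ∀ f, m ≤ f → ∀ {V : Type} (G : SimpleGraph V)
      (c : Sym2 (V × Fin f) → Fin r) (S : Finset V), S.Nonempty →
      (∀ u ∈ S, ∃ N ⊆ S, (∀ v ∈ N, G.Adj u v) ∧ D < N.card) →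
      HasMonoCanonCopy G T f t r c := by
  classical
  obtain ⟨m, hm⟩ := exists_mono_biclique hr t
  let τ := Finset (Fin m) × Finset (Fin m) × Fin r
  refine ⟨m, Fintype.card τ * (2 * Fintype.card β), fun f hf {V} G c S hS hdeg => ?_⟩
  have hAB : ∀ u v : V, ∃ e : τ, e.1.card = t ∧ e.2.1.card = t ∧ ∀ a ∈ e.1, ∀ b ∈ e.2.1,
      c s((u, Fin.castLE hf a), (v, Fin.castLE hf b)) = e.2.2 := fun u v => by
    obtain ⟨A, B, k, h⟩ := hm fun a b => c s((u, Fin.castLE hf a), (v, Fin.castLE hf b))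
    exact ⟨(A, B, k), h⟩
  choose e heA heB hec using hAB
  let E : τ → V → V → Prop := fun i u v => G.Adj u v ∧ e u v = i
  have hsum : ∑ _i : τ, (2 * Fintype.card β) * S.card <
      ∑ i : τ, ∑ u ∈ S, (S.filter fun v => E i u v).card := by
    rw [Finset.sum_comm, Finset.sum_const, smul_eq_mul, Finset.card_univ, ← mul_assoc,
      mul_comm _ S.card, ← smul_eq_mul S.card, ← Finset.sum_const]
    refine Finset.sum_lt_sum_of_nonempty hS fun u hu => ?_
    obtain ⟨N, hNS, hNadj, hN⟩ := hdeg u hu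
    refine hN.trans_le ?_
    rw [Finset.card_eq_sum_card_fiberwise (f := fun v => e u v) (t := Finset.univ) (by simp)]
    refine Finset.sum_le_sum fun i _ => Finset.card_le_card fun v hv => ?_
    simp only [Finset.mem_filter] at hv ⊢
    exact ⟨hNS hv.1, hNadj v hv.1, hv.2⟩
  obtain ⟨i, -, hi⟩ := Finset.exists_lt_of_sum_lt hsum
  obtain ⟨P, Q, ⟨u, hu⟩, hP, hQ⟩ := exists_bipartite_core (E i) (Fintype.card β)
    (S.card + S.card) S S rfl (by rw [← two_mul, ← mul_assoc, mul_comm _ 2]; exact hi)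
  obtain ⟨v₀, hv₀⟩ := Finset.card_pos.1 (lt_of_le_of_lt (Nat.zero_le _) (hP u hu))
  obtain rfl : e u v₀ = i := (Finset.mem_filter.1 hv₀).2.2
  obtain ⟨x⟩ := hT.connected.nonempty
  obtain ⟨σ, g, h, -⟩ := (RootedBranch.univ_of_isTree hT x).exists_isMonoBlowup_of_core
    (G := G) (c := c) (t := t) (k := (e u v₀).2.2) (Fintype.card β)
    ((e u v₀).1.map (Fin.castLEEmb hf)) ((e u v₀).2.1.map (Fin.castLEEmb hf)) P Q
    (E (e u v₀)) (by simp [heA]) (by simp [heB])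
    (by
      rintro a b ⟨hab, heq⟩
      refine ⟨hab, ?_⟩
      simp only [Finset.mem_map, Fin.castLEEmb_apply]
      rintro _ ⟨i, hi, rfl⟩ _ ⟨j, hj, rfl⟩
      rw [← heq] at hi hj ⊢
      exact hec a b i hi j hj)
    hP hQ u hu ∅ (by simp)
  exact h.hasMonoCanonCopy

/-- If no nonempty vertex set induces a subgraph of minimum degree greater than `D`, the vertices
can be ranked such that each has at most `D` neighbours of smaller rank. -/
theorem exists_degenerate_rank {V : Type*} (G : SimpleGraph V) (D : ℕ)
    (h : ∀ S : Finset V, S.Nonempty → ∃ u ∈ S, ∀ N ⊆ S, (∀ v ∈ N, G.Adj u v) → N.card ≤ D)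
    (n : ℕ) : ∀ S : Finset V, S.card = n → ∃ rk : V → ℕ, (∀ v ∈ S, rk v < n) ∧
      Set.InjOn rk S ∧
      ∀ v ∈ S, ∀ N ⊆ S, (∀ u ∈ N, G.Adj v u ∧ rk u < rk v) → N.card ≤ D := by
  classical
  induction n with
  | zero =>
    intro S hS
    obtain rfl := Finset.card_eq_zero.1 hS
    exact ⟨fun _ => 0, by simp⟩
  | succ n ih =>
    intro S hS
    obtain ⟨u, hu, hdeg⟩ := h S (Finset.card_pos.1 (by omega))
    obtain ⟨rk, hlt, hinj, hrk⟩ := ih (S.erase u) (by rw [Finset.card_erase_of_mem hu]; omega)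
    have hother : ∀ v ∈ S, v ≠ u → Function.update rk u n v < n := fun v hv hvu => by
      rw [Function.update_of_ne hvu]
      exact hlt v (Finset.mem_erase.2 ⟨hvu, hv⟩)
    refine ⟨Function.update rk u n, fun v hv => ?_, fun a ha b hb hab => ?_,
      fun v hv N hNS hN => ?_⟩
    · by_cases hvu : v = u
      · simp [hvu]
      · exact (hother v hv hvu).trans (Nat.lt_succ_self n)
    · by_cases hau : a = u <;> by_cases hbu : b = u
      · rw [hau, hbu]
      · have := hother b hb hbu
        rw [← hab, hau] at this
        simp at this
      · have := hother a ha hau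
        rw [hab, hbu] at this
        simp at this
      · rw [Function.update_of_ne hau, Function.update_of_ne hbu] at hab
        exact hinj (by simpa [hau] using ha) (by simpa [hbu] using hb) hab
    · by_cases hvu : v = u
      · exact hdeg N hNS fun w hw => hvu ▸ (hN w hw).1
      · have hNu : ∀ w ∈ N, w ≠ u := by
          rintro w hw rfl
          have h₁ := (hN w hw).2
          have h₂ := hother v hv hvu
          rw [Function.update_self] at h₁
          omega
        refine hrk v (Finset.mem_erase.2 ⟨hvu, hv⟩) N
          (fun w hw => Finset.mem_erase.2 ⟨hNu w hw, hNS hw⟩) fun w hw => ⟨(hN w hw).1, ?_⟩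
        have := (hN w hw).2
        rwa [Function.update_of_ne hvu, Function.update_of_ne (hNu w hw)] at this

/-- In a blowup of a graph with a degenerate ranking one can shrink the parts so that the colour of
an edge depends only on its endpoint in the part of smaller rank. -/
theorem exists_clean_parts {V : Type*} [Fintype V] {f r : ℕ} (hr : 0 < r) (G : SimpleGraph V)
    (c : Sym2 (V × Fin f) → Fin r) (rk : V → ℕ) (D m : ℕ)
    (hD : ∀ v, ∀ N : Finset V, (∀ u ∈ N, G.Adj v u ∧ rk u < rk v) → N.card ≤ D)
    (hf : m * r ^ (D * m) ≤ f) :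
    ∃ (X : V → Finset (Fin f)) (w : V → V → Fin f → Fin r), (∀ v, (X v).card = m) ∧
      ∀ u v, G.Adj u v → rk u < rk v → ∀ a ∈ X u, ∀ b ∈ X v, c s((u, a), (v, b)) = w u v a := by
  classical
  have key : ∀ n : ℕ, ∃ (X : V → Finset (Fin f)) (w : V → V → Fin f → Fin r),
      (∀ v, rk v < n → (X v).card = m) ∧ ∀ u v, rk v < n → G.Adj u v → rk u < rk v →
        ∀ a ∈ X u, ∀ b ∈ X v, c s((u, a), (v, b)) = w u v a := by
    intro n
    induction n with
    | zero => exact ⟨fun _ => ∅, fun _ _ _ => ⟨0, hr⟩, by simp, by simp⟩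
    | succ n ih =>
      obtain ⟨X, w, hX, hw⟩ := ih
      have hstep : ∀ v, ∃ Y : Finset (Fin f), ∃ y : V × Fin f → Fin r, rk v = n →
          Y.card = m ∧ ∀ b ∈ Y, ∀ u, G.Adj u v → rk u < rk v → ∀ a ∈ X u,
            c s((u, a), (v, b)) = y (u, a) := by
        intro v
        by_cases hv : rk v = n
        · obtain ⟨Y, -, hY, y, hy⟩ := exists_const_subset hr
            ((Finset.univ.filter fun u => G.Adj v u ∧ rk u < rk v).biUnion
              fun u => (X u).image (Prod.mk u))
            (fun b x => c s(x, (v, b))) Finset.univ m (by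
              refine le_trans ?_ (hf.trans (by simp))
              gcongr
              refine (Finset.card_biUnion_le_card_mul _ _ m fun u hu => ?_).trans ?_
              · simp only [Finset.mem_filter, Finset.mem_univ, true_and] at hu
                exact Finset.card_image_le.trans (hX u (hv ▸ hu.2)).le
              · gcongr
                exact hD v _ (by simp))
          refine ⟨Y, y, fun _ => ⟨hY, fun b hb u huv hlt a ha => hy b hb (u, a) ?_⟩⟩
          simp only [Finset.mem_biUnion, Finset.mem_filter, Finset.mem_univ, true_and]
          exact ⟨u, ⟨huv.symm, hlt⟩, Finset.mem_image_of_mem _ ha⟩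
        · exact ⟨∅, fun _ => ⟨0, hr⟩, fun h => absurd h hv⟩
      choose Y y hY using hstep
      refine ⟨fun v => if rk v = n then Y v else X v,
        fun u v a => if rk v = n then y v (u, a) else w u v a, fun v hv => ?_,
        fun u v hv huv hlt => ?_⟩
      · by_cases hvn : rk v = n
        · simpa [hvn] using (hY v hvn).1
        · simpa [hvn] using hX v (by omega)
      · have hun : rk u ≠ n := by omega
        by_cases hvn : rk v = n
        · simp only [hvn, hun, if_true, if_false]
          exact fun a ha b hb => (hY v hvn).2 b hb u huv hlt a ha
        · simp only [hvn, hun, if_false]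
          exact hw u v (by omega) huv hlt
  obtain ⟨X, w, hX, hw⟩ := key (Finset.univ.sup rk + 1)
  have hle : ∀ v, rk v < Finset.univ.sup rk + 1 := fun v =>
    Nat.lt_succ_of_le (Finset.le_sup (Finset.mem_univ v))
  exact ⟨X, w, fun v => hX v (hle v), fun u v => hw u v (hle v)⟩

theorem exists_robustness_thresholds (P : ℕ) : ∃ (q κ : ℕ → ℕ) (M : ℕ),
    (∀ a b, a < b → b ≤ P →
      q b + P ≤ q a ∧ q b + P ≤ κ a ∧ P * (P * κ a + 1) ^ P ≤ q a) ∧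
    ∀ a, q a + P ≤ M ∧ κ a ≤ M := by
  let R : ℕ → ℕ := fun n => Nat.rec 0 (fun _ x => x + P + P * (P * (x + P) + 1) ^ P) n
  have hR : ∀ n, R (n + 1) = R n + P + P * (P * (R n + P) + 1) ^ P := fun n => rfl
  have hmono : Monotone R := monotone_nat_of_le_succ fun n => by rw [hR]; omega
  refine ⟨fun a => R (P - a), fun a => R (P - a - 1) + P, R P + P, fun a b hab hb => ?_,
    fun a => ⟨Nat.add_le_add_right (hmono (by omega)) _,
      Nat.add_le_add_right (hmono (by omega)) _⟩⟩
  obtain ⟨n, hn⟩ : ∃ n, P - a = n + 1 := ⟨P - a - 1, by omega⟩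
  have hbn : R (P - b) ≤ R n := hmono (by omega)
  have := hR n
  simp only [hn, Nat.add_sub_cancel]
  refine ⟨by omega, by omega, by omega⟩

/-- The set of values on `W` of a partial map. -/
theorem exists_values_finset {ι V : Type*} (W : Finset ι) (π : ι → Option V) :
    ∃ Q : Finset V, Q.card ≤ W.card ∧ ∀ s ∈ W, ∀ z, π s = some z → z ∈ Q := by
  classical
  refine ⟨W.biUnion fun s => (π s).toFinset, ?_, fun s hs z hz => ?_⟩
  · refine (Finset.card_biUnion_le_card_mul _ _ 1 fun s _ => ?_).trans (by simp)
    cases π s <;> simp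
  · simp only [Finset.mem_biUnion]
    exact ⟨s, hs, by simp [hz]⟩

theorem exists_values_finset_of_finset {ι V : Type*} (W : Finset ι) (L : Finset (ι → Option V)) :
    ∃ Q : Finset V, Q.card ≤ L.card * W.card ∧
      ∀ π ∈ L, ∀ s ∈ W, ∀ z, π s = some z → z ∈ Q := by
  classical
  choose Q hQ hQ' using fun π : ι → Option V => exists_values_finset W π
  refine ⟨L.biUnion Q, Finset.card_biUnion_le_card_mul _ _ _ fun π _ => hQ π,
    fun π hπ s hs z hz => ?_⟩
  exact Finset.mem_biUnion.2 ⟨π, hπ, hQ' π s hs z hz⟩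

/-- If a subfamily of `F` is robust around `π₂` then some member of a kernel of `F` is a
restriction of `π₂`. -/
theorem exists_mem_kernel_le {ι V : Type*} {W : Finset ι} {q : ℕ} {E F : Set (ι → V)}
    {π₂ : ι → Option V} {L : Finset (ι → Option V)} (h : Robust W q E id π₂) (hEF : E ⊆ F)
    (hL : ∀ π ∈ L, ∀ s z, π s = some z → s ∈ W)
    (hcov : ∀ σ ∈ F, ∃ π ∈ L, ExtendsPartial σ π) (hc : L.card * W.card ≤ q) :
    ∃ π ∈ L, ∀ s z, π s = some z → π₂ s = some z := by
  obtain ⟨Q, hQ, hQ'⟩ := exists_values_finset_of_finset W L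
  obtain ⟨σ, hσ, hσ₂, hav⟩ := h Q (hQ.trans hc)
  obtain ⟨π, hπ, hσπ⟩ := hcov σ (hEF hσ)
  refine ⟨π, hπ, fun s z hz => ?_⟩
  have hs := hL π hπ s z hz
  have hσz : σ s = z := hσπ s z hz
  cases hs₂ : π₂ s with
  | none => exact absurd (hQ' π hπ s hs z hz) (hσz ▸ hav s hs hs₂)
  | some z' => rw [← hσz, ← hσ₂ s z' hs₂]; rfl

/-- Switching `v` robustly among vertices of the same type preserves robustness. -/
theorem Robust.switch {ι V : Type*} {N q n M : ℕ} {W : Finset ι} {J : Set V}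
    {ω : V → Fin N → V} {v : V} {ψ : Fin N → Option V} {Fam : V → Set (ι → V)}
    {L : V → Finset (ι → Option V)} (hψ : ExtendsPartial (ω v) ψ)
    (hJ : Robust Finset.univ M J ω ψ) (hn : n ≤ M) (hnq : n ≤ q) {π₀ : ι → Option (Fin N)}
    (hL : ∀ v' ∈ J, (fun s => (π₀ s).map (ω v')) ∈ L v')
    (hrob : ∀ v' ∈ J, ∀ π ∈ L v', Robust W q (Fam v') id π) :
    ∃ π' : ι → Option V, (∀ s z, π' s = some z → (π₀ s).map (ω v) = some z) ∧
      Robust W n {σ | ∃ v' ∈ J, σ ∈ Fam v'} id π' := by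
  refine ⟨fun s => (π₀ s).bind ψ, fun s z hz => ?_, fun Q hQ => ?_⟩
  · obtain ⟨i, hi, hiz⟩ := Option.bind_eq_some_iff.1 hz
    simp [hi, hψ i z hiz]
  · obtain ⟨v', hv', hext, hav⟩ := hJ Q (hQ.trans hn)
    obtain ⟨σ, hσ, hσe, hσa⟩ := hrob v' hv' _ (hL v' hv') Q (hQ.trans hnq)
    refine ⟨σ, ⟨v', hv', hσ⟩, fun s z hz => ?_, fun s hs hz => ?_⟩
    · obtain ⟨i, hi, hiz⟩ := Option.bind_eq_some_iff.1 hz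
      exact hσe s z (by simp [hi, hext i z hiz])
    · cases hi : π₀ s with
      | none => exact hσa s hs (by simp [hi])
      | some i =>
        have : ω v' i ∉ Q := hav i (by simp) (by simpa [hi] using hz)
        rwa [← hσe s (ω v' i) (by simp [hi])] at this

theorem exists_enumeration {V : Type*} [Nonempty V] {N : ℕ} (S : Finset V) (h : S.card ≤ N) :
    ∃ ω : Fin N → V, ∀ z ∈ S, ∃ i, ω i = z := by
  classical
  refine ⟨fun i => if hi : i.1 < S.card then (S.equivFin.symm ⟨i, hi⟩).1 else Classical.arbitrary V,
    fun z hz => ⟨⟨S.equivFin ⟨z, hz⟩, (S.equivFin ⟨z, hz⟩).2.trans_le h⟩, by simp⟩⟩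

/-- Boundedly many kernels can be encoded by one tuple of bounded length. -/
theorem exists_enumeration_kernels {ι V κ : Type*} [Fintype ι] [Fintype κ] [Nonempty V] {n : ℕ}
    (L : κ → Finset (ι → Option V)) (hL : ∀ x, (L x).card ≤ n) :
    ∃ ω : Fin (Fintype.card κ * (n * Fintype.card ι)) → V, ∀ x, ∀ π ∈ L x,
      ∃ π₀ : ι → Option (Fin (Fintype.card κ * (n * Fintype.card ι))),
        π = fun s => (π₀ s).map ω := by
  classical
  choose Q hQ hQ' using fun x => exists_values_finset_of_finset Finset.univ (L x)
  obtain ⟨ω, hω⟩ := exists_enumeration (N := Fintype.card κ * (n * Fintype.card ι))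
    (Finset.univ.biUnion Q) (by
      refine (Finset.card_biUnion_le_card_mul _ _ _ fun x _ => (hQ x).trans
        (Nat.mul_le_mul_right _ (hL x))).trans (by simp))
  refine ⟨ω, fun x π hπ => ?_⟩
  have : ∀ s, ∃ o : Option (Fin (Fintype.card κ * (n * Fintype.card ι))), π s = o.map ω := by
    intro s
    cases hs : π s with
    | none => exact ⟨none, rfl⟩
    | some z =>
      obtain ⟨i, hi⟩ := hω z (Finset.mem_biUnion.2 ⟨x, by simp, hQ' x π hπ s (by simp) z hs⟩)
      exact ⟨some i, by simp [hi]⟩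
  choose π₀ hπ₀ using this
  exact ⟨π₀, funext hπ₀⟩

/-- If robust families of blown-up branches can be moved across every edge of a host graph, then
every monochromatic copy of `T[W]` in the host graph yields a robust family of blowups of
`T[W]`. -/
theorem RootedBranch.exists_robust {β V : Type*} [Fintype β] [DecidableEq β] {f r t : ℕ}
    {T : SimpleGraph β} {G : SimpleGraph V} {c : Sym2 (V × Fin f) → Fin r}
    {X A : V → Finset (Fin f)} {χ : Sym2 V → Fin r} {q κ : ℕ → ℕ} {M : ℕ}
    (hq : ∀ a b, a < b → b ≤ Fintype.card β →
      q b + Fintype.card β ≤ q a ∧ q b + Fintype.card β ≤ κ a)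
    (hM : ∀ a, q a + Fintype.card β ≤ M) (hA : ∀ u, t ≤ (A u).card) (hAX : ∀ u, A u ⊆ X u)
    (hedge : ∀ u v k y W π, G.Adj u v → χ s(u, v) = k → y ∈ W →
      W.card < Fintype.card β →
      Robust W (q W.card)
        {σ | ∃ B, IsMonoBlowup T G c X t W k σ B ∧ σ y = v ∧ B y = A v} id π →
      ∀ n, n ≤ M → n ≤ κ W.card → ∃ π', (∀ s z, π' s = some z → π s = some z) ∧
        Robust W n {σ | ∃ B, IsMonoBlowup T G c X t W k σ B ∧ G.Adj u (σ y) ∧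
          ∀ a ∈ A u, ∀ b ∈ B y, c s((u, a), (σ y, b)) = k} id π')
    {k : Fin r} {σ : β → V} {x : β} {W : Finset β} (hW : RootedBranch T x W)
    (hinj : Set.InjOn σ W) (hadj : ∀ a ∈ W, ∀ b ∈ W, T.Adj a b →
      G.Adj (σ a) (σ b) ∧ χ s(σ a, σ b) = k) :
    ∃ π : β → Option V, (∀ s z, π s = some z → s ∈ W ∧ σ s = z) ∧
      Robust W (q W.card)
        {σ' | ∃ B, IsMonoBlowup T G c X t W k σ' B ∧ σ' x = σ x ∧ B x = A (σ x)} id π := by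
  classical
  induction hW with
  | single x =>
    refine ⟨fun s => if s = x then some (σ x) else none, fun s z hz => ?_, fun Q _ =>
      ⟨fun _ => σ x, ⟨fun _ => A (σ x), isMonoBlowup_singleton x (hA _) (hAX _), rfl, rfl⟩,
        fun s z hz => ?_, fun s hs hz => ?_⟩⟩
    · dsimp only at hz
      split_ifs at hz with h
      subst h
      exact ⟨by simp, by simpa using hz⟩
    · dsimp only at hz
      split_ifs at hz with h
      simpa using hz
    · simp [Finset.mem_singleton.1 hs] at hz
  | @graft x y W₁ W₂ h₁ h₂ hd hxy hu ih₁ ih₂ =>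
    obtain ⟨π₁, hπ₁, hr₁⟩ := ih₁ (hinj.mono (by simp)) fun a ha b hb =>
      hadj a (Finset.mem_union_left _ ha) b (Finset.mem_union_left _ hb)
    obtain ⟨π₂, hπ₂, hr₂⟩ := ih₂ (hinj.mono (by simp)) fun a ha b hb =>
      hadj a (Finset.mem_union_right _ ha) b (Finset.mem_union_right _ hb)
    have hx := h₁.root_mem
    have hy := h₂.root_mem
    obtain ⟨hGxy, hχ⟩ := hadj x (Finset.mem_union_left _ hx) y (Finset.mem_union_right _ hy) hxy
    have hcard : (W₁ ∪ W₂).card = W₁.card + W₂.card := Finset.card_union_of_disjoint hd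
    have hc₁ : 0 < W₁.card := Finset.card_pos.2 ⟨x, hx⟩
    have hc₂ : 0 < W₂.card := Finset.card_pos.2 ⟨y, hy⟩
    have hle : (W₁ ∪ W₂).card ≤ Fintype.card β := Finset.card_le_univ _
    have hq₁ := (hq W₁.card (W₁ ∪ W₂).card (by omega) hle).1
    have hκ₂ := (hq W₂.card (W₁ ∪ W₂).card (by omega) hle).2
    obtain ⟨π₃, hπ₃, hr₃⟩ := hedge _ _ k y W₂ π₂ hGxy hχ hy (by omega) hr₂
      (q (W₁ ∪ W₂).card + Fintype.card β) (hM _) hκ₂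
    have hn : ∀ b ∈ W₂, b ∉ W₁ := fun b hb hb' => Finset.disjoint_left.1 hd hb' hb
    refine ⟨fun s => if s ∈ W₁ then π₁ s else π₃ s, fun s z hz => ?_, fun Q hQ => ?_⟩
    · dsimp only at hz
      split_ifs at hz with h
      · exact ⟨Finset.mem_union_left _ h, (hπ₁ s z hz).2⟩
      · exact ⟨Finset.mem_union_right _ (hπ₂ s z (hπ₃ s z hz)).1, (hπ₂ s z (hπ₃ s z hz)).2⟩
    have hcu : ∀ (τ : β → V) (U : Finset β),
        (Q ∪ U.image τ).card ≤ q (W₁ ∪ W₂).card + Fintype.card β := fun τ U =>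
      (Finset.card_union_le _ _).trans (Nat.add_le_add hQ
        (Finset.card_image_le.trans (Finset.card_le_univ _)))
    obtain ⟨σ₂, ⟨B₂, hB₂, hG₂, hc₂⟩, hext₂, hav₂⟩ := hr₃ (Q ∪ W₁.image σ) (hcu σ W₁)
    obtain ⟨σ₁, ⟨B₁, hB₁, hσ₁, hBx⟩, hext₁, hav₁⟩ :=
      hr₁ (Q ∪ W₂.image σ₂) ((hcu σ₂ W₂).trans hq₁)
    simp only [id, Finset.mem_union, not_or] at hext₁ hext₂ hav₁ hav₂
    refine ⟨_, ⟨_, hB₁.graft hB₂ hd hu ?_ (hσ₁ ▸ hG₂) ?_, ?_, ?_⟩, ?_, ?_⟩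
    · intro a ha b hb hab
      cases h : π₁ a with
      | none => exact (hav₁ a ha h).2 (hab ▸ Finset.mem_image_of_mem _ hb)
      | some z =>
        have ha' : σ₁ a = σ a := (hext₁ a z h).trans (hπ₁ a z h).2.symm
        cases h' : π₃ b with
        | none => exact (hav₂ b hb h').2 (by
            rw [← hab, ha']; exact Finset.mem_image_of_mem _ ha)
        | some z' =>
          have hb' : σ₂ b = σ b := (hext₂ b z' h').trans (hπ₂ b z' (hπ₃ b z' h')).2.symm
          have : a = b := hinj (by simp [ha]) (by simp [hb]) (by rw [← ha', ← hb', hab])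
          exact hn b hb (this ▸ ha)
    · rw [hBx, hσ₁]; exact hc₂
    · simp [hx, hσ₁]
    · simp [hx, hBx]
    · intro s z hz
      by_cases h : s ∈ W₁
      · simp only [h, if_true] at hz
        simpa [h] using hext₁ s z hz
      · simp only [h, if_false] at hz
        simpa [h] using hext₂ s z hz
    · intro s hs hz
      by_cases h : s ∈ W₁
      · simp only [h, if_true] at hz
        simpa [h] using (hav₁ s h hz).1
      · simp only [h, if_false] at hz
        simpa [h] using (hav₂ s ((Finset.mem_union.1 hs).resolve_left h) hz).1

/-- Blowups of `T[W]` attached to an edge `uv`: those rooted at `v`, or those rooted at `u`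
whose root part only uses the elements `a` with `w u v a = k`. -/
def edgeFamily {β V : Type*} {f r : ℕ} (T : SimpleGraph β) (G : SimpleGraph V)
    (c : Sym2 (V × Fin f) → Fin r) (X : V → Finset (Fin f)) (w : V → V → Fin f → Fin r) (t : ℕ)
    (u v : V) : Bool × β × Finset β × Fin r → Set (β → V)
  | (true, y, W, k) => {σ | ∃ B, IsMonoBlowup T G c X t W k σ B ∧ σ y = v}
  | (false, y, W, k) =>
    {σ | ∃ B, IsMonoBlowup T G c X t W k σ B ∧ σ y = u ∧ ∀ a ∈ B y, w u v a = k}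

theorem exists_edge_switching {β : Type} [Fintype β] [DecidableEq β] (T : SimpleGraph β) {r : ℕ}
    (hr : 0 < r) (t : ℕ) (q κ : ℕ → ℕ) (M : ℕ)
    (hq : ∀ a, a < Fintype.card β →
      Fintype.card β * (Fintype.card β * κ a + 1) ^ Fintype.card β ≤ q a)
    (hκ : ∀ a, κ a ≤ M) (hM : Fintype.card β ≤ M) :
    ∃ m : ℕ, ∀ {V : Type} {f : ℕ} (G : SimpleGraph V) (c : Sym2 (V × Fin f) → Fin r)
      (rk : V → ℕ) (X : V → Finset (Fin f)) (w : V → V → Fin f → Fin r),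
      Function.Injective rk → (∀ v, (X v).card = m) →
      (∀ u v, G.Adj u v → rk u < rk v → ∀ a ∈ X u, ∀ b ∈ X v, c s((u, a), (v, b)) = w u v a) →
      ∃ (A : V → Finset (Fin f)) (χ : Sym2 V → Fin r), (∀ u, A u ⊆ X u) ∧
        (∀ u, (A u).card = t) ∧
        ∀ u v k y W π, G.Adj u v → χ s(u, v) = k → y ∈ W →
          W.card < Fintype.card β →
          Robust W (q W.card)
            {σ | ∃ B, IsMonoBlowup T G c X t W k σ B ∧ σ y = v ∧ B y = A v} id π →
          ∀ n, n ≤ M → n ≤ κ W.card → ∃ π', (∀ s z, π' s = some z → π s = some z) ∧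
            Robust W n {σ | ∃ B, IsMonoBlowup T G c X t W k σ B ∧ G.Adj u (σ y) ∧
              ∀ a ∈ A u, ∀ b ∈ B y, c s((u, a), (σ y, b)) = k} id π' := by
  classical
  set P := Fintype.card β with hP
  let Key := Bool × β × Finset β × Fin r
  let N := Fintype.card Key * ((P * M + 1) ^ P * P)
  let Θ := Set (Key × (β → Option (Fin N)))
  have : Fintype Θ := Fintype.ofFinite _
  obtain ⟨m, hm⟩ := exists_colour_selection (Θ := Θ) N M t hr
  refine ⟨m, fun {V f} G c rk X w hrk hX hw => ?_⟩
  rcases isEmpty_or_nonempty V with hV | hV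
  · exact ⟨fun v => hV.elim v, fun _ => ⟨0, hr⟩, fun v => hV.elim v, fun v => hV.elim v,
      fun v => hV.elim v⟩
  choose L hLc hLr hLe using fun (u v : V) (x : Key) =>
    exists_kernel x.2.2.1 (κ x.2.2.1.card) id (edgeFamily T G c X w t u v x)
  have hWP : ∀ W : Finset β, W.card ≤ P := fun W => Finset.card_le_univ W
  have hLP : ∀ u v x, (L u v x).card ≤ (P * κ x.2.2.1.card + 1) ^ P := fun u v x =>
    (hLc u v x).trans ((Nat.pow_le_pow_left (Nat.succ_le_succ
      (Nat.mul_le_mul_right _ (hWP _))) _).trans (Nat.pow_le_pow_right (Nat.succ_pos _) (hWP _)))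
  have hLM : ∀ u v x, (L u v x).card ≤ (P * M + 1) ^ P := fun u v x =>
    (hLP u v x).trans (Nat.pow_le_pow_left (Nat.succ_le_succ
      (Nat.mul_le_mul_left _ (hκ _))) _)
  have hLq : ∀ u v x, x.2.2.1.card < P → (L u v x).card * x.2.2.1.card ≤ q x.2.2.1.card :=
    fun u v x hx => (Nat.mul_le_mul (hLP u v x) (hWP _)).trans
      ((mul_comm _ _).trans_le (hq _ hx))
  choose ω hω using fun u v => exists_enumeration_kernels (L u v) (hLM u v)
  let θ : V → V → Θ := fun u v => {x | (fun s => (x.2 s).map (ω u v)) ∈ L u v x.1}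
  have hθ : ∀ {u v v'}, θ u v = θ u v' → ∀ (x : Key) (π₀ : β → Option (Fin N)),
      (fun s => (π₀ s).map (ω u v)) ∈ L u v x → (fun s => (π₀ s).map (ω u v')) ∈ L u v' x := by
    intro u v v' h x π₀ hx
    have : (x, π₀) ∈ θ u v := hx
    rw [h] at this
    exact this
  choose A hAX hAt h hh using fun u => hm {v | G.Adj u v ∧ rk u < rk v} (θ u) (ω u) (w u) (X u)
    (hX u).ge
  let χ : Sym2 V → Fin r := Sym2.lift ⟨fun a b => if rk a < rk b then h a b else h b a, by
    intro a b
    rcases lt_trichotomy (rk a) (rk b) with hab | hab | hab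
    · simp [hab, hab.le]
    · rw [hrk hab]
    · simp [hab, hab.le]⟩
  have hχ : ∀ a b, χ s(a, b) = if rk a < rk b then h a b else h b a := fun a b => rfl
  refine ⟨A, χ, hAX, hAt, fun u v k y W π huv hk hy hW hπ n hnM hnκ => ?_⟩
  rw [hχ] at hk
  rcases lt_or_gt_of_ne (fun he => huv.ne (hrk he) : rk u ≠ rk v) with hlt | hlt
  · rw [if_pos hlt] at hk
    obtain ⟨π₁, hπ₁, hle⟩ := exists_mem_kernel_le hπ
      (F := edgeFamily T G c X w t u v (true, y, W, k))
      (fun σ ⟨B, h₁, h₂, _⟩ => ⟨B, h₁, h₂⟩) (fun π hπ => (hLr u v _ π hπ).2) (hLe u v _)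
      (hLq u v (true, y, W, k) hW)
    obtain ⟨π₀, rfl⟩ := hω u v _ π₁ hπ₁
    obtain ⟨ψ, hψ, hJ⟩ := hh u v ⟨huv, hlt⟩
    obtain ⟨π', hπ', hr'⟩ := Robust.switch (q := κ W.card) (W := W) hψ hJ hnM hnκ (π₀ := π₀)
      (Fam := fun v' => edgeFamily T G c X w t u v' (true, y, W, k))
      (L := fun v' => L u v' (true, y, W, k))
      (fun v' hv' => hθ hv'.2.1.symm _ _ hπ₁)
      (fun v' _ π hπ => (hLr u v' _ π hπ).1)
    refine ⟨π', fun s z hz => hle s z (hπ' s z hz), hr'.mono le_rfl ?_⟩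
    rintro σ ⟨v', ⟨⟨hv', hlt'⟩, -, hcol⟩, B, hB, rfl⟩
    refine ⟨B, hB, hv', fun a ha b hb => ?_⟩
    rw [hw u (σ y) hv' hlt' a (hAX u ha) b (hB.subset y hy hb), hcol a ha, hk]
  · rw [if_neg hlt.not_gt] at hk
    obtain ⟨ψ, hψ, hJ⟩ := hh v u ⟨huv.symm, hlt⟩
    obtain ⟨Q, hQ, hQ'⟩ := exists_values_finset W π
    obtain ⟨u', ⟨⟨hu', hlt'⟩, hθu, hcol⟩, hext, hav⟩ := hJ Q (hQ.trans ((hWP W).trans hM))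
    obtain ⟨π₁, hπ₁, hle⟩ := exists_mem_kernel_le hπ
      (F := edgeFamily T G c X w t v u' (false, y, W, k))
      (fun σ ⟨B, h₁, h₂, h₃⟩ => ⟨B, h₁, h₂, fun a ha => hk ▸ hcol a (h₃ ▸ ha)⟩)
      (fun π hπ => (hLr v u' _ π hπ).2) (hLe v u' _) (hLq v u' (false, y, W, k) hW)
    obtain ⟨π₀, rfl⟩ := hω v u' _ π₁ hπ₁
    have hsupp := (hLr v u' _ _ hπ₁).2
    have heq : (fun s => (π₀ s).map (ω v u')) = fun s => (π₀ s).map (ω v u) := by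
      funext s
      cases hs : π₀ s with
      | none => rfl
      | some i =>
        have hsi : (π₀ s).map (ω v u') = some (ω v u' i) := by simp [hs]
        have hiQ := hQ' s (hsupp s _ hsi) _ (hle s _ hsi)
        cases hi : ψ i with
        | none => exact absurd hiQ (hav i (Finset.mem_univ i) hi)
        | some z => rw [Option.map_some, Option.map_some, hext i z hi, hψ i z hi]
    have hmem := hθ hθu _ _ hπ₁
    refine ⟨_, hle, ?_⟩
    rw [heq]
    refine (hLr v u _ _ hmem).1.mono hnκ ?_
    rintro σ ⟨B, hB, rfl, hBy⟩
    refine ⟨B, hB, huv, fun a ha b hb => ?_⟩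
    rw [Sym2.eq_swap, hw (σ y) u huv.symm hlt b (hB.subset y hy hb) a (hAX u ha), hBy b hb]

/-- For every tree `T`, every `r ≥ 2` and every `t`, there is an `f`
depending only on `T`, `r` and `t` such that for every graph `G` with
`G →ᵣ T`, every `r`-colouring of the edges of the `f`-blowup `G[f]` contains
a monochromatic canonical copy of `T[t]`; i.e. `B(G →ᵣ T; t) ≤ f` for all
such `G`. -/
theorem trees_blowup_no_dependence (p : ℕ) (T : SimpleGraph (Fin p)) (hT : T.IsTree)
    (r : ℕ) (hr : 2 ≤ r) (t : ℕ) :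
    ∃ f : ℕ, ∀ (n : ℕ) (G : SimpleGraph (Fin n)), Arrows G T r →
      ∀ c : Sym2 (Fin n × Fin f) → Fin r, HasMonoCanonCopy G T f t r c := by
  have hr₀ : 0 < r := by omega
  obtain ⟨x⟩ := hT.connected.nonempty
  obtain ⟨m₁, D, hdense⟩ := exists_hasMonoCanonCopy_of_dense hT hr₀ t
  obtain ⟨q, κ, M, hq, hM⟩ := exists_robustness_thresholds (Fintype.card (Fin p))
  obtain ⟨m, hm⟩ := exists_edge_switching T hr₀ t q κ M (fun a ha => (hq a _ ha le_rfl).2.2)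
    (fun a => (hM a).2) (le_of_add_le_right (hM 0).1)
  refine ⟨m₁ + m * r ^ (D * m), fun n G hG c => ?_⟩
  by_cases hS : ∃ S : Finset (Fin n), S.Nonempty ∧
      ∀ u ∈ S, ∃ N ⊆ S, (∀ v ∈ N, G.Adj u v) ∧ D < N.card
  · obtain ⟨S, hS, hdeg⟩ := hS
    exact hdense _ (Nat.le_add_right _ _) G c S hS hdeg
  push Not at hS
  obtain ⟨rk, -, hinj, hrk⟩ := exists_degenerate_rank G D hS n Finset.univ (by simp)
  obtain ⟨X, w, hX, hw⟩ := exists_clean_parts hr₀ G c rk D m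
    (fun v N hN => hrk v (by simp) N (by simp) hN) (Nat.le_add_left _ _)
  obtain ⟨A, χ, hAX, hA, hedge⟩ := hm G c rk X w
    (fun a b hab => hinj (by simp) (by simp) hab) hX hw
  obtain ⟨σ, hσ, k, hk⟩ := hG χ
  obtain ⟨π, -, hπ⟩ := (RootedBranch.univ_of_isTree hT x).exists_robust
    (fun a b hab hb => ⟨(hq a b hab hb).1, (hq a b hab hb).2.1⟩) (fun a => (hM a).1)
    (fun u => (hA u).ge) hAX hedge hσ.injOn (fun a _ b _ => hk a b)
  obtain ⟨σ', ⟨B, hB, -⟩, -⟩ := hπ ∅ (by simp)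
  exact hB.hasMonoCanonCopy
end

section
/- For every tree T and every subtree T′ ⊆ T, there exists a non-decreasing function f : ℕ → ℕ with f(n) → ∞ as n → ∞ such that the following holds. Let G be a graph with G →₂ T, let c be a partial 2-colouring of G, let m : V(G) → ℕ, and let c′ be a 2-colouring of the edges of the blowup G[{m(x)}_{x∈V(G)}] which is f-coherent with c. Then there exists a colour χ ∈ {red, blue} and subgraphs H′ ⊆ H ⊆ G such that H′ is isomorphic to T′, H is a possible χ-coloured copy of T with respect to c, and the blowup G[{m(x)}_{x∈V(G)}] contains a canonical copy of H′[{f(m(x))}_{x∈V(H′)}] all of whose edges are coloured χ by c′. -/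
/-- `IsPossibleCopy T G c φ χ` : the injective map `φ` is a possible `χ`-coloured
copy of `T` in `G` with respect to the partial `2`-colouring `c` of `G`
(modelled as `c : Sym2 _ → Option (Fin 2)`, where `none` means uncoloured):
`φ` is an injective homomorphism of `T` into `G` and every edge of the copy
that is coloured by `c` has colour `χ`. -/
def IsPossibleCopy {p n : ℕ} (T : SimpleGraph (Fin p)) (G : SimpleGraph (Fin n))
    (c : Sym2 (Fin n) → Option (Fin 2)) (φ : Fin p → Fin n) (χ : Fin 2) : Prop :=
  Function.Injective φ ∧
    ∀ u v, T.Adj u v → G.Adj (φ u) (φ v) ∧ ∀ k, c s(φ u, φ v) = some k → k = χ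

/-- `Coherent G c m f c'` : the `2`-colouring `c'` of the edges of the blowup
`G[{m(x)}ₓ]` (whose vertex set is `(x : Fin n) × Fin (m x)`) is `f`-coherent
with the partial `2`-colouring `c` of `G`: whenever an edge `xy` of `G` is
coloured `k` by `c`, the complete bipartite graph between the blowups of `x`
and `y` contains no complete bipartite graph `K_{f(m x), f(m y)}` in the
opposite colour. -/
def Coherent {n : ℕ} (G : SimpleGraph (Fin n)) (c : Sym2 (Fin n) → Option (Fin 2))
    (m : Fin n → ℕ) (f : ℕ → ℕ)
    (c' : Sym2 ((x : Fin n) × Fin (m x)) → Fin 2) : Prop :=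
  ∀ x y : Fin n, G.Adj x y → ∀ k : Fin 2, c s(x, y) = some k →
    ¬ ∃ (a : Fin (f (m x)) → Fin (m x)) (b : Fin (f (m y)) → Fin (m y)),
        Function.Injective a ∧ Function.Injective b ∧
        ∀ i j, c' s(⟨x, a i⟩, ⟨y, b j⟩) ≠ k

/-- A function extracting monochromatic complete bipartite subgraphs from `2`-coloured ones. -/
def bipartiteRamsey (n : ℕ) : ℕ := Nat.log 2 n / 4

theorem bipartiteRamsey_mono : Monotone bipartiteRamsey := fun _ _ h =>
  Nat.div_le_div_right (Nat.log_mono_right h)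

theorem tendsto_bipartiteRamsey : Filter.Tendsto bipartiteRamsey Filter.atTop Filter.atTop := by
  refine Filter.tendsto_atTop_atTop_of_monotone bipartiteRamsey_mono fun b => ⟨2 ^ (4 * b), ?_⟩
  simp [bipartiteRamsey]

theorem bipartiteRamsey_le (n : ℕ) : bipartiteRamsey n ≤ n :=
  (Nat.div_le_self _ _).trans (Nat.log_le_self _ _)

theorem bipartiteRamsey_spec {n : ℕ} (h : bipartiteRamsey n ≠ 0) :
    bipartiteRamsey n * 2 ^ (2 * bipartiteRamsey n + 1) ≤ n := by
  set r := bipartiteRamsey n with hr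
  have hn : n ≠ 0 := by
    rintro rfl
    simp [hr, bipartiteRamsey] at h
  have h1 : 4 * r ≤ Nat.log 2 n := by
    rw [hr, bipartiteRamsey]
    omega
  calc r * 2 ^ (2 * r + 1) ≤ 2 ^ r * 2 ^ (2 * r + 1) :=
        Nat.mul_le_mul_right _ Nat.lt_two_pow_self.le
    _ = 2 ^ (3 * r + 1) := by rw [← pow_add]; congr 1; ring
    _ ≤ 2 ^ Nat.log 2 n := Nat.pow_le_pow_right (by norm_num) (by omega)
    _ ≤ n := Nat.pow_log_le_self 2 hn

/-- Bipartite Ramsey theorem, with the smaller side first. -/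
theorem exists_mono_bipartite_of_le (A B : Finset ℕ) (d : ℕ → ℕ → Fin 2)
    (h : A.card ≤ B.card) :
    ∃ χ : Fin 2, ∃ A' ⊆ A, ∃ B' ⊆ B, bipartiteRamsey A.card ≤ A'.card ∧
      bipartiteRamsey B.card ≤ B'.card ∧ ∀ a ∈ A', ∀ b ∈ B', d a b = χ := by
  classical
  set r := bipartiteRamsey A.card with hr
  by_cases h0 : r = 0
  · exact ⟨0, ∅, by simp, B, subset_rfl, by simp [h0], bipartiteRamsey_le _, by simp⟩
  have hs0 : bipartiteRamsey B.card ≠ 0 := by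
    have := bipartiteRamsey_mono h
    omega
  have hs := bipartiteRamsey_spec hs0
  have hrs : r ≤ bipartiteRamsey B.card := bipartiteRamsey_mono h
  set s := bipartiteRamsey B.card
  have hA : 2 * r ≤ A.card := by
    refine le_trans ?_ (bipartiteRamsey_spec h0)
    rw [mul_comm]
    refine Nat.mul_le_mul_left _ ?_
    calc 2 = 2 ^ 1 := rfl
      _ ≤ _ := Nat.pow_le_pow_right (by norm_num) (by omega)
  obtain ⟨A₀, hA₀, hc⟩ := Finset.exists_subset_card_eq hA
  have hmaj : ∀ b, ∃ χ : Fin 2, r ≤ (A₀.filter fun a => d a b = χ).card := by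
    intro b
    by_contra! hcon
    have h1 := Finset.card_eq_sum_card_fiberwise (f := fun a => d a b) (s := A₀)
      (t := Finset.univ) (by simp)
    rw [Fin.sum_univ_two] at h1
    have := hcon 0
    have := hcon 1
    omega
  choose χ hχ using hmaj
  let key : ℕ → Finset ℕ × Fin 2 := fun b => (A₀.filter fun a => d a b = χ b, χ b)
  have hcard : (A₀.powerset ×ˢ (Finset.univ : Finset (Fin 2))).card * s ≤ B.card := by
    rw [Finset.card_product, Finset.card_powerset, hc]
    simp only [Finset.card_univ, Fintype.card_fin]
    refine le_trans ?_ hs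
    rw [mul_comm, ← pow_succ]
    exact Nat.mul_le_mul_left _ (Nat.pow_le_pow_right (by norm_num) (by omega))
  obtain ⟨⟨A', κ⟩, -, hy⟩ := Finset.exists_le_card_fiber_of_mul_le_card_of_maps_to
    (s := B) (f := key) (t := A₀.powerset ×ˢ (Finset.univ : Finset (Fin 2)))
    (by
      intro b _
      simp only [key, Finset.mem_product, Finset.mem_powerset, Finset.mem_univ, and_true]
      exact Finset.filter_subset _ _)
    ⟨(∅, 0), by simp⟩ hcard
  have hne : (B.filter fun b => key b = (A', κ)).Nonempty := by
    rw [← Finset.card_pos]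
    omega
  refine ⟨κ, A', ?_, B.filter fun b => key b = (A', κ), Finset.filter_subset _ _, ?_, hy, ?_⟩
  · obtain ⟨b, hb⟩ := hne
    have hb := (Finset.mem_filter.1 hb).2
    simp only [key, Prod.mk.injEq] at hb
    rw [← hb.1]
    exact (Finset.filter_subset _ _).trans hA₀
  · obtain ⟨b, hb⟩ := hne
    have hb := (Finset.mem_filter.1 hb).2
    simp only [key, Prod.mk.injEq] at hb
    rw [← hb.1]
    exact hχ b
  · intro a ha b hb
    have hb := (Finset.mem_filter.1 hb).2
    simp only [key, Prod.mk.injEq] at hb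
    rw [← hb.1] at ha
    rw [← hb.2]
    exact (Finset.mem_filter.1 ha).2

/-- Bipartite Ramsey theorem with sides of arbitrary sizes. -/
theorem exists_mono_bipartite (A B : Finset ℕ) (d : ℕ → ℕ → Fin 2) :
    ∃ χ : Fin 2, ∃ A' ⊆ A, ∃ B' ⊆ B, bipartiteRamsey A.card ≤ A'.card ∧
      bipartiteRamsey B.card ≤ B'.card ∧ ∀ a ∈ A', ∀ b ∈ B', d a b = χ := by
  rcases le_total A.card B.card with h | h
  · exact exists_mono_bipartite_of_le A B d h
  · obtain ⟨χ, B', hB, A', hA, h1, h2, h3⟩ :=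
      exists_mono_bipartite_of_le B A (fun b a => d a b) h
    exact ⟨χ, A', hA, B', hB, h2, h1, fun a ha b hb => h3 b hb a ha⟩

/-- `SkewPairs a b L` : a list, newest entry first, of disjoint pairs of finite sets of sizes at
most `a` and `b`, in which the second set of each pair meets the first sets of all older pairs. -/
structure SkewPairs {V : Type*} (a b : ℕ) (L : List (Finset V × Finset V)) : Prop where
  card_fst : ∀ P ∈ L, P.1.card ≤ a
  card_snd : ∀ P ∈ L, P.2.card ≤ b
  disjoint : ∀ P ∈ L, Disjoint P.1 P.2
  meets : L.Pairwise fun P Q => ¬ Disjoint Q.1 P.2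

theorem length_le_sum_countP {V β : Type*} [DecidableEq V] (B : Finset V) (A : β → Finset V)
    (L : List β) (h : ∀ P ∈ L, ¬ Disjoint (A P) B) :
    L.length ≤ ∑ z ∈ B, L.countP fun P => z ∈ A P := by
  induction L with
  | nil => simp
  | cons P L ih =>
    have h1 := ih fun Q hQ => h Q (List.mem_cons_of_mem _ hQ)
    obtain ⟨z, hzA, hzB⟩ := Finset.not_disjoint_iff.1 (h P List.mem_cons_self)
    simp only [List.countP_cons, Finset.sum_add_distrib, List.length_cons]
    refine Nat.add_le_add h1 ?_
    have := Finset.single_le_sum (s := B)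
      (f := fun z => if decide (z ∈ A P) = true then 1 else 0) (fun _ _ => Nat.zero_le _) hzB
    simpa [hzA] using this

/-- A weak form of the skew version of the Bollobás set-pairs inequality. -/
theorem SkewPairs.length_le {V : Type*} {a b : ℕ} {L : List (Finset V × Finset V)}
    (h : SkewPairs a b L) : L.length ≤ (b + 1) ^ a := by
  classical
  induction a generalizing L with
  | zero =>
    match L, h with
    | [], _ => simp
    | [_], _ => simp
    | P :: Q :: L, h =>
      exfalso
      have h1 := h.card_fst Q (by simp)
      have h2 := (List.pairwise_cons.1 h.meets).1 Q (by simp)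
      simp only [nonpos_iff_eq_zero, Finset.card_eq_zero] at h1
      simp [h1] at h2
  | succ a ih =>
    match L, h with
    | [], _ => simp
    | P :: L, h =>
      have hP := List.pairwise_cons.1 h.meets
      have h1 := length_le_sum_countP P.2 Prod.fst L hP.1
      have h2 : ∀ z ∈ P.2, (L.countP fun Q => z ∈ Q.1) ≤ (b + 1) ^ a := by
        intro z _
        rw [List.countP_eq_length_filter,
          ← List.length_map (fun Q : Finset V × Finset V => (Q.1.erase z, Q.2))]
        refine ih ⟨?_, ?_, ?_, ?_⟩
        · intro R hR
          simp only [List.mem_map, List.mem_filter, decide_eq_true_eq] at hR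
          obtain ⟨Q, ⟨hQ, hz⟩, rfl⟩ := hR
          have := h.card_fst Q (List.mem_cons_of_mem _ hQ)
          have := Finset.card_erase_add_one hz
          simp only
          omega
        · intro R hR
          simp only [List.mem_map, List.mem_filter, decide_eq_true_eq] at hR
          obtain ⟨Q, ⟨hQ, hz⟩, rfl⟩ := hR
          exact h.card_snd Q (List.mem_cons_of_mem _ hQ)
        · intro R hR
          simp only [List.mem_map, List.mem_filter, decide_eq_true_eq] at hR
          obtain ⟨Q, ⟨hQ, hz⟩, rfl⟩ := hR
          exact (h.disjoint Q (List.mem_cons_of_mem _ hQ)).mono_left (Finset.erase_subset _ _)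
        · rw [List.pairwise_map]
          refine (hP.2.filter _).imp_of_mem ?_
          intro Q R hQ hR hQR
          simp only [List.mem_filter, decide_eq_true_eq] at hQ hR
          obtain ⟨y, hy1, hy2⟩ := Finset.not_disjoint_iff.1 hQR
          refine Finset.not_disjoint_iff.2 ⟨y, Finset.mem_erase.2 ⟨?_, hy1⟩, hy2⟩
          rintro rfl
          exact Finset.disjoint_left.1 (h.disjoint Q (List.mem_cons_of_mem _ hQ.1)) hQ.2 hy2
      have h3 := Finset.sum_le_card_nsmul P.2 _ _ h2
      have h4 := h.card_snd P List.mem_cons_self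
      have h5 : 1 ≤ (b + 1) ^ a := Nat.one_le_pow _ _ (by omega)
      simp only [smul_eq_mul] at h3
      have h6 := Nat.mul_le_mul_right ((b + 1) ^ a) h4
      simp only [List.length_cons, pow_succ]
      nlinarith

section Blowup

variable {α V : Type*}

/-- All edges between `A` in the blowup of `x` and `B` in the blowup of `y` have colour `χ`. -/
def MonoPair (d : Sym2 (V × ℕ) → Fin 2) (x : V) (A : Finset ℕ) (y : V) (B : Finset ℕ)
    (χ : Fin 2) : Prop :=
  ∀ a ∈ A, ∀ b ∈ B, d s((x, a), (y, b)) = χ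

theorem MonoPair.symm {d : Sym2 (V × ℕ) → Fin 2} {x y : V} {A B : Finset ℕ} {χ : Fin 2}
    (h : MonoPair d x A y B χ) : MonoPair d y B x A χ := fun b hb a ha => by
  rw [Sym2.eq_swap]
  exact h a ha b hb

theorem MonoPair.mono {d : Sym2 (V × ℕ) → Fin 2} {x y : V} {A B A' B' : Finset ℕ} {χ : Fin 2}
    (h : MonoPair d x A y B χ) (hA : A' ⊆ A) (hB : B' ⊆ B) : MonoPair d x A' y B' χ :=
  fun a ha b hb => h a (hA ha) b (hB hb)

/-- Coherence of `d` with `c` on the blowup with parts `S x`, where `F x` is the size of the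
forbidden sets inside `S x`. -/
def CoherentOn (G : SimpleGraph V) (c : Sym2 V → Option (Fin 2)) (d : Sym2 (V × ℕ) → Fin 2)
    (S : V → Finset ℕ) (F : V → ℕ) : Prop :=
  ∀ x y, G.Adj x y → ∀ k, c s(x, y) = some k → ∀ A ⊆ S x, ∀ B ⊆ S y,
    F x ≤ A.card → F y ≤ B.card → ¬ MonoPair d x A y B (k + 1)

theorem CoherentOn.mono {G : SimpleGraph V} {c : Sym2 V → Option (Fin 2)}
    {d : Sym2 (V × ℕ) → Fin 2} {S : V → Finset ℕ} {F F' : V → ℕ}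
    (h : CoherentOn G c d S F) (hF : ∀ x, F x ≤ F' x) : CoherentOn G c d S F' :=
  fun x y hxy k hk A hA B hB h1 h2 =>
    h x y hxy k hk A hA B hB ((hF x).trans h1) ((hF y).trans h2)

/-- `ψ` restricted to `W` is a possible `χ`-coloured copy of `T[W]`. -/
structure IsPartialCopy (T : SimpleGraph α) (G : SimpleGraph V) (c : Sym2 V → Option (Fin 2))
    (χ : Fin 2) (W : Set α) (ψ : α → V) : Prop where
  injOn : Set.InjOn ψ W
  adj : ∀ u ∈ W, ∀ v ∈ W, T.Adj u v → G.Adj (ψ u) (ψ v)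
  color : ∀ u ∈ W, ∀ v ∈ W, T.Adj u v → ∀ k, c s(ψ u, ψ v) = some k → k = χ

theorem IsPartialCopy.mono {T : SimpleGraph α} {G : SimpleGraph V}
    {c c₀ : Sym2 V → Option (Fin 2)} {χ : Fin 2} {W W' : Set α} {ψ : α → V}
    (h : IsPartialCopy T G c χ W ψ) (hW : W' ⊆ W)
    (hc : ∀ e k, c₀ e = some k → c e = some k) : IsPartialCopy T G c₀ χ W' ψ :=
  ⟨h.injOn.mono hW, fun u hu v hv => h.adj u (hW hu) v (hW hv),
    fun u hu v hv huv k hk => h.color u (hW hu) v (hW hv) huv k (hc _ _ hk)⟩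

/-- `ψ` is a possible copy of `T[W]` which can replace the part `φ(W)` of a copy `φ` of `T`, when
`vw` is the only edge of `T` entering `W`. -/
structure Attaches (T : SimpleGraph α) (G : SimpleGraph V) (c : Sym2 V → Option (Fin 2))
    (χ : Fin 2) (W : Set α) (φ : α → V) (v w : α) (ψ : α → V) : Prop where
  copy : IsPartialCopy T G c χ W ψ
  avoids : ∀ z ∈ W, ∀ a ∉ W, ψ z ≠ φ a
  adj : G.Adj (φ v) (ψ w)
  color : ∀ k, c s(φ v, ψ w) = some k → k = χ

open Classical in
theorem Attaches.glue {T : SimpleGraph α} {G : SimpleGraph V} {c : Sym2 V → Option (Fin 2)}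
    {χ : Fin 2} {W : Set α} {φ ψ : α → V} {v w : α}
    (h : Attaches T G c χ W φ v w ψ) (hφ : IsPartialCopy T G c χ Set.univ φ)
    (hcross : ∀ a ∉ W, ∀ b ∈ W, T.Adj a b → a = v ∧ b = w) :
    IsPartialCopy T G c χ Set.univ (fun z => if z ∈ W then ψ z else φ z) := by
  refine ⟨?_, ?_, ?_⟩
  · intro a _ b _ hab
    by_cases ha : a ∈ W <;> by_cases hb : b ∈ W <;> simp only [ha, hb, if_true, if_false] at hab
    · exact h.copy.injOn ha hb hab
    · exact (h.avoids a ha b hb hab).elim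
    · exact (h.avoids b hb a ha hab.symm).elim
    · exact hφ.injOn (Set.mem_univ _) (Set.mem_univ _) hab
  · intro a _ b _ hab
    by_cases ha : a ∈ W <;> by_cases hb : b ∈ W <;> simp only [ha, hb, if_true, if_false]
    · exact h.copy.adj a ha b hb hab
    · obtain ⟨rfl, rfl⟩ := hcross b hb a ha hab.symm
      exact h.adj.symm
    · obtain ⟨rfl, rfl⟩ := hcross a ha b hb hab
      exact h.adj
    · exact hφ.adj a (Set.mem_univ _) b (Set.mem_univ _) hab
  · intro a _ b _ hab
    by_cases ha : a ∈ W <;> by_cases hb : b ∈ W <;> simp only [ha, hb, if_true, if_false]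
    · exact h.copy.color a ha b hb hab
    · obtain ⟨rfl, rfl⟩ := hcross b hb a ha hab.symm
      rw [Sym2.eq_swap]
      exact h.color
    · obtain ⟨rfl, rfl⟩ := hcross a ha b hb hab
      exact h.color
    · exact hφ.color a (Set.mem_univ _) b (Set.mem_univ _) hab

/-- A possible copy of `T` whose part on `U` is blown up monochromatically, with `F x` vertices
inside the part `S x`. -/
def HasBlowup (T : SimpleGraph α) (G : SimpleGraph V) (c : Sym2 V → Option (Fin 2))
    (d : Sym2 (V × ℕ) → Fin 2) (S : V → Finset ℕ) (F : V → ℕ) (U : Set α) (χ : Fin 2)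
    (φ : α → V) (X : α → Finset ℕ) : Prop :=
  IsPartialCopy T G c χ Set.univ φ ∧ (∀ u ∈ U, X u ⊆ S (φ u) ∧ F (φ u) ≤ (X u).card) ∧
    ∀ u ∈ U, ∀ v ∈ U, T.Adj u v → MonoPair d (φ u) (X u) (φ v) (X v) χ

theorem HasBlowup.mono {T : SimpleGraph α} {G : SimpleGraph V} {c c₀ : Sym2 V → Option (Fin 2)}
    {d : Sym2 (V × ℕ) → Fin 2} {S S₀ : V → Finset ℕ} {F F₀ : V → ℕ} {U : Set α} {χ : Fin 2}
    {φ : α → V} {X : α → Finset ℕ} (h : HasBlowup T G c d S F U χ φ X)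
    (hc : ∀ e k, c₀ e = some k → c e = some k) (hS : ∀ x, S x ⊆ S₀ x) (hF : ∀ x, F₀ x ≤ F x) :
    HasBlowup T G c₀ d S₀ F₀ U χ φ X :=
  ⟨h.1.mono subset_rfl hc,
    fun u hu => ⟨(h.2.1 u hu).1.trans (hS _), (hF _).trans (h.2.1 u hu).2⟩, h.2.2⟩

/-- `f` is a valid size function for blowing up the part `U` of `T`. -/
def GoodFor (T : SimpleGraph α) (U : Set α) (f : ℕ → ℕ) : Prop :=
  ∀ (n : ℕ) (G : SimpleGraph (Fin n)), Arrows G T 2 →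
    ∀ (c : Sym2 (Fin n) → Option (Fin 2)) (S : Fin n → Finset ℕ) (d : Sym2 (Fin n × ℕ) → Fin 2),
      CoherentOn G c d S (fun x => f (S x).card) →
      ∃ χ φ X, HasBlowup T G c d S (fun x => f (S x).card) U χ φ X

theorem GoodFor.mono {T : SimpleGraph α} {U : Set α} {f f' : ℕ → ℕ} (h : GoodFor T U f)
    (hf : ∀ n, f' n ≤ f n) : GoodFor T U f' := by
  intro n G hG c S d hco
  obtain ⟨χ, φ, X, hX⟩ := h n G hG c S d (hco.mono fun _ => hf _)
  exact ⟨χ, φ, X, hX.mono (fun _ _ => id) (fun _ => subset_rfl) fun _ => hf _⟩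

theorem goodFor_singleton (T : SimpleGraph α) (r : α) : GoodFor T {r} id := by
  intro n G hG c S d _
  obtain ⟨φ, hφ, χ, h⟩ := hG fun e => (c e).getD 0
  refine ⟨χ, φ, fun u => S (φ u), ⟨hφ.injOn, fun u _ v _ huv => (h u v huv).1, ?_⟩,
    fun u _ => ⟨subset_rfl, le_rfl⟩, ?_⟩
  · intro u _ v _ huv k hk
    have := (h u v huv).2
    simpa [hk] using this
  · rintro u rfl v rfl huv
    exact (huv.ne rfl).elim

/-- The state of the recolouring process: `c` is the current partial colouring, `S x` the current
part at `x`, and `L x χ` records the pairs `(φ(Wᶜ), φ(W))` for the possible `χ`-coloured copies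
`φ` of `T` for which the part at `x = φ v` was shrunk. -/
structure RecolouringState [Fintype α] (T : SimpleGraph α) (G : SimpleGraph V)
    (c₀ : Sym2 V → Option (Fin 2)) (d : Sym2 (V × ℕ) → Fin 2) (S₀ : V → Finset ℕ) (F : V → ℕ)
    (g : ℕ → ℕ) (W : Set α) (w : α) (c : Sym2 V → Option (Fin 2)) (S : V → Finset ℕ)
    (L : V → Fin 2 → List (Finset V × Finset V)) : Prop where
  extend : ∀ e k, c₀ e = some k → c e = some k
  subset : ∀ x, S x ⊆ S₀ x
  card_le : ∀ x, g^[(L x 0).length + (L x 1).length] (S₀ x).card ≤ (S x).card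
  coherent : CoherentOn G c d S F
  skew : ∀ x χ, SkewPairs (Fintype.card α) (Fintype.card α) (L x χ)
  blocked : ∀ x χ, ∀ P ∈ L x χ, ∀ ψ, IsPartialCopy T G c χ W ψ → G.Adj x (ψ w) →
    c s(x, ψ w) = none → ∃ z ∈ W, ψ z ∈ P.1

theorem RecolouringState.card_ge [Fintype α] {T : SimpleGraph α} {G : SimpleGraph V}
    {c₀ : Sym2 V → Option (Fin 2)} {d : Sym2 (V × ℕ) → Fin 2} {S₀ : V → Finset ℕ} {F : V → ℕ}
    {g : ℕ → ℕ} {W : Set α} {w : α} {c : Sym2 V → Option (Fin 2)} {S : V → Finset ℕ}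
    {L : V → Fin 2 → List (Finset V × Finset V)}
    (h : RecolouringState T G c₀ d S₀ F g W w c S L) (hg : ∀ n, g n ≤ n) (x : V) :
    g^[2 * (Fintype.card α + 1) ^ Fintype.card α] (S₀ x).card ≤ (S x).card := by
  refine le_trans ?_ (h.card_le x)
  have h0 := (h.skew x 0).length_le
  have h1 := (h.skew x 1).length_le
  exact Function.antitone_iterate_of_le_id (f := g) hg (by omega) _

/-- One step of the recolouring process, in which the part at `φ v` is shrunk to `X`. -/
theorem RecolouringState.step [Fintype α] [Fintype V] [DecidableEq V] {T : SimpleGraph α}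
    {G : SimpleGraph V}
    {c₀ : Sym2 V → Option (Fin 2)} {d : Sym2 (V × ℕ) → Fin 2} {S₀ : V → Finset ℕ} {F : V → ℕ}
    {g : ℕ → ℕ} {W : Set α} {v w : α} {c : Sym2 V → Option (Fin 2)} {S : V → Finset ℕ}
    {L : V → Fin 2 → List (Finset V × Finset V)}
    (h : RecolouringState T G c₀ d S₀ F g W w c S L) (hg : Monotone g)
    (hvw : T.Adj v w) {χ : Fin 2} {φ : α → V}
    (hφ : IsPartialCopy T G c χ Set.univ φ) {X : Finset ℕ} (hX : X ⊆ S (φ v))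
    (hXc : g (S (φ v)).card ≤ X.card) (hnone : c s(φ v, φ w) = none)
    (hK : ∀ ψ, Attaches T G c χ W φ v w ψ → ∀ A ⊆ X, ∀ B ⊆ S (ψ w),
      F (φ v) ≤ A.card → F (ψ w) ≤ B.card → ¬ MonoPair d (φ v) A (ψ w) B χ) :
    ∃ c' S' L', RecolouringState T G c₀ d S₀ F g W w c' S' L' ∧
      (Finset.univ.filter fun e => c' e = none).card <
        (Finset.univ.filter fun e => c e = none).card := by
  classical
  set x := φ v with hx
  have hatt : Attaches T G c χ W φ v w φ :=
    ⟨hφ.mono (Set.subset_univ _) fun _ _ => id,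
      fun z hz a ha hza => ha (hφ.injOn (Set.mem_univ _) (Set.mem_univ _) hza ▸ hz),
      hφ.adj _ (Set.mem_univ _) _ (Set.mem_univ _) hvw,
      hφ.color _ (Set.mem_univ _) _ (Set.mem_univ _) hvw⟩
  let c' : Sym2 V → Option (Fin 2) := fun e =>
    if c e = none ∧ ∃ ψ, Attaches T G c χ W φ v w ψ ∧ e = s(x, ψ w) then some (χ + 1) else c e
  have hc' : ∀ e k, c e = some k → c' e = some k := by
    intro e k hk
    simp [c', hk]
  have hc'n : ∀ e, c' e = none → c e = none := by
    intro e he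
    cases hce : c e with
    | none => rfl
    | some k => rw [hc' e k hce] at he; exact he
  let S' := Function.update S x X
  have hS' : ∀ y, S' y ⊆ S y := by
    intro y
    by_cases hy : y = x
    · subst hy
      simpa [S'] using hX
    · simp [S', hy]
  let P : Finset V × Finset V :=
    ((Finset.univ.filter (· ∉ W)).image φ, (Finset.univ.filter (· ∈ W)).image φ)
  let L' : V → Fin 2 → List (Finset V × Finset V) := fun y κ =>
    if y = x ∧ κ = χ then P :: L y κ else L y κ
  have key : ∀ y z k, G.Adj y z → c s(y, z) = none → c' s(y, z) = some k →
      k = χ + 1 ∧ ∃ ψ, Attaches T G c χ W φ v w ψ ∧ s(y, z) = s(x, ψ w) := by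
    intro y z k _ hcn hk
    by_cases hcond : c s(y, z) = none ∧ ∃ ψ, Attaches T G c χ W φ v w ψ ∧ s(y, z) = s(x, ψ w)
    · simp only [c', if_pos hcond, Option.some.injEq] at hk
      exact ⟨hk.symm, hcond.2⟩
    · simp only [c', if_neg hcond, hcn] at hk
      cases hk
  have hχ : χ + 1 + 1 = χ := by omega
  refine ⟨c', S', L', ⟨?_, ?_, ?_, ?_, ?_, ?_⟩, ?_⟩
  · exact fun e k hk => hc' e k (h.extend e k hk)
  · exact fun y => (hS' y).trans (h.subset y)
  · intro y
    by_cases hy : y = x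
    · have hlen : (L' y 0).length + (L' y 1).length =
          (L y 0).length + (L y 1).length + 1 := by
        have : χ = 0 ∨ χ = 1 := by omega
        rcases this with h0 | h0 <;> simp [L', hy, h0] <;> omega
      rw [hlen, Function.iterate_succ_apply', hy]
      simp only [S', Function.update_self]
      exact (hg (h.card_le x)).trans hXc
    · simpa [L', S', hy] using h.card_le y
  · intro y z hyz k hk A hA B hB hFA hFB hm
    cases hcyz : c s(y, z) with
    | some k' =>
      obtain rfl : k' = k := by simpa [hc' _ _ hcyz] using hk
      exact h.coherent y z hyz k' hcyz A (hA.trans (hS' y)) B (hB.trans (hS' z)) hFA hFB hm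
    | none =>
      obtain ⟨rfl, ψ, hψ, he⟩ := key y z k hyz hcyz hk
      rw [hχ] at hm
      rcases Sym2.eq_iff.1 he with ⟨rfl, rfl⟩ | ⟨rfl, rfl⟩
      · refine hK ψ hψ A ?_ B (hB.trans (hS' _)) hFA hFB hm
        simpa [S'] using hA
      · refine hK ψ hψ B ?_ A (hA.trans (hS' _)) hFB hFA hm.symm
        simpa [S'] using hB
  · intro y κ
    by_cases hy : y = x ∧ κ = χ
    · simp only [L', if_pos hy]
      have hold := h.skew y κ
      have hcard : ∀ (p : α → Prop) [DecidablePred p],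
          ((Finset.univ.filter p).image φ).card ≤ Fintype.card α := fun p _ =>
        Finset.card_image_le.trans (Finset.card_le_univ _)
      refine ⟨?_, ?_, ?_, ?_⟩
      · exact List.forall_mem_cons.2 ⟨hcard _, hold.card_fst⟩
      · exact List.forall_mem_cons.2 ⟨hcard _, hold.card_snd⟩
      · refine List.forall_mem_cons.2 ⟨?_, hold.disjoint⟩
        rw [Finset.disjoint_left]
        intro b hb1 hb2
        simp only [P, Finset.mem_image, Finset.mem_filter, Finset.mem_univ, true_and] at hb1 hb2
        obtain ⟨a, ha, rfl⟩ := hb1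
        obtain ⟨z, hz, hza⟩ := hb2
        exact hatt.avoids z hz a ha hza
      · refine List.pairwise_cons.2 ⟨?_, hold.meets⟩
        intro Q hQ
        obtain ⟨rfl, rfl⟩ := hy
        obtain ⟨z, hz, hzQ⟩ := h.blocked _ _ Q hQ φ hatt.copy hatt.adj hnone
        refine Finset.not_disjoint_iff.2 ⟨φ z, hzQ, ?_⟩
        exact Finset.mem_image_of_mem _ (by simpa using hz)
    · simp only [L', if_neg hy]
      exact h.skew y κ
  · intro y κ Q hQ ψ hψ hadj hn
    have hψ' := hψ.mono subset_rfl hc'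
    have hn' := hc'n _ hn
    by_cases hQL : Q ∈ L y κ
    · exact h.blocked y κ Q hQL ψ hψ' hadj hn'
    · by_cases hy : y = x ∧ κ = χ
      · simp only [L', if_pos hy, List.mem_cons, hQL, or_false] at hQ
        obtain ⟨rfl, rfl⟩ := hy
        by_contra! hcon
        have hA : Attaches T G c κ W φ v w ψ := by
          refine ⟨hψ', ?_, hadj, ?_⟩
          · intro z hz a ha hza
            apply hcon z hz
            rw [hza, hQ]
            exact Finset.mem_image_of_mem _ (by simpa using ha)
          · intro k hk
            rw [← hx, hn'] at hk
            cases hk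
        have hcond : c s(x, ψ w) = none ∧
            ∃ ψ', Attaches T G c κ W φ v w ψ' ∧ s(x, ψ w) = s(x, ψ' w) := ⟨hn', ψ, hA, rfl⟩
        simp only [c', if_pos hcond] at hn
        cases hn
      · simp only [L', if_neg hy] at hQ
        exact (hQL hQ).elim
  · refine Finset.card_lt_card (Finset.ssubset_iff_of_subset ?_ |>.2 ⟨s(x, φ w), ?_, ?_⟩)
    · intro e he
      simp only [Finset.mem_filter, Finset.mem_univ, true_and] at he ⊢
      exact hc'n e he
    · simpa using hnone
    · have hcond : c s(x, φ w) = none ∧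
          ∃ ψ', Attaches T G c χ W φ v w ψ' ∧ s(x, φ w) = s(x, ψ' w) := ⟨hnone, φ, hatt, rfl⟩
      simp only [c', if_pos hcond, Finset.mem_filter, Finset.mem_univ, true_and]
      exact Option.some_ne_none _

/-- Adding to `U` a vertex `w`, where `W` is the part of `T` cut off from `U` by the edge `vw`. -/
theorem GoodFor.insert_vertex [Fintype α] {T : SimpleGraph α} {U W : Set α} {v w : α} {g : ℕ → ℕ}
    (h : GoodFor T U g) (hg : Monotone g) (hgle : ∀ n, g n ≤ n)
    (hvU : v ∈ U) (hUW : ∀ u ∈ U, u ∉ W) (hwW : w ∈ W) (hvw : T.Adj v w)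
    (hcross : ∀ a ∉ W, ∀ b ∈ W, T.Adj a b → a = v ∧ b = w) :
    GoodFor T (insert w U) (fun n => bipartiteRamsey
      (g (g^[2 * (Fintype.card α + 1) ^ Fintype.card α] n))) := by
  classical
  set N := 2 * (Fintype.card α + 1) ^ Fintype.card α with hN
  intro n G hG c₀ S₀ d hco
  set F : Fin n → ℕ := fun x => bipartiteRamsey (g (g^[N] (S₀ x).card)) with hF
  suffices hmain : ∀ c S L, RecolouringState T G c₀ d S₀ F g W w c S L →
      ∃ χ φ X, HasBlowup T G c₀ d S₀ F (insert w U) χ φ X by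
    refine hmain c₀ S₀ (fun _ _ => []) ⟨fun _ _ => id, fun _ => subset_rfl, fun _ => by simp,
      hco, fun _ _ => ⟨?_, ?_, ?_, ?_⟩, ?_⟩ <;> simp
  intro c S L hst
  induction hk : (Finset.univ.filter fun e => c e = none).card using Nat.strong_induction_on
    generalizing c S L with
  | _ k ih =>
  have hcard := hst.card_ge hgle
  have hFg : ∀ x, F x ≤ g (S x).card := fun x =>
    (bipartiteRamsey_le _).trans (hg (hcard x))
  obtain ⟨χ, φ, X, hφ, hX, hXm⟩ := h n G hG c S d (hst.coherent.mono hFg)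
  have hvW := hUW v hvU
  have hwU : w ∉ U := fun hw => hUW w hw hwW
  by_cases hK : ∃ ψ, Attaches T G c χ W φ v w ψ ∧ ∃ A ⊆ X v, ∃ B ⊆ S (ψ w),
      F (φ v) ≤ A.card ∧ F (ψ w) ≤ B.card ∧ MonoPair d (φ v) A (ψ w) B χ
  · obtain ⟨ψ, hψ, A, hA, B, hB, hFA, hFB, hAB⟩ := hK
    refine ⟨χ, fun z => if z ∈ W then ψ z else φ z,
      fun z => if z = w then B else if z = v then A else X z,
      (hψ.glue hφ hcross).mono subset_rfl hst.extend, ?_, ?_⟩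
    · rintro u (rfl | hu)
      · simpa [hwW] using ⟨hB.trans (hst.subset _), hFB⟩
      · have huw : u ≠ w := fun e => hwU (e ▸ hu)
        by_cases huv : u = v
        · subst huv
          simpa [hvW, huw] using ⟨(hA.trans (hX u hu).1).trans (hst.subset _), hFA⟩
        · simpa [hUW u hu, huw, huv] using
            ⟨(hX u hu).1.trans (hst.subset _), (hFg _).trans (hX u hu).2⟩
    · have hsub : ∀ u, u ≠ w → (if u = w then B else if u = v then A else X u) ⊆ X u := by
        intro u hu
        by_cases huv : u = v
        · subst huv
          simpa [hu] using hA
        · simp [hu, huv]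
      have hvw' : v ≠ w := hvw.ne
      rintro u (rfl | hu) u' (rfl | hu') huu'
      · exact (huu'.ne rfl).elim
      · obtain ⟨rfl, -⟩ := hcross u' (hUW u' hu') u hwW huu'.symm
        simpa [hwW, hvW, hvw'] using hAB.symm
      · obtain ⟨rfl, -⟩ := hcross u (hUW u hu) u' hwW huu'
        simpa [hwW, hvW, hvw'] using hAB
      · simp only [hUW u hu, hUW u' hu', if_false]
        exact (hXm u hu u' hu' huu').mono (hsub u fun e => hwU (e ▸ hu))
          (hsub u' fun e => hwU (e ▸ hu'))
  · have hatt : Attaches T G c χ W φ v w φ :=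
      ⟨hφ.mono (Set.subset_univ _) fun _ _ => id,
        fun z hz a ha hza => ha (hφ.injOn (Set.mem_univ _) (Set.mem_univ _) hza ▸ hz),
        hφ.adj _ (Set.mem_univ _) _ (Set.mem_univ _) hvw,
        hφ.color _ (Set.mem_univ _) _ (Set.mem_univ _) hvw⟩
    have hnone : c s(φ v, φ w) = none := by
      cases hc : c s(φ v, φ w) with
      | none => rfl
      | some κ =>
        exfalso
        obtain rfl := hatt.color κ hc
        obtain ⟨χ', A, hA, B, hB, hcA, hcB, hAB⟩ :=
          exists_mono_bipartite (X v) (S (φ w)) fun a b => d s((φ v, a), (φ w, b))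
        have hFA : F (φ v) ≤ A.card :=
          (bipartiteRamsey_mono ((hg (hcard _)).trans (hX v hvU).2)).trans hcA
        have hFB : F (φ w) ≤ B.card :=
          (bipartiteRamsey_mono ((hgle _).trans (hcard _))).trans hcB
        by_cases hχ' : χ' = κ
        · subst hχ'
          exact hK ⟨φ, hatt, A, hA, B, hB, hFA, hFB, hAB⟩
        · have : χ' = κ + 1 := by omega
          subst this
          exact hst.coherent _ _ hatt.adj κ hc A (hA.trans (hX v hvU).1) B hB hFA hFB hAB
    obtain ⟨c', S', L', hst', hlt⟩ := hst.step hg hvw hφ (hX v hvU).1 (hX v hvU).2 hnone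
      fun ψ hψ A hA B hB h1 h2 h3 => hK ⟨ψ, hψ, A, hA, B, hB, h1, h2, h3⟩
    exact ih _ (hk ▸ hlt) c' S' L' hst' rfl

/-- In a tree, an edge leaving a connected set of vertices cuts off a branch avoiding that set. -/
theorem SimpleGraph.IsAcyclic.exists_branch {T : SimpleGraph α} (hT : T.IsAcyclic) {U : Set α}
    {r v w : α}
    (hU : ∀ u ∈ U, Relation.ReflTransGen (fun a b => T.Adj a b ∧ a ∈ U ∧ b ∈ U) r u)
    (hv : v ∈ U) (hw : w ∉ U) (hvw : T.Adj v w) :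
    ∃ W : Set α, (∀ u ∈ U, u ∉ W) ∧ w ∈ W ∧
      ∀ a ∉ W, ∀ b ∈ W, T.Adj a b → a = v ∧ b = w := by
  have hbr : ¬ (T.deleteEdges {s(v, w)}).Reachable v w :=
    SimpleGraph.isBridge_iff.1 (SimpleGraph.isAcyclic_iff_forall_adj_isBridge.1 hT hvw)
  have hreach : ∀ u ∈ U, (T.deleteEdges {s(v, w)}).Reachable r u := by
    intro u hu
    have := hU u hu
    clear hu
    induction this with
    | refl => exact SimpleGraph.Reachable.refl _
    | tail _ hab ih =>
      refine ih.trans (SimpleGraph.Adj.reachable ?_)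
      rw [SimpleGraph.deleteEdges_adj]
      refine ⟨hab.1, fun he => ?_⟩
      rcases Sym2.eq_iff.1 he with ⟨-, rfl⟩ | ⟨rfl, -⟩
      · exact hw hab.2.2
      · exact hw hab.2.1
  refine ⟨{z | (T.deleteEdges {s(v, w)}).Reachable w z}, ?_, SimpleGraph.Reachable.refl _, ?_⟩
  · intro u hu huW
    exact hbr (((hreach v hv).symm.trans (hreach u hu)).trans huW.symm)
  · intro a ha b hb hab
    by_cases he : s(a, b) = s(v, w)
    · rcases Sym2.eq_iff.1 he with h | ⟨rfl, rfl⟩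
      · exact h
      · exact (ha (SimpleGraph.Reachable.refl _)).elim
    · refine (ha (hb.trans (SimpleGraph.Adj.reachable ?_))).elim
      rw [SimpleGraph.deleteEdges_adj]
      exact ⟨hab.symm, fun h => he (Sym2.eq_swap.trans h)⟩

theorem tendsto_iterate_atTop {g : ℕ → ℕ} (hg : Filter.Tendsto g Filter.atTop Filter.atTop)
    (k : ℕ) : Filter.Tendsto g^[k] Filter.atTop Filter.atTop := by
  induction k with
  | zero => exact Filter.tendsto_id
  | succ k ih => exact ih.comp hg

theorem SimpleGraph.IsTree.exists_goodFor_univ [Fintype α] {T : SimpleGraph α} (hT : T.IsTree) :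
    ∃ f : ℕ → ℕ, Monotone f ∧ Filter.Tendsto f Filter.atTop Filter.atTop ∧
      (∀ n, f n ≤ n) ∧ GoodFor T Set.univ f := by
  classical
  obtain ⟨r⟩ := hT.connected.nonempty
  suffices hk : ∀ k : ℕ, ∀ U : Set α, Uᶜ.ncard = k → r ∈ U →
      (∀ u ∈ U, Relation.ReflTransGen (fun a b => T.Adj a b ∧ a ∈ U ∧ b ∈ U) r u) →
      (∃ g : ℕ → ℕ, Monotone g ∧ Filter.Tendsto g Filter.atTop Filter.atTop ∧
        (∀ n, g n ≤ n) ∧ GoodFor T U g) →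
      ∃ f : ℕ → ℕ, Monotone f ∧ Filter.Tendsto f Filter.atTop Filter.atTop ∧
        (∀ n, f n ≤ n) ∧ GoodFor T Set.univ f by
    refine hk _ {r} rfl rfl ?_
      ⟨id, monotone_id, Filter.tendsto_id, fun _ => le_rfl, goodFor_singleton T r⟩
    rintro u rfl
    exact Relation.ReflTransGen.refl
  intro k
  induction k with
  | zero =>
    intro U hU _ _ hg
    rw [Set.ncard_eq_zero, Set.compl_empty_iff] at hU
    rwa [hU] at hg
  | succ k ih =>
    intro U hU hr hconn ⟨g, hg, hgt, hgle, hgood⟩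
    obtain ⟨z, hz⟩ : Uᶜ.Nonempty := by
      rw [← Set.ncard_pos]
      omega
    obtain ⟨p⟩ := hT.connected.preconnected r z
    obtain ⟨e, -, hv, hw⟩ := p.exists_boundary_dart U hr hz
    obtain ⟨W, hUW, hwW, hcross⟩ := hT.isAcyclic.exists_branch hconn hv hw e.adj
    have hmono := hg.iterate (2 * (Fintype.card α + 1) ^ Fintype.card α)
    refine ih (insert e.snd U) ?_ (Set.mem_insert_of_mem _ hr) ?_
      ⟨_, bipartiteRamsey_mono.comp (hg.comp hmono),
        tendsto_bipartiteRamsey.comp (hgt.comp (tendsto_iterate_atTop hgt _)), ?_,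
        hgood.insert_vertex hg hgle hv hUW hwW e.adj hcross⟩
    · have : (insert e.snd U)ᶜ = Uᶜ \ {e.snd} := by
        ext a
        simp only [Set.mem_compl_iff, Set.mem_insert_iff, Set.mem_sdiff, Set.mem_singleton_iff]
        tauto
      rw [this, Set.ncard_sdiff_singleton_of_mem hw, hU]
      rfl
    · have hlift : ∀ u ∈ U, Relation.ReflTransGen
          (fun a b => T.Adj a b ∧ a ∈ insert e.snd U ∧ b ∈ insert e.snd U) r u := by
        intro u hu
        refine Relation.ReflTransGen.mono ?_ _ _ (hconn u hu)
        exact fun a b hab => ⟨hab.1, Set.mem_insert_of_mem _ hab.2.1,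
          Set.mem_insert_of_mem _ hab.2.2⟩
      rintro u (rfl | hu)
      · exact (hlift _ hv).tail ⟨e.adj, Set.mem_insert_of_mem _ hv, Set.mem_insert _ _⟩
      · exact hlift u hu
    · intro n
      exact (bipartiteRamsey_le _).trans ((hgle _).trans
        (Function.iterate_le_id_of_le_id (f := g) hgle _ n))

end Blowup

/-- For every tree `T` and subtree `T' ⊆ T` (given by an embedding `ι` of `T'`
into `T`) there is a non-decreasing function `f : ℕ → ℕ` tending to infinity
such that: for every graph `G` with `G →₂ T`, every partial `2`-colouring `c`
of `G`, every `m : V(G) → ℕ` and every `2`-colouring `c'` of the blowup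
`G[{m(x)}ₓ]` which is `f`-coherent with `c`, there are a colour `χ` and
subgraphs `H' ⊆ H ⊆ G` (with `H` a possible `χ` copy of `T`, given by `φ`,
and `H'` a copy of `T'` inside `H`, given by `ρ`) such that the blowup
contains a canonical copy of `H'[{f(m(x))}ₓ]` all of whose edges are
coloured `χ` by `c'`. -/
theorem trees_coherent_blowup (p q : ℕ) (T : SimpleGraph (Fin p))
    (T' : SimpleGraph (Fin q)) (ι : Fin q → Fin p)
    (hT : T.IsTree) (hT' : T'.IsTree) (hι : Function.Injective ι)
    (hsub : ∀ u v, T'.Adj u v → T.Adj (ι u) (ι v)) :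
    ∃ f : ℕ → ℕ, Monotone f ∧ Filter.Tendsto f Filter.atTop Filter.atTop ∧
      ∀ (n : ℕ) (G : SimpleGraph (Fin n)), Arrows G T 2 →
        ∀ (c : Sym2 (Fin n) → Option (Fin 2)) (m : Fin n → ℕ)
          (c' : Sym2 ((x : Fin n) × Fin (m x)) → Fin 2),
          Coherent G c m f c' →
          ∃ (χ : Fin 2) (φ : Fin p → Fin n), IsPossibleCopy T G c φ χ ∧
            ∃ ρ : Fin q → Fin n, Function.Injective ρ ∧
              Set.range ρ ⊆ Set.range φ ∧
              (∀ u v, T'.Adj u v →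
                s(ρ u, ρ v) ∈ Sym2.map φ '' T.edgeSet) ∧
              ∃ g : (u : Fin q) → Fin (f (m (ρ u))) → Fin (m (ρ u)),
                (∀ u, Function.Injective (g u)) ∧
                ∀ u v, T'.Adj u v → ∀ i j,
                  c' s(⟨ρ u, g u i⟩, ⟨ρ v, g v j⟩) = χ := by
  obtain ⟨f, hf, hft, -, hgood⟩ := hT.exists_goodFor_univ
  refine ⟨f, hf, hft, fun n G hG c m c' hco => ?_⟩
  let j : ((x : Fin n) × Fin (m x)) → Fin n × ℕ := fun z => (z.1, z.2.val)
  have hj : Function.Injective j := by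
    rintro ⟨x, a⟩ ⟨y, b⟩ h
    simp only [j, Prod.mk.injEq] at h
    obtain ⟨rfl, h⟩ := h
    rw [Fin.ext h]
  let d : Sym2 (Fin n × ℕ) → Fin 2 := Function.extend (Sym2.map j) c' 0
  have hd : ∀ x y a b, d s((x, Fin.val a), (y, Fin.val b)) = c' s(⟨x, a⟩, ⟨y, b⟩) :=
    fun x y a b => (Sym2.map.injective hj).extend_apply c' 0 s(⟨x, a⟩, ⟨y, b⟩)
  have hemb : ∀ x (A : Finset ℕ), A ⊆ Finset.range (m x) → f (m x) ≤ A.card →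
      ∃ a : Fin (f (m x)) → Fin (m x), Function.Injective a ∧ ∀ i, (a i : ℕ) ∈ A := by
    intro x A hA hc
    obtain ⟨A', hA', hc'⟩ := Finset.exists_subset_card_eq hc
    refine ⟨fun i => ⟨A'.orderEmbOfFin hc' i, Finset.mem_range.1
      (hA (hA' (Finset.orderEmbOfFin_mem _ _ _)))⟩, ?_, fun i =>
        hA' (Finset.orderEmbOfFin_mem _ _ _)⟩
    intro i i' h
    simpa using h
  obtain ⟨χ, φ, X, hφ, hX, hm⟩ := hgood n G hG c (fun x => Finset.range (m x)) d (by
    intro x y hxy k hk A hA B hB hFA hFB hAB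
    simp only [Finset.card_range] at hFA hFB
    obtain ⟨a, ha, haA⟩ := hemb x A hA hFA
    obtain ⟨b, hb, hbB⟩ := hemb y B hB hFB
    refine hco x y hxy k hk ⟨a, b, ha, hb, fun i i' h => ?_⟩
    have h1 := hAB _ (haA i) _ (hbB i')
    rw [hd, h] at h1
    revert h1
    clear * -
    revert k
    decide)
  have hφi : Function.Injective φ := fun a b h => hφ.injOn (Set.mem_univ _) (Set.mem_univ _) h
  simp only [Finset.card_range] at hX
  choose a ha haX using fun u => hemb (φ u) (X u) (hX u (Set.mem_univ _)).1
    (hX u (Set.mem_univ _)).2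
  refine ⟨χ, φ, ⟨hφi, fun u v huv => ⟨hφ.adj u (Set.mem_univ _) v (Set.mem_univ _) huv,
    hφ.color u (Set.mem_univ _) v (Set.mem_univ _) huv⟩⟩, φ ∘ ι, hφi.comp hι,
    Set.range_comp_subset_range _ _, fun u v huv => ⟨s(ι u, ι v), hsub u v huv, rfl⟩,
    fun u => a (ι u), fun u => ha (ι u), fun u v huv i i' => ?_⟩
  rw [← hm (ι u) (Set.mem_univ _) (ι v) (Set.mem_univ _) (hsub u v huv) _ (haX (ι u) i) _
    (haX (ι v) i'), hd]
  rfl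
end

section
/- Let r, s ∈ ℕ and let H be a 3-chromatically connected graph. Then there exists a graph G such that (1) G →ᵣ H, and (2) the girth of the hypergraph H(G) of copies of H in G is greater than s. -/
/-- A graph `H` is `3`-chromatically connected if it has at least `3` vertices
and for every vertex subset `s` inducing a bipartite (i.e. `2`-colourable)
subgraph, the graph obtained by deleting `s` is connected. -/
def ThreeChromaticallyConnected {β : Type*} [Fintype β] (H : SimpleGraph β) : Prop :=
  3 ≤ Fintype.card β ∧
    ∀ s : Set β, (H.induce s).Colorable 2 → (H.induce sᶜ).Connected

/-- The hyperedges of the hypergraph `H(G)` of copies of `H` in `G`: its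
vertices are the edges of `G`, and each copy of `H` in `G` contributes the set
of edges of `G` it uses as a hyperedge. -/
def CopyHyperedges {α β : Type*} (H : SimpleGraph β) (G : SimpleGraph α) :
    Set (Set (Sym2 α)) :=
  {A | ∃ φ : β → α, Function.Injective φ ∧
        (∀ u v, H.Adj u v → G.Adj (φ u) (φ v)) ∧ A = Sym2.map φ '' H.edgeSet}

/-- A hypergraph (given by its set `E` of hyperedges over vertex type `V`) has
a Berge cycle of length `ℓ` if `ℓ ≥ 2` and there are distinct hyperedges
`e 0, …, e (ℓ-1)` in `E` and distinct vertices `v 0, …, v (ℓ-1)` with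
`v i ∈ e i ∩ e (i+1)` (indices cyclic). -/
def HasBergeCycle {V : Type*} (E : Set (Set V)) (ℓ : ℕ) : Prop :=
  2 ≤ ℓ ∧ ∃ (e : Fin ℓ → Set V) (v : Fin ℓ → V),
    Function.Injective e ∧ Function.Injective v ∧ (∀ i, e i ∈ E) ∧
      ∀ i : Fin ℓ, v i ∈ e i ∧ v i ∈ e ⟨(i.val + 1) % ℓ, Nat.mod_lt _ i.pos⟩

/-! ### Short cycles in indexed families of sets -/

/-- The family `E` has a Berge cycle with hyperedges `E (e 0), …, E (e (ℓ - 1))` and connecting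
vertices `v 0, …, v (ℓ - 1)`; only the first `ℓ` values of `e` and `v` matter, and `e ℓ = e 0`. -/
structure IsBergeCycle {I X : Type*} (E : I → Set X) (ℓ : ℕ) (e : ℕ → I) (v : ℕ → X) : Prop where
  injOn_left : Set.InjOn e (Set.Iio ℓ)
  injOn_right : Set.InjOn v (Set.Iio ℓ)
  closed : e ℓ = e 0
  mem : ∀ t < ℓ, v t ∈ E (e t) ∧ v t ∈ E (e (t + 1))

/-- The family `E` has no Berge cycle of length between `2` and `s`. -/
def ShortCycleFree {I X : Type*} (E : I → Set X) (s : ℕ) : Prop :=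
  ∀ ℓ, 2 ≤ ℓ → ℓ ≤ s → ∀ e v, ¬ IsBergeCycle E ℓ e v

theorem ShortCycleFree.image {I X Y : Type*} {E : I → Set X} {s : ℕ} (hE : ShortCycleFree E s)
    {F : X → Y} (hF : Function.Injective F) : ShortCycleFree (fun i => F '' E i) s := by
  intro ℓ h2 hs e v h
  have hx : ∀ t, ∃ x, t < ℓ → x ∈ E (e t) ∧ F x = v t := by
    intro t
    by_cases ht : t < ℓ
    · obtain ⟨x, hx, hxv⟩ := (h.mem t ht).1
      exact ⟨x, fun _ => ⟨hx, hxv⟩⟩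
    · obtain ⟨x, -⟩ := (h.mem 0 (by omega)).1
      exact ⟨x, fun h' => absurd h' ht⟩
  choose x hx using hx
  refine hE ℓ h2 hs e x ⟨h.injOn_left, ?_, h.closed, fun t ht => ⟨(hx t ht).1, ?_⟩⟩
  · intro a ha b hb hab
    exact h.injOn_right ha hb (by rw [← (hx a ha).2, ← (hx b hb).2, hab])
  · obtain ⟨y, hy, hyv⟩ := (h.mem t ht).2
    rwa [hF ((hx t ht).2.trans hyv.symm)]

/-- In a family without short Berge cycles, every short closed walk with distinct connecting
vertices is stationary. -/
theorem ShortCycleFree.closedWalk_const {I X : Type*} {E : I → Set X} {s : ℕ}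
    (hE : ShortCycleFree E s) (ℓ : ℕ) : ℓ ≤ s → ∀ (e : ℕ → I) (v : ℕ → X),
      Set.InjOn v (Set.Iio ℓ) → e ℓ = e 0 →
      (∀ t < ℓ, e t ≠ e (t + 1) → v t ∈ E (e t) ∧ v t ∈ E (e (t + 1))) →
      ∀ t ≤ ℓ, e t = e 0 := by
  induction ℓ using Nat.strong_induction_on with
  | _ ℓ ih =>
  intro hs e v hv hclosed hstep
  by_cases hrep : ∃ i j, i < j ∧ j ≤ ℓ ∧ j - i < ℓ ∧ e i = e j
  · obtain ⟨i, j, hij, hjl, hlt, heq⟩ := hrep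
    have hin : ∀ t ≤ j - i, e (i + t) = e i := by
      refine ih (j - i) hlt (by omega) (fun t => e (i + t)) (fun t => v (i + t)) ?_ ?_ ?_
      · intro a ha b hb hab
        simp only [Set.mem_Iio] at ha hb
        have := hv (show i + a ∈ Set.Iio ℓ by simp; omega)
          (show i + b ∈ Set.Iio ℓ by simp; omega) hab
        omega
      · simp only [Nat.add_zero, heq]
        congr 1
        omega
      · intro t ht
        exact hstep (i + t) (by omega)
    have hout : ∀ t ≤ ℓ - (j - i), (if t ≤ i then e t else e (t + (j - i))) = e 0 := by
      have := ih (ℓ - (j - i)) (by omega) (by omega)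
        (fun t => if t ≤ i then e t else e (t + (j - i)))
        (fun t => if t < i then v t else v (t + (j - i))) ?_ ?_ ?_
      · simpa using this
      · intro a ha b hb hab
        simp only [Set.mem_Iio] at ha hb hab
        split_ifs at hab
        · exact hv (by simp; omega) (by simp; omega) hab
        · have := hv (by simp; omega) (by simp; omega) hab
          omega
        · have := hv (by simp; omega) (by simp; omega) hab
          omega
        · have := hv (by simp; omega) (by simp; omega) hab
          omega
      · simp only [Nat.zero_le, if_true]
        split_ifs with h
        · have h1 : ℓ - (j - i) = i := by omega
          have h2 : j = ℓ := by omega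
          rw [h1, heq, h2, hclosed]
        · rw [← hclosed]
          congr 1
          omega
      · intro t ht hne
        rcases lt_trichotomy t i with hti | rfl | hti
        · simp only [hti, hti.le, if_true, Nat.succ_le_of_lt hti] at hne ⊢
          exact hstep t (by omega) hne
        · simp only [lt_irrefl, le_refl, if_true, if_false, Nat.not_succ_le_self] at hne ⊢
          have h1 : t + (j - t) = j := by omega
          have h2 : t + 1 + (j - t) = j + 1 := by omega
          rw [h2, heq] at hne ⊢
          rw [h1]
          exact hstep j (by omega) hne
        · have h1 : ¬ t < i := by omega
          have h2 : ¬ t ≤ i := by omega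
          have h3 : ¬ t + 1 ≤ i := by omega
          have h4 : t + 1 + (j - i) = t + (j - i) + 1 := by omega
          simp only [h1, h2, h3, if_false, h4] at hne ⊢
          exact hstep _ (by omega) hne
    intro t ht
    have hi : e i = e 0 := by simpa using hout i (by omega)
    rcases le_or_gt t i with hti | hti
    · simpa [hti] using hout t (by omega)
    · rcases le_or_gt t j with htj | htj
      · have := hin (t - i) (by omega)
        rw [← hi, ← this]
        congr 1
        omega
      · have := hout (t - (j - i)) (by omega)
        rw [if_neg (by omega)] at this
        rw [← this]
        congr 1
        omega
  · push Not at hrep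
    rcases Nat.lt_or_ge ℓ 2 with h2 | h2
    · intro t ht
      have : t = 0 ∨ t = ℓ := by omega
      rcases this with rfl | rfl
      · rfl
      · exact hclosed
    · refine absurd ⟨?_, hv, hclosed, fun t ht => hstep t ht ?_⟩ (hE ℓ h2 hs e v)
      · intro a ha b hb hab
        simp only [Set.mem_Iio] at ha hb
        by_contra hne
        rcases lt_or_gt_of_ne hne with h | h
        · exact hrep a b h (by omega) (by omega) hab
        · exact hrep b a h (by omega) (by omega) hab.symm
      · exact hrep t (t + 1) (by omega) (by omega) (by omega)

theorem HasBergeCycle.exists_isBergeCycle {X : Type*} {E : Set (Set X)} {ℓ : ℕ}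
    (h : HasBergeCycle E ℓ) :
    2 ≤ ℓ ∧ ∃ e v, IsBergeCycle (fun A : E => (A : Set X)) ℓ e v := by
  obtain ⟨h2, e, v, he, hv, hmem, hinc⟩ := h
  have hpos : 0 < ℓ := by omega
  refine ⟨h2, fun t => ⟨e ⟨t % ℓ, Nat.mod_lt _ hpos⟩, hmem _⟩,
    fun t => v ⟨t % ℓ, Nat.mod_lt _ hpos⟩, ?_, ?_, ?_, ?_⟩
  · intro a ha b hb hab
    have := he (Subtype.ext_iff.1 hab)
    simpa [Nat.mod_eq_of_lt ha, Nat.mod_eq_of_lt hb] using this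
  · intro a ha b hb hab
    have := hv hab
    simpa [Nat.mod_eq_of_lt ha, Nat.mod_eq_of_lt hb] using this
  · simp
  · intro t ht
    have := hinc ⟨t, ht⟩
    simpa [Nat.mod_eq_of_lt ht] using this

/-! ### Random selection with deletions -/

open Finset in
theorem card_comp_mem_mul_le {F : Type*} [Fintype F] {k m : ℕ} (P : (Fin k → F) → Prop)
    [DecidablePred P] {j : Fin k → Fin m} (hj : Function.Injective j) :
    #{g : Fin m → F | P (g ∘ j)} * Fintype.card F ^ k ≤ #{x | P x} * Fintype.card F ^ m := by
  have h := card_le_card_of_injOn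
    (s := ({g : Fin m → F | P (g ∘ j)} : Finset _) ×ˢ (univ : Finset (Fin k → F)))
    (t := ({x | P x} : Finset (Fin k → F)) ×ˢ (univ : Finset (Fin m → F)))
    (fun z => (z.1 ∘ j, Function.extend j z.2 z.1)) ?_ ?_
  · simpa [card_product] using h
  · rintro ⟨g, y⟩ h
    simpa using h
  · rintro ⟨g, y⟩ - ⟨g', y'⟩ - h
    simp only [Prod.mk.injEq] at h
    obtain ⟨h1, h2⟩ := h
    refine Prod.ext (funext fun i => ?_) (funext fun a => ?_)
    · by_cases hi : ∃ a, j a = i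
      · obtain ⟨a, rfl⟩ := hi
        exact congrFun h1 a
      · simpa [Function.extend_apply' _ _ _ hi] using congrFun h2 i
    · simpa [hj.extend_apply] using congrFun h2 (j a)

open Finset in
theorem sum_half_pow_card_le {F : Type*} [Fintype F] (m : ℕ) (P : F → Prop) [DecidablePred P]
    {δ : ℝ} (hP : δ * Fintype.card F ≤ #{x | P x}) :
    ∑ g : Fin m → F, (1 / 2 : ℝ) ^ #{i | P (g i)} ≤
      ((1 - δ / 2) * Fintype.card F) ^ m := by
  have h1 : ∀ g : Fin m → F, (1 / 2 : ℝ) ^ #{i | P (g i)} =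
      ∏ i, (if P (g i) then (1 / 2 : ℝ) else 1) := by
    intro g
    rw [prod_ite]
    simp
  have h2 : ∑ x : F, (if P x then (1 / 2 : ℝ) else 1) = Fintype.card F - #{x | P x} / 2 := by
    have h3 : ∀ x : F, (if P x then (1 / 2 : ℝ) else 1) = 1 - (if P x then 1 else 0) / 2 := by
      intro x
      split_ifs <;> norm_num
    simp_rw [h3]
    rw [sum_sub_distrib, ← sum_div]
    simp
  simp_rw [h1]
  rw [← Fintype.sum_pow fun x => if P x then (1 / 2 : ℝ) else 1, h2]
  refine pow_le_pow_left₀ ?_ (by linarith) m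
  have : (#{x | P x} : ℝ) ≤ Fintype.card F := by
    exact_mod_cast card_le_univ _
  have : (0 : ℝ) ≤ Fintype.card F := by positivity
  linarith

open Finset in
/-- If every colouring makes a positive proportion of `F` good while the configurations
`P ℓ` are rare, then there is a multiset of elements of `F`, given by `g` on the index set `T`,
that avoids all configurations and contains a good element for every colouring. -/
theorem exists_selection {F C : Type*} [Fintype F] [Fintype C] [Nonempty F]
    (good : C → F → Prop) (P : (ℓ : ℕ) → (Fin (ℓ + 1) → F) → Prop) (s m D : ℕ) (hD : 0 < D)
    (δ : ℝ) (hδ : ∀ c, δ * Fintype.card F ≤ Nat.card {x // good c x})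
    (hC : Fintype.card C * (1 - δ / 2) ^ m * 2 ^ D < 1 / 2)
    (hP : ∑ ℓ ∈ range s, (m : ℝ) ^ (ℓ + 1) * Nat.card {x // P ℓ x} / Fintype.card F ^ (ℓ + 1)
      ≤ D / 2) :
    ∃ (g : Fin m → F) (T : Finset (Fin m)), (∀ c, ∃ i ∈ T, good c (g i)) ∧
      ∀ ℓ < s, ∀ j : Fin (ℓ + 1) → Fin m, Function.Injective j → (∀ a, j a ∈ T) →
        ¬ P ℓ (g ∘ j) := by
  classical
  simp only [Nat.card_eq_fintype_card, Fintype.card_subtype] at hδ hP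
  have hF : (0 : ℝ) < Fintype.card F := by exact_mod_cast Fintype.card_pos
  have hD' : (0 : ℝ) < D := by exact_mod_cast hD
  let bad (g : Fin m → F) : Finset (Σ ℓ : ℕ, Fin (ℓ + 1) → Fin m) :=
    (range s).sigma fun ℓ => {j | Function.Injective j ∧ P ℓ (g ∘ j)}
  have hbad : ∑ g : Fin m → F, (#(bad g) : ℝ) ≤ D / 2 * Fintype.card F ^ m := by
    have h1 : ∀ ℓ, ∑ g : Fin m → F,
        (#{j : Fin (ℓ + 1) → Fin m | Function.Injective j ∧ P ℓ (g ∘ j)} : ℝ) ≤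
        (m : ℝ) ^ (ℓ + 1) * #{x | P ℓ x} / Fintype.card F ^ (ℓ + 1) * Fintype.card F ^ m := by
      intro ℓ
      have h2 : ∑ g : Fin m → F,
          (#{j : Fin (ℓ + 1) → Fin m | Function.Injective j ∧ P ℓ (g ∘ j)} : ℝ) =
          ∑ j : Fin (ℓ + 1) → Fin m,
            (#{g : Fin m → F | Function.Injective j ∧ P ℓ (g ∘ j)} : ℝ) := by
        simp only [card_filter]
        push_cast
        exact sum_comm
      have h3 : ∀ j : Fin (ℓ + 1) → Fin m,
          (#{g : Fin m → F | Function.Injective j ∧ P ℓ (g ∘ j)} : ℝ) ≤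
            #{x | P ℓ x} * Fintype.card F ^ m / Fintype.card F ^ (ℓ + 1) := by
        intro j
        by_cases hj : Function.Injective j
        · rw [le_div_iff₀ (by positivity)]
          simp only [hj, true_and]
          exact_mod_cast card_comp_mem_mul_le (P ℓ) hj
        · simp only [hj, false_and, filter_false, card_empty, Nat.cast_zero]
          positivity
      rw [h2]
      refine (sum_le_sum fun j _ => h3 j).trans (le_of_eq ?_)
      simp only [sum_const, card_univ, Fintype.card_fun, Fintype.card_fin, nsmul_eq_mul]
      push_cast
      ring
    calc ∑ g : Fin m → F, (#(bad g) : ℝ)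
        = ∑ ℓ ∈ range s, ∑ g : Fin m → F,
          (#{j : Fin (ℓ + 1) → Fin m | Function.Injective j ∧ P ℓ (g ∘ j)} : ℝ) := by
          simp only [bad, card_sigma]
          push_cast
          exact sum_comm
      _ ≤ _ := sum_le_sum fun ℓ _ => h1 ℓ
      _ ≤ D / 2 * Fintype.card F ^ m := by
          rw [← sum_mul]
          gcongr
  have hgood : ∑ g : Fin m → F, ∑ c : C, (1 / 2 : ℝ) ^ #{i | good c (g i)} ≤
      Fintype.card C * (1 - δ / 2) ^ m * Fintype.card F ^ m := by
    rw [sum_comm]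
    refine (sum_le_sum fun c _ => sum_half_pow_card_le m (good c) (hδ c)).trans (le_of_eq ?_)
    simp only [sum_const, card_univ, nsmul_eq_mul, mul_pow]
    ring
  obtain ⟨g, -, hg⟩ : ∃ g ∈ (univ : Finset (Fin m → F)),
      (#(bad g) : ℝ) / D + 2 ^ D * ∑ c : C, (1 / 2 : ℝ) ^ #{i | good c (g i)} < 1 := by
    refine exists_lt_of_sum_lt ?_
    rw [sum_add_distrib, ← sum_div, ← mul_sum]
    have hpos : (0 : ℝ) < Fintype.card F ^ m := by positivity
    have h1 : (∑ g : Fin m → F, (#(bad g) : ℝ)) / D ≤ 1 / 2 * Fintype.card F ^ m := by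
      rw [div_le_iff₀ hD']
      linarith
    have h2 : 2 ^ D * ∑ g : Fin m → F, ∑ c : C, (1 / 2 : ℝ) ^ #{i | good c (g i)} <
        1 / 2 * Fintype.card F ^ m := by
      calc _ ≤ 2 ^ D * (Fintype.card C * (1 - δ / 2) ^ m * Fintype.card F ^ m) := by gcongr
        _ = (Fintype.card C * (1 - δ / 2) ^ m * 2 ^ D) * Fintype.card F ^ m := by ring
        _ < _ := by gcongr
    simp only [sum_const, card_univ, Fintype.card_fun, Fintype.card_fin, nsmul_eq_mul, mul_one]
    push_cast
    linarith
  have hbadg : #(bad g) < D := by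
    have h1 : (0 : ℝ) ≤ 2 ^ D * ∑ c : C, (1 / 2 : ℝ) ^ #{i | good c (g i)} := by positivity
    have h2 : (#(bad g) : ℝ) / D < 1 := by linarith
    rw [div_lt_one hD'] at h2
    exact_mod_cast h2
  have hgoodg : ∀ c, D < #{i | good c (g i)} := by
    intro c
    by_contra! hle
    have h1 : (1 / 2 : ℝ) ^ D ≤ ∑ c : C, (1 / 2 : ℝ) ^ #{i | good c (g i)} :=
      (pow_le_pow_of_le_one (by norm_num) (by norm_num) hle).trans
        (single_le_sum (f := fun c => (1 / 2 : ℝ) ^ #{i | good c (g i)})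
          (fun _ _ => by positivity) (mem_univ c))
    have h2 : (2 : ℝ) ^ D * (1 / 2) ^ D = 1 := by rw [← mul_pow]; norm_num
    have h3 := mul_le_mul_of_nonneg_left h1 (by positivity : (0 : ℝ) ≤ 2 ^ D)
    rw [h2] at h3
    have h4 : (0 : ℝ) ≤ #(bad g) / D := by positivity
    linarith
  refine ⟨g, ((bad g).image fun z => z.2 0)ᶜ, ?_, ?_⟩
  · intro c
    by_contra! hno
    have hsub : ({i | good c (g i)} : Finset (Fin m)) ⊆ (bad g).image fun z => z.2 0 := by
      intro i hi
      by_contra hi'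
      exact hno i (mem_compl.2 hi') (mem_filter.1 hi).2
    have := (card_le_card hsub).trans card_image_le
    have := hgoodg c
    omega
  · intro ℓ hℓ j hj hT hPj
    refine mem_compl.1 (hT 0) (mem_image.2 ⟨⟨ℓ, j⟩, ?_, rfl⟩)
    simp [bad, hℓ, hj, hPj]

/-! ### Bipartite Ramsey systems -/

/-- The edges of the image of `B` under `φ`. -/
def edgeImage {W W' : Type*} (B : SimpleGraph W) (φ : W → W') : Set (Sym2 W') :=
  Sym2.map φ '' B.edgeSet

/-- A system of copies `φ i` of a graph `B` with vertex classes `p` inside a bipartite graph `B'`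
with classes `q`: copies are induced and respect the classes, and every colouring of `B'` with
`r` colours has a monochromatic copy in the system. -/
structure RamseySystem {W W' I : Type*} (r : ℕ) (B : SimpleGraph W) (p : W → Bool)
    (B' : SimpleGraph W') (q : W' → Bool) (φ : I → W → W') : Prop where
  ne_of_adj : ∀ x y, B'.Adj x y → q x ≠ q y
  injective : ∀ i, Function.Injective (φ i)
  map_class : ∀ i w, q (φ i w) = p w
  adj_iff : ∀ i u v, B'.Adj (φ i u) (φ i v) ↔ B.Adj u v
  exists_mono : ∀ c : Sym2 W' → Fin r, ∃ i k, ∀ u v, B.Adj u v → c s(φ i u, φ i v) = k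

/-- The Hales–Jewett theorem for the alphabet of edges of `B` gives a Ramsey system inside a
power of `B`. -/
theorem exists_ramseySystem.{u} {W : Type u} [Finite W] (r : ℕ) (B : SimpleGraph W) (p : W → Bool)
    (hB : ∀ x y, B.Adj x y → p x ≠ p y) :
    ∃ (W' I : Type u) (_ : Finite W') (_ : Finite I) (B' : SimpleGraph W') (q : W' → Bool)
      (φ : I → W → W'), RamseySystem r B p B' q φ := by
  classical
  let E := {z : W × W // B.Adj z.1 z.2 ∧ p z.1 = false}
  obtain ⟨ι, _, hι⟩ := Combinatorics.Line.exists_mono_in_high_dimension E (Fin r)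
  let W' := {x : Bool × (ι → W) // ∀ t, p (x.2 t) = x.1}
  let B' : SimpleGraph W' :=
    { Adj := fun x y => x.1.1 ≠ y.1.1 ∧ ∀ t, B.Adj (x.1.2 t) (y.1.2 t)
      symm := ⟨fun x y h => ⟨h.1.symm, fun t => (h.2 t).symm⟩⟩
      loopless := ⟨fun x h => h.1 rfl⟩ }
  have hE : ∀ z : E, p z.1.2 = true := by
    intro z
    have h1 := hB _ _ z.2.1
    rw [z.2.2] at h1
    simpa using h1.symm
  let endpt (b : Bool) (z : E) : W := if b = true then z.1.2 else z.1.1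
  have hendpt : ∀ b z, p (endpt b z) = b := by
    intro b z
    cases b
    · exact z.2.2
    · exact hE z
  have hadj : ∀ b b' z, b ≠ b' → B.Adj (endpt b z) (endpt b' z) := by
    intro b b' z h
    cases b <;> cases b' <;> simp only [ne_eq, not_true_eq_false] at h
    · exact z.2.1
    · exact z.2.1.symm
  let φ (l : Combinatorics.Line E ι) (w : W) : W' :=
    ⟨(p w, fun t => (l.idxFun t).elim w (endpt (p w))), fun t => by
      dsimp only
      cases l.idxFun t with
      | none => rfl
      | some z => exact hendpt _ z⟩
  refine ⟨W', Combinatorics.Line E ι, inferInstance, ?_, B', fun x => x.1.1, φ, ?_, ?_, ?_, ?_, ?_⟩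
  · exact Finite.of_injective (fun l => l.idxFun) fun l l' h => Combinatorics.Line.ext h
  · exact fun x y h => h.1
  · intro l u v h
    obtain ⟨t, ht⟩ := l.proper
    have := congrFun (congrArg (fun x : W' => x.1.2) h) t
    simpa [φ, ht] using this
  · exact fun i w => rfl
  · intro l u v
    constructor
    · rintro ⟨-, h⟩
      obtain ⟨t, ht⟩ := l.proper
      simpa [φ, ht] using h t
    · intro h
      refine ⟨hB _ _ h, fun t => ?_⟩
      simp only [φ]
      cases l.idxFun t with
      | none => exact h
      | some z => exact hadj _ _ z (hB _ _ h)
  · intro c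
    let pt (ω : ι → E) (b : Bool) : W' := ⟨(b, fun t => endpt b (ω t)), fun t => hendpt b (ω t)⟩
    obtain ⟨l, k, hk⟩ := hι fun ω => c s(pt ω false, pt ω true)
    have key : ∀ u v, B.Adj u v → p u = false → c s(φ l u, φ l v) = k := by
      intro u v h hu
      have hv : p v = true := hE ⟨(u, v), h, hu⟩
      rw [← hk ⟨(u, v), h, hu⟩]
      congr 2
      · refine Subtype.ext (Prod.ext hu (funext fun t => ?_))
        simp only [φ, pt, Combinatorics.Line.apply_def, hu]
        cases l.idxFun t <;> rfl
      · refine Subtype.ext (Prod.ext hv (funext fun t => ?_))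
        simp only [φ, pt, Combinatorics.Line.apply_def, hv]
        cases l.idxFun t <;> rfl
    refine ⟨l, k, fun u v h => ?_⟩
    cases hu : p u with
    | false => exact key u v h hu
    | true =>
      have hv : p v = false := by
        have := hB _ _ h
        rw [hu] at this
        simpa using this.symm
      rw [Sym2.eq_swap]
      exact key v u h.symm hv

open Finset in
/-- The vertex sets of the copies on a Berge cycle of copies of `B` overlap substantially. -/
theorem IsBergeCycle.card_biUnion_le {W W' I : Type*} [Fintype W] [DecidableEq W']
    {B : SimpleGraph W} {φ : I → W → W'} (hφ : ∀ i, Function.Injective (φ i)) {ℓ : ℕ}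
    {e : ℕ → I} {v : ℕ → Sym2 W'} (h : IsBergeCycle (fun i => edgeImage B (φ i)) ℓ e v)
    (hℓ : 2 ≤ ℓ) :
    #((range ℓ).biUnion fun t => univ.image (φ (e t))) ≤ ℓ * (Fintype.card W - 2) + 1 := by
  have hsub : ∀ i, ∀ z ∈ edgeImage B (φ i), z.toFinset ⊆ univ.image (φ i) ∧ #z.toFinset = 2 := by
    rintro i _ ⟨z, hz, rfl⟩
    induction z with
    | _ a b =>
    have hne : a ≠ b := B.ne_of_adj hz
    constructor
    · intro x hx
      simp only [Sym2.map_mk, Sym2.mem_toFinset, Sym2.mem_iff] at hx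
      rcases hx with rfl | rfl <;> simp
    · exact Sym2.card_toFinset_of_not_isDiag _ (by simpa using fun h' => hne (hφ i h'))
  have hcard : ∀ i, #(univ.image (φ i)) = Fintype.card W := fun i =>
    card_image_of_injective _ (hφ i)
  have hW : 2 ≤ Fintype.card W := by
    have h1 := hsub _ _ (h.mem 0 (by omega)).1
    have h2 := card_le_card h1.1
    rwa [hcard, h1.2] at h2
  set U : ℕ → Finset W' := fun k => (range k).biUnion fun t => univ.image (φ (e t)) with hU
  have hUsucc : ∀ k, U (k + 1) = univ.image (φ (e k)) ∪ U k := by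
    intro k
    simp only [hU, range_add_one, biUnion_insert]
  have hmemU : ∀ t k, t < k → univ.image (φ (e t)) ⊆ U k := fun t k htk =>
    subset_biUnion_of_mem (fun t => univ.image (φ (e t))) (mem_range.2 htk)
  have hstep : ∀ k, k + 1 < ℓ → #(U (k + 1)) ≤ (k + 1) * (Fintype.card W - 2) + 2 := by
    intro k
    induction k with
    | zero =>
      intro _
      have : U 0 = ∅ := by simp [hU]
      rw [hUsucc, this, union_empty, hcard]
      omega
    | succ k ih =>
      intro hk
      have h1 := ih (by omega)
      have h2 := h.mem k (by omega)
      have h3 : 2 ≤ #(univ.image (φ (e (k + 1))) ∩ U (k + 1)) := by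
        rw [← (hsub _ _ h2.1).2]
        exact card_le_card (subset_inter (hsub _ _ h2.2).1
          ((hsub _ _ h2.1).1.trans (hmemU k _ (by omega))))
      have h4 := card_union_add_card_inter (univ.image (φ (e (k + 1)))) (U (k + 1))
      rw [hcard] at h4
      rw [hUsucc, add_mul _ 1, one_mul]
      omega
  obtain ⟨k, rfl⟩ : ∃ k, ℓ = k + 2 := ⟨ℓ - 2, by omega⟩
  have h1 := hstep k (by omega)
  have h2 := h.mem k (by omega)
  have h3 := h.mem (k + 1) (by omega)
  rw [h.closed] at h3
  have h4 : 3 ≤ #(univ.image (φ (e (k + 1))) ∩ U (k + 1)) := by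
    by_contra! hlt
    have h5 : (v k).toFinset ⊆ univ.image (φ (e (k + 1))) ∩ U (k + 1) :=
      subset_inter (hsub _ _ h2.2).1 ((hsub _ _ h2.1).1.trans (hmemU k _ (by omega)))
    have h6 : (v (k + 1)).toFinset ⊆ univ.image (φ (e (k + 1))) ∩ U (k + 1) :=
      subset_inter (hsub _ _ h3.1).1 ((hsub _ _ h3.2).1.trans (hmemU 0 _ (by omega)))
    have h7 : (v k).toFinset = (v (k + 1)).toFinset :=
      (eq_of_subset_of_card_le h5 (by rw [(hsub _ _ h2.1).2]; omega)).trans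
        (eq_of_subset_of_card_le h6 (by rw [(hsub _ _ h3.1).2]; omega)).symm
    have h8 : v k = v (k + 1) := Sym2.ext fun x => by
      rw [← Sym2.mem_toFinset, h7, Sym2.mem_toFinset]
    have := h.injOn_right (show k ∈ Set.Iio (k + 2) by simp)
      (show k + 1 ∈ Set.Iio (k + 2) by simp) h8
    omega
  have h5 := card_union_add_card_inter (univ.image (φ (e (k + 1)))) (U (k + 1))
  rw [hcard] at h5
  change #(U (k + 2)) ≤ _
  rw [hUsucc, show k + 2 = (k + 1) + 1 from rfl, add_mul _ 1, one_mul]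
  omega

open Finset in
theorem card_fun_small_image_le {A Y : Type*} [Fintype A] [Fintype Y] [DecidableEq A]
    [DecidableEq Y] [Nonempty Y] (q : ℕ) :
    #{f : A → Y | #(univ.image f) ≤ q} ≤ q ^ Fintype.card A * Fintype.card Y ^ q := by
  have h : ({f : A → Y | #(univ.image f) ≤ q} : Finset (A → Y)) ⊆
      (univ : Finset ((A → Fin q) × (Fin q → Y))).image fun z => z.2 ∘ z.1 := by
    intro f hf
    obtain ⟨emb⟩ : Nonempty (univ.image f ↪ Fin q) := by
      refine Function.Embedding.nonempty_of_card_le ?_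
      rw [Fintype.card_coe, Fintype.card_fin]
      exact (mem_filter.1 hf).2
    refine mem_image.2 ⟨(fun a => emb ⟨f a, by simp⟩,
      Function.extend emb Subtype.val fun _ => Classical.arbitrary Y), mem_univ _, ?_⟩
    funext a
    simp [emb.injective.extend_apply]
  refine (card_le_card h).trans (card_image_le.trans ?_)
  simp

open Finset in
/-- In the blow-up of a Ramsey system with parts of size `n`, at least `n ^ |W|` of the copies are
monochromatic under any colouring. -/
theorem RamseySystem.pow_card_le {W W' I : Type*} [Fintype W] [Finite W'] [Finite I] {r : ℕ}
    {B : SimpleGraph W} {p : W → Bool} {B' : SimpleGraph W'} {q : W' → Bool} {φ : I → W → W'}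
    (h : RamseySystem r B p B' q φ) {n : ℕ} (hn : 0 < n) (c : Sym2 (W' × Fin n) → Fin r) :
    n ^ Fintype.card W ≤ Nat.card {x : I × (W → Fin n) //
      ∃ k, ∀ u v, B.Adj u v → c s((φ x.1 u, x.2 u), (φ x.1 v, x.2 v)) = k} := by
  classical
  have := Fintype.ofFinite W'
  have hmono : ∀ f : W' → Fin n, ∃ i k, ∀ u v, B.Adj u v →
      c s((φ i u, f (φ i u)), (φ i v, f (φ i v))) = k := fun f =>
    h.exists_mono fun z => c (z.map fun x => (x, f x))
  choose i hi using hmono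
  have hcard := Nat.card_le_card_of_injective
    (fun z : (W' → Fin n) × (W → Fin n) =>
      ((⟨(i z.1, z.1 ∘ φ (i z.1)), hi z.1⟩ : {x : I × (W → Fin n) //
        ∃ k, ∀ u v, B.Adj u v → c s((φ x.1 u, x.2 u), (φ x.1 v, x.2 v)) = k}),
        Function.extend (φ (i z.1)) z.2 z.1)) ?_
  · simp only [Nat.card_prod] at hcard
    have h1 : Nat.card (W' → Fin n) = n ^ Fintype.card W' := by simp
    have h2 : Nat.card (W → Fin n) = n ^ Fintype.card W := by simp
    rw [h1, h2, mul_comm] at hcard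
    exact Nat.le_of_mul_le_mul_right hcard (by positivity)
  · rintro ⟨f, y⟩ ⟨f', y'⟩ heq
    simp only [Prod.mk.injEq, Subtype.mk.injEq] at heq
    obtain ⟨⟨h1, h2⟩, h3⟩ := heq
    rw [← h1] at h2 h3
    refine Prod.ext (funext fun x => ?_) (funext fun w => ?_)
    · by_cases hx : ∃ w, φ (i f) w = x
      · obtain ⟨w, rfl⟩ := hx
        exact congrFun h2 w
      · simpa [Function.extend_apply' _ _ _ hx] using congrFun h3 x
    · simpa [(h.injective _).extend_apply] using congrFun h3 (φ (i f) w)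

open Finset in
/-- There are few tuples of copies in a blow-up whose vertex sets overlap substantially. -/
theorem card_overlapping_le {W W' I : Type*} [Fintype W] [Fintype W'] [Fintype I]
    [DecidableEq W'] [Nonempty W'] (φ : I → W → W') {n : ℕ} (hn : 0 < n) (k q : ℕ) :
    Nat.card {x : Fin k → I × (W → Fin n) // #(univ.biUnion fun a =>
        univ.image fun w => (φ (x a).1 w, (x a).2 w)) ≤ q} ≤
      Fintype.card I ^ k * q ^ (k * Fintype.card W) * Fintype.card W' ^ q * n ^ q := by
  classical
  have : NeZero n := ⟨hn.ne'⟩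
  have hcard := Nat.card_le_card_of_injective
    (fun x : {x : Fin k → I × (W → Fin n) // #(univ.biUnion fun a =>
        univ.image fun w => (φ (x a).1 w, (x a).2 w)) ≤ q} =>
      ((fun a => (x.1 a).1, ⟨fun z => (φ (x.1 z.1).1 z.2, (x.1 z.1).2 z.2), ?_⟩) :
        (Fin k → I) × {f : Fin k × W → W' × Fin n // #(univ.image f) ≤ q})) ?_
  · refine hcard.trans ?_
    have h1 := card_fun_small_image_le (A := Fin k × W) (Y := W' × Fin n) q
    rw [Nat.card_prod, Nat.card_eq_fintype_card, Nat.card_eq_fintype_card, Fintype.card_subtype]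
    simp only [Fintype.card_prod, Fintype.card_fin, Fintype.card_fun] at h1 ⊢
    calc _ ≤ _ := Nat.mul_le_mul_left _ h1
      _ = _ := by rw [mul_pow]; ring
  · refine le_trans (card_le_card ?_) x.2
    intro y hy
    obtain ⟨⟨a, w⟩, -, rfl⟩ := mem_image.1 hy
    exact mem_biUnion.2 ⟨a, mem_univ _, mem_image_of_mem _ (mem_univ w)⟩
  · rintro ⟨x, hx⟩ ⟨y, hy⟩ heq
    simp only [Prod.mk.injEq, Subtype.mk.injEq] at heq
    refine Subtype.ext (funext fun a => Prod.ext (congrFun heq.1 a) (funext fun w => ?_))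
    exact congrArg Prod.snd (congrFun heq.2 (a, w))

open Finset in
/-- Every bipartite graph has a Ramsey system without short cycles. -/
theorem exists_sparse_ramseySystem.{u} {W : Type u} [Finite W] {r : ℕ} (hr : 0 < r) (s : ℕ)
    (B : SimpleGraph W) (p : W → Bool) (hB : ∀ x y, B.Adj x y → p x ≠ p y) :
    ∃ (W' : Type u) (I : Type) (_ : Finite W') (_ : Finite I) (B' : SimpleGraph W')
      (q : W' → Bool) (φ : I → W → W'),
      RamseySystem r B p B' q φ ∧ ShortCycleFree (fun i => edgeImage B (φ i)) s := by
  classical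
  have := Fintype.ofFinite W
  by_cases hW : Fintype.card W < 2
  · have hno : ∀ u v, ¬ B.Adj u v := by
      intro u v h
      have := Fintype.card_le_one_iff.1 (by omega : Fintype.card W ≤ 1) u v
      exact B.ne_of_adj h this
    refine ⟨W, Unit, inferInstance, inferInstance, B, p, fun _ => id,
      ⟨hB, fun _ => Function.injective_id, fun _ _ => rfl, fun _ _ _ => Iff.rfl,
        fun _ => ⟨(), ⟨0, hr⟩, fun u v h => absurd h (hno u v)⟩⟩, ?_⟩
    intro ℓ h2 _ e v h
    obtain ⟨z, hz, -⟩ := (h.mem 0 (by omega)).1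
    induction z with
    | _ a b => exact hno a b hz
  obtain ⟨W₀, I₀, _, _, B₀, q₀, φ₀, h₀⟩ := exists_ramseySystem r B p hB
  have := Fintype.ofFinite W₀
  have := Fintype.ofFinite I₀
  obtain ⟨i₀, -⟩ := h₀.exists_mono fun _ => ⟨0, hr⟩
  have : Nonempty I₀ := ⟨i₀⟩
  have hWne : Nonempty W := Fintype.card_pos_iff.1 (by omega)
  have : Nonempty W₀ := hWne.map (φ₀ i₀)
  set v := Fintype.card W
  set v₀ := Fintype.card W₀
  have hI : 0 < Fintype.card I₀ := Fintype.card_pos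
  set δ : ℝ := 1 / Fintype.card I₀ with hδ
  have hδ0 : 0 < δ := by positivity
  have hδ1 : δ ≤ 1 := by
    rw [hδ, div_le_one (by positivity)]
    exact_mod_cast hI
  have hR : (0 : ℝ) < (r : ℝ) ^ v₀ ^ 2 := by positivity
  obtain ⟨N, hN⟩ := exists_pow_lt_of_lt_one (x := 1 / (2 * (r : ℝ) ^ v₀ ^ 2)) (y := 1 - δ / 2)
    (by positivity) (by linarith)
  let Q (ℓ : ℕ) := (ℓ + 1) * (v - 2) + 1
  let k (ℓ : ℕ) := Fintype.card I₀ ^ (ℓ + 1) * Q ℓ ^ ((ℓ + 1) * v) * v₀ ^ Q ℓ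
  set K := ∑ ℓ ∈ range s, N ^ (ℓ + 1) * k ℓ + 1 with hK
  set n := 2 * K + 1 with hn
  have hn0 : 0 < n := by omega
  have : NeZero n := ⟨hn0.ne'⟩
  let φ (x : I₀ × (W → Fin n)) (w : W) : W₀ × Fin n := (φ₀ x.1 w, x.2 w)
  have hsel := exists_selection
    (F := I₀ × (W → Fin n)) (C := Sym2 (W₀ × Fin n) → Fin r)
    (fun c x => ∃ k, ∀ u v, B.Adj u v → c s(φ x u, φ x v) = k)
    (fun ℓ x => #(univ.biUnion fun a => univ.image (φ (x a))) ≤ Q ℓ)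
    s (N * n ^ 2) (2 * K * n) (by positivity) δ
  refine (hsel ?_ ?_ ?_).elim fun g ⟨T, hgood, hfree⟩ => ?_
  · intro c
    have h1 := h₀.pow_card_le hn0 c
    have h2 : δ * Fintype.card (I₀ × (W → Fin n)) = (n ^ v : ℕ) := by
      simp only [Fintype.card_prod, Fintype.card_fun, Fintype.card_fin, hδ]
      push_cast
      field_simp
      rfl
    rw [h2]
    exact_mod_cast h1
  · have hcol : Fintype.card (Sym2 (W₀ × Fin n) → Fin r) ≤ (r ^ v₀ ^ 2) ^ n ^ 2 := by
      rw [Fintype.card_fun, Fintype.card_fin, ← pow_mul]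
      refine Nat.pow_le_pow_right hr ?_
      refine (Fintype.card_le_of_surjective _ Sym2.mk_surjective).trans (le_of_eq ?_)
      simp only [Fintype.card_prod, Fintype.card_fin]
      ring
    have hcol' : (Fintype.card (Sym2 (W₀ × Fin n) → Fin r) : ℝ) ≤
        ((r : ℝ) ^ v₀ ^ 2) ^ n ^ 2 := by exact_mod_cast hcol
    have hbase : (r : ℝ) ^ v₀ ^ 2 * (1 - δ / 2) ^ N ≤ 1 / 2 := by
      have h1 := mul_le_mul_of_nonneg_left hN.le hR.le
      refine h1.trans (le_of_eq ?_)
      field_simp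
    have hnonneg : (0 : ℝ) ≤ 1 - δ / 2 := by linarith
    have hn2 : n ^ 2 = 2 * K * n + n := by rw [hn]; ring
    calc (Fintype.card (Sym2 (W₀ × Fin n) → Fin r) : ℝ) * (1 - δ / 2) ^ (N * n ^ 2) *
          2 ^ (2 * K * n)
        ≤ ((r : ℝ) ^ v₀ ^ 2) ^ n ^ 2 * (1 - δ / 2) ^ (N * n ^ 2) * 2 ^ (2 * K * n) := by gcongr
      _ = ((r : ℝ) ^ v₀ ^ 2 * (1 - δ / 2) ^ N) ^ n ^ 2 * 2 ^ (2 * K * n) := by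
          rw [mul_pow, pow_mul (1 - δ / 2)]
      _ ≤ (1 / 2) ^ n ^ 2 * 2 ^ (2 * K * n) := by gcongr
      _ = (1 / 2) ^ n * ((1 / 2) * 2) ^ (2 * K * n) := by rw [hn2, pow_add, mul_pow]; ring
      _ = (1 / 2) ^ n := by norm_num
      _ < (1 / 2) ^ 1 := pow_lt_pow_right_of_lt_one₀ (by norm_num) (by norm_num) (by omega)
      _ = 1 / 2 := pow_one _
  · have hterm : ∀ ℓ, ((N * n ^ 2 : ℕ) : ℝ) ^ (ℓ + 1) *
        Nat.card {x : Fin (ℓ + 1) → I₀ × (W → Fin n) //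
          #(univ.biUnion fun a => univ.image (φ (x a))) ≤ Q ℓ} /
        Fintype.card (I₀ × (W → Fin n)) ^ (ℓ + 1) ≤ ((N ^ (ℓ + 1) * k ℓ : ℕ) : ℝ) * n := by
      intro ℓ
      rw [div_le_iff₀ (by positivity)]
      have h1 := card_overlapping_le φ₀ hn0 (ℓ + 1) (Q ℓ)
      have h2 : 2 * (ℓ + 1) + Q ℓ = 1 + v * (ℓ + 1) := by
        obtain ⟨d, hd⟩ : ∃ d, v = d + 2 := ⟨v - 2, by omega⟩
        simp only [Q, hd, Nat.add_sub_cancel]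
        ring
      have h3 : (N * n ^ 2) ^ (ℓ + 1) * (k ℓ * n ^ Q ℓ) ≤
          N ^ (ℓ + 1) * k ℓ * n * Fintype.card (I₀ × (W → Fin n)) ^ (ℓ + 1) := by
        calc (N * n ^ 2) ^ (ℓ + 1) * (k ℓ * n ^ Q ℓ)
            = N ^ (ℓ + 1) * k ℓ * n ^ (2 * (ℓ + 1) + Q ℓ) := by
              rw [mul_pow, pow_add n (2 * (ℓ + 1)) (Q ℓ), pow_mul n 2, mul_mul_mul_comm]
          _ = N ^ (ℓ + 1) * k ℓ * n * (1 * (n ^ v) ^ (ℓ + 1)) := by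
              rw [h2, pow_add n, pow_mul n]; ring
          _ ≤ N ^ (ℓ + 1) * k ℓ * n * (Fintype.card I₀ ^ (ℓ + 1) * (n ^ v) ^ (ℓ + 1)) := by
              gcongr
              exact Nat.one_le_pow _ _ hI
          _ = _ := by
              simp only [Fintype.card_prod, Fintype.card_fun, Fintype.card_fin, mul_pow]
              rfl
      exact_mod_cast (Nat.mul_le_mul_left _ h1).trans h3
    refine (sum_le_sum fun ℓ _ => hterm ℓ).trans ?_
    rw [← sum_mul]
    have h4 : (∑ ℓ ∈ range s, ((N ^ (ℓ + 1) * k ℓ : ℕ) : ℝ)) ≤ K := by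
      rw [hK]
      push_cast
      linarith
    calc _ ≤ (K : ℝ) * n := by gcongr
      _ = _ := by push_cast; ring
  · refine ⟨W₀ × Fin n, T, inferInstance, inferInstance, B₀.comap Prod.fst, q₀ ∘ Prod.fst,
      fun i => φ (g i), ⟨fun x y => h₀.ne_of_adj _ _, fun i a b hab =>
        h₀.injective _ (congrArg Prod.fst hab), fun i w => h₀.map_class _ w,
        fun i a b => h₀.adj_iff _ a b, fun c => ?_⟩, ?_⟩
    · obtain ⟨i, hi, hk⟩ := hgood c
      exact ⟨⟨i, hi⟩, hk⟩
    · intro L h2 hs e z h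
      obtain ⟨ℓ, rfl⟩ : ∃ ℓ, L = ℓ + 1 := ⟨L - 1, by omega⟩
      refine hfree ℓ (by omega) (fun a => (e a).1) ?_ (fun a => (e a).2) ?_
      · intro a b hab
        exact Fin.ext (h.injOn_left a.2 b.2 (Subtype.ext hab))
      · refine le_trans (card_le_card ?_) (h.card_biUnion_le
          (fun i a b hab => h₀.injective _ (congrArg Prod.fst hab)) h2)
        intro y hy
        obtain ⟨a, -, ha⟩ := mem_biUnion.1 hy
        exact mem_biUnion.2 ⟨a, mem_range.2 a.2, ha⟩

/-! ### Amalgamation along a bipartite Ramsey system -/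

section Amalgam

variable {V W' I β : Type*} {G : SimpleGraph V} {S : Set V} {B' : SimpleGraph W'}
  {φ : I → S → W'} {H : SimpleGraph β}

open Classical in
/-- The `i`-th copy of `V` in the amalgam: the vertices in `S` are embedded by `φ i`, the others
are private to the copy. -/
noncomputable def amalgamMap (φ : I → S → W') (i : I) (v : V) : W' ⊕ I × ↥(Sᶜ) :=
  if h : v ∈ S then .inl (φ i ⟨v, h⟩) else .inr (i, ⟨v, h⟩)

/-- The graph obtained from `B'` by extending every copy `φ i` of `G.induce S` to a copy of `G`. -/
def amalgam (G : SimpleGraph V) (B' : SimpleGraph W') (φ : I → S → W') :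
    SimpleGraph (W' ⊕ I × ↥(Sᶜ)) where
  Adj x y := x ≠ y ∧ ((∃ x' y', x = .inl x' ∧ y = .inl y' ∧ B'.Adj x' y') ∨
    ∃ i u v, G.Adj u v ∧ x = amalgamMap φ i u ∧ y = amalgamMap φ i v)
  symm := ⟨by
    rintro x y ⟨hne, ⟨x', y', hx, hy, h⟩ | ⟨i, u, v, h, hx, hy⟩⟩
    · exact ⟨hne.symm, .inl ⟨y', x', hy, hx, h.symm⟩⟩
    · exact ⟨hne.symm, .inr ⟨i, v, u, h.symm, hy, hx⟩⟩⟩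
  loopless := ⟨fun _ h => h.1 rfl⟩

theorem amalgamMap_of_mem {i : I} {v : V} (h : v ∈ S) :
    amalgamMap φ i v = .inl (φ i ⟨v, h⟩) := dif_pos h

theorem amalgamMap_of_notMem {i : I} {v : V} (h : v ∉ S) :
    amalgamMap φ i v = .inr (i, ⟨v, h⟩) := dif_neg h

theorem amalgamMap_eq_inl {i : I} {v : V} {x : W'} (h : amalgamMap φ i v = .inl x) :
    ∃ hv : v ∈ S, φ i ⟨v, hv⟩ = x := by
  by_cases hv : v ∈ S
  · exact ⟨hv, by simpa [amalgamMap_of_mem hv] using h⟩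
  · simp [amalgamMap_of_notMem hv] at h

theorem amalgamMap_eq_inr {i : I} {v : V} {x : I × ↥(Sᶜ)} (h : amalgamMap φ i v = .inr x) :
    i = x.1 := by
  by_cases hv : v ∈ S
  · simp [amalgamMap_of_mem hv] at h
  · rw [amalgamMap_of_notMem hv, Sum.inr.injEq] at h
    rw [← h]

theorem mem_of_amalgamMap_eq {i j : I} (hij : i ≠ j) {u v : V}
    (h : amalgamMap φ i u = amalgamMap φ j v) : u ∈ S := by
  by_contra hu
  rw [amalgamMap_of_notMem hu] at h
  exact hij (amalgamMap_eq_inr h.symm).symm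

theorem amalgamMap_injective (hφ : ∀ i, Function.Injective (φ i)) (i : I) :
    Function.Injective (amalgamMap φ i) := by
  intro u v h
  by_cases hu : u ∈ S
  · rw [amalgamMap_of_mem hu] at h
    obtain ⟨hv, hv'⟩ := amalgamMap_eq_inl h.symm
    exact congrArg Subtype.val (hφ i hv').symm
  · have hv : v ∉ S := fun hv => by
      rw [amalgamMap_of_notMem hu, amalgamMap_of_mem hv] at h
      exact Sum.inr_ne_inl h
    rw [amalgamMap_of_notMem hu, amalgamMap_of_notMem hv] at h
    simpa using h

theorem amalgam_adj_inl (hadj : ∀ i u v, B'.Adj (φ i u) (φ i v) ↔ (G.induce S).Adj u v)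
    {x y : W'} : (amalgam G B' φ).Adj (.inl x) (.inl y) ↔ B'.Adj x y := by
  constructor
  · rintro ⟨-, ⟨x', y', hx, hy, h⟩ | ⟨i, u, v, h, hx, hy⟩⟩
    · rw [Sum.inl.injEq] at hx hy
      rwa [hx, hy]
    · obtain ⟨hu, rfl⟩ := amalgamMap_eq_inl hx.symm
      obtain ⟨hv, rfl⟩ := amalgamMap_eq_inl hy.symm
      exact (hadj i _ _).2 h
  · intro h
    exact ⟨fun h' => B'.ne_of_adj h (Sum.inl_injective h'), .inl ⟨x, y, rfl, rfl, h⟩⟩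

theorem amalgam_adj_amalgamMap (hφ : ∀ i, Function.Injective (φ i))
    (hadj : ∀ i u v, B'.Adj (φ i u) (φ i v) ↔ (G.induce S).Adj u v) {i : I} {u v : V} :
    (amalgam G B' φ).Adj (amalgamMap φ i u) (amalgamMap φ i v) ↔ G.Adj u v := by
  constructor
  · intro h
    by_cases huv : u ∈ S ∧ v ∈ S
    · rw [amalgamMap_of_mem huv.1, amalgamMap_of_mem huv.2, amalgam_adj_inl hadj, hadj] at h
      exact h
    · obtain ⟨-, ⟨x', y', hx, hy, -⟩ | ⟨j, u', v', h, hx, hy⟩⟩ := h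
      · exact absurd ⟨(amalgamMap_eq_inl hx).1, (amalgamMap_eq_inl hy).1⟩ huv
      · obtain rfl : i = j := by
          by_contra hij
          exact huv ⟨mem_of_amalgamMap_eq hij hx, mem_of_amalgamMap_eq hij hy⟩
        rwa [amalgamMap_injective hφ i hx, amalgamMap_injective hφ i hy]
  · intro h
    exact ⟨fun h' => G.ne_of_adj h (amalgamMap_injective hφ i h'), .inr ⟨i, u, v, h, rfl, rfl⟩⟩

theorem exists_amalgamMap_eq_of_adj_inr {x : I × ↥(Sᶜ)} {y : W' ⊕ I × ↥(Sᶜ)}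
    (h : (amalgam G B' φ).Adj (.inr x) y) : ∃ v, amalgamMap φ x.1 v = y := by
  obtain ⟨-, ⟨x', y', hx, -, -⟩ | ⟨i, u, v, -, hx, hy⟩⟩ := h
  · exact absurd hx Sum.inr_ne_inl
  · rw [← amalgamMap_eq_inr hx.symm]
    exact ⟨v, hy.symm⟩

/-- A copy of a `3`-chromatically connected graph in the amalgam lies in one of the copies
of `G`. -/
theorem exists_copy_of_amalgam [Fintype β] (hH : ThreeChromaticallyConnected H)
    (hadj : ∀ i u v, B'.Adj (φ i u) (φ i v) ↔ (G.induce S).Adj u v) {q : W' → Bool}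
    (hq : ∀ x y, B'.Adj x y → q x ≠ q y) {f : β → W' ⊕ I × ↥(Sᶜ)}
    (hf : ∀ u v, H.Adj u v → (amalgam G B' φ).Adj (f u) (f v)) :
    ∃ i, ∀ b, ∃ v, amalgamMap φ i v = f b := by
  set s : Set β := {b | ∃ x, f b = .inl x} with hs
  have hcol : ∀ t ⊆ s, (H.induce t).Colorable 2 := by
    intro t ht
    choose x hx using fun b : t => ht b.2
    have C : (H.induce t).Coloring Bool := SimpleGraph.Coloring.mk (fun b => q (x b)) (by
      intro a b hab
      have h1 : (amalgam G B' φ).Adj (f a) (f b) := hf _ _ hab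
      rw [hx, hx, amalgam_adj_inl hadj] at h1
      exact hq _ _ h1)
    simpa using C.colorable
  have hout : ∀ b, b ∉ s → ∃ x, f b = .inr x := by
    intro b hb
    cases hfb : f b with
    | inl x => exact absurd ⟨x, hfb⟩ hb
    | inr x => exact ⟨x, rfl⟩
  have hconn := hH.2 s (hcol s subset_rfl)
  obtain ⟨⟨b₀, hb₀⟩⟩ := hconn.nonempty
  obtain ⟨x₀, hx₀⟩ := hout b₀ hb₀
  have howner : ∀ b : ↥(sᶜ), ∃ x, f b = .inr x ∧ x.1 = x₀.1 := by
    intro b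
    obtain ⟨w⟩ := hconn.preconnected ⟨b₀, hb₀⟩ b
    have key : ∀ (a b : ↥(sᶜ)) (_ : ((H.induce sᶜ).Walk a b)),
        (∃ x, f a = .inr x ∧ x.1 = x₀.1) → ∃ x, f b = .inr x ∧ x.1 = x₀.1 := by
      intro a b w
      induction w with
      | nil => exact id
      | @cons u v w hab _ ih =>
        rintro ⟨x, hx, hxi⟩
        refine ih ?_
        have h1 : (amalgam G B' φ).Adj (f u) (f v) := hf _ _ hab
        rw [hx] at h1
        obtain ⟨y', hy'⟩ := exists_amalgamMap_eq_of_adj_inr h1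
        obtain ⟨y, hy⟩ := hout v v.2
        rw [hy] at hy'
        exact ⟨y, hy, (amalgamMap_eq_inr hy').symm.trans hxi⟩
    exact key _ _ w ⟨x₀, hx₀, rfl⟩
  refine ⟨x₀.1, fun b => ?_⟩
  by_cases hb : b ∈ s
  · have hne : b ≠ b₀ := fun h => hb₀ (h ▸ hb)
    have hconn' := hH.2 (s \ {b}) (hcol _ Set.sdiff_subset)
    have hbm : b ∈ (s \ {b})ᶜ := by simp
    have hb₀m : b₀ ∈ (s \ {b})ᶜ := fun h => hb₀ h.1
    have : Nontrivial ↥((s \ {b})ᶜ) :=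
      ⟨⟨b, hbm⟩, ⟨b₀, hb₀m⟩, fun h => hne (congrArg Subtype.val h)⟩
    obtain ⟨⟨d, hd⟩, hbd⟩ := hconn'.preconnected.exists_adj_of_nontrivial ⟨b, hbm⟩
    have hbd' : H.Adj b d := hbd
    have hds : d ∉ s := fun h => hd ⟨h, fun h' => H.ne_of_adj hbd' h'.symm⟩
    obtain ⟨x, hx, hxi⟩ := howner ⟨d, hds⟩
    have h1 := hf _ _ hbd'.symm
    simp only at hx
    rw [hx] at h1
    rw [← hxi]
    exact exists_amalgamMap_eq_of_adj_inr h1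
  · obtain ⟨x, hx, hxi⟩ := howner ⟨b, hb⟩
    refine ⟨x.2, ?_⟩
    simp only at hx
    rw [amalgamMap_of_notMem x.2.2, hx, ← hxi]

theorem CopyHyperedges.subset_edgeSet {A : Set (Sym2 V)} (hA : A ∈ CopyHyperedges H G) :
    A ⊆ G.edgeSet := by
  obtain ⟨f, -, hf, rfl⟩ := hA
  rintro _ ⟨z, hz, rfl⟩
  induction z with
  | _ a b => exact hf a b hz

theorem exists_copyHyperedge_of_amalgam [Fintype β] (hH : ThreeChromaticallyConnected H)
    (hφ : ∀ i, Function.Injective (φ i))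
    (hadj : ∀ i u v, B'.Adj (φ i u) (φ i v) ↔ (G.induce S).Adj u v) {q : W' → Bool}
    (hq : ∀ x y, B'.Adj x y → q x ≠ q y) (A : CopyHyperedges H (amalgam G B' φ)) :
    ∃ (i : I) (A' : CopyHyperedges H G), A.1 = Sym2.map (amalgamMap φ i) '' A'.1 := by
  obtain ⟨A, f, hinj, hf, rfl⟩ := A
  obtain ⟨i, hi⟩ := exists_copy_of_amalgam hH hadj hq hf
  choose g hg using hi
  obtain rfl : amalgamMap φ i ∘ g = f := funext hg
  refine ⟨i, ⟨_, g, hinj.of_comp, fun u v h => ?_, rfl⟩, ?_⟩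
  · exact (amalgam_adj_amalgamMap hφ hadj).1 (hf u v h)
  · rw [Set.image_image]
    exact Set.image_congr fun z _ => (Sym2.map_map z).symm

/-- An edge shared by two different copies of `G` in the amalgam lies in `B'`. -/
theorem mem_edgeImage_of_mem_inter {i j : I} (hij : i ≠ j) {A A' : Set (Sym2 V)}
    (hA : A ⊆ G.edgeSet) {z : Sym2 (W' ⊕ I × ↥(Sᶜ))} (hz : z ∈ Sym2.map (amalgamMap φ i) '' A)
    (hz' : z ∈ Sym2.map (amalgamMap φ j) '' A') :
    z ∈ Sym2.map Sum.inl '' edgeImage (G.induce S) (φ i) := by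
  obtain ⟨e, he, rfl⟩ := hz
  obtain ⟨e', -, he'⟩ := hz'
  have hmem : ∀ a ∈ e, a ∈ S := by
    intro a ha
    have h1 : amalgamMap φ i a ∈ Sym2.map (amalgamMap φ j) e' := by
      rw [he']
      exact Sym2.mem_map.2 ⟨a, ha, rfl⟩
    obtain ⟨b, -, hb⟩ := Sym2.mem_map.1 h1
    exact mem_of_amalgamMap_eq hij hb.symm
  induction e with
  | _ a b =>
  have ha := hmem a (by simp)
  have hb := hmem b (by simp)
  refine ⟨_, ⟨s(⟨a, ha⟩, ⟨b, hb⟩), hA he, rfl⟩, ?_⟩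
  simp [amalgamMap_of_mem ha, amalgamMap_of_mem hb]

theorem shortCycleFree_amalgam [Fintype β] {s : ℕ} (hH : ThreeChromaticallyConnected H)
    (hφ : ∀ i, Function.Injective (φ i))
    (hadj : ∀ i u v, B'.Adj (φ i u) (φ i v) ↔ (G.induce S).Adj u v) {q : W' → Bool}
    (hq : ∀ x y, B'.Adj x y → q x ≠ q y)
    (hG : ShortCycleFree (fun A : CopyHyperedges H G => A.1) s)
    (hB : ShortCycleFree (fun i => edgeImage (G.induce S) (φ i)) s) :
    ShortCycleFree (fun A : CopyHyperedges H (amalgam G B' φ) => A.1) s := by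
  intro ℓ h2 hs e v h
  choose own lift hlift using exists_copyHyperedge_of_amalgam hH hφ hadj hq
  have hmem : ∀ t < ℓ, v t ∈ Sym2.map (amalgamMap φ (own (e t))) '' (lift (e t)).1 ∧
      v t ∈ Sym2.map (amalgamMap φ (own (e (t + 1)))) '' (lift (e (t + 1))).1 := by
    intro t ht
    rw [← hlift, ← hlift]
    exact h.mem t ht
  have hedge : ∀ A, (lift A).1 ⊆ G.edgeSet := fun A =>
    CopyHyperedges.subset_edgeSet (lift A).2
  have hconst : ∀ t ≤ ℓ, own (e t) = own (e 0) := by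
    refine (hB.image (Sym2.map.injective Sum.inl_injective)).closedWalk_const ℓ hs
      (fun t => own (e t)) v h.injOn_right (congrArg own h.closed) fun t ht hne => ⟨?_, ?_⟩
    · exact mem_edgeImage_of_mem_inter hne (hedge _) (hmem t ht).1 (hmem t ht).2
    · exact mem_edgeImage_of_mem_inter hne.symm (hedge _) (hmem t ht).2 (hmem t ht).1
  set i := own (e 0)
  have hF : Function.Injective (Sym2.map (amalgamMap φ i)) :=
    Sym2.map.injective (amalgamMap_injective hφ i)
  have hE : ShortCycleFree
      (fun A : CopyHyperedges H G => Sym2.map (amalgamMap φ i) '' A.1) s := hG.image hF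
  refine hE ℓ h2 hs (fun t => lift (e t)) v ⟨?_, h.injOn_right, congrArg lift h.closed, ?_⟩
  · intro a ha b hb hab
    refine h.injOn_left ha hb (Subtype.ext ?_)
    rw [hlift, hlift, hconst a (le_of_lt ha), hconst b (le_of_lt hb)]
    exact congrArg (fun A : CopyHyperedges H G => Sym2.map (amalgamMap φ i) '' A.1) hab
  · intro t ht
    have h1 := hmem t ht
    rwa [hconst t ht.le, hconst (t + 1) ht] at h1

end Amalgam

/-! ### Ramsey's theorem for pairs -/

open Finset in
/-- Every `r`-coloured sufficiently large complete graph contains a sequence of `L` vertices such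
that the colour of an edge between two of them only depends on the first one. -/
theorem exists_endHomogeneous_sequence (r L : ℕ) : ∃ a : ℕ, ∀ {A : Type} (χ : Sym2 A → Fin r)
    (S : Finset A), a ≤ #S → ∃ (x : ℕ → A) (κ : ℕ → Fin r), (∀ i < L, x i ∈ S) ∧
      ∀ i j, i < j → j < L → x i ≠ x j ∧ χ s(x i, x j) = κ i := by
  classical
  induction L with
  | zero =>
    refine ⟨1, fun χ S hS => ?_⟩
    obtain ⟨x₀, -⟩ := card_pos.1 hS
    exact ⟨fun _ => x₀, fun _ => χ s(x₀, x₀), by simp, by simp⟩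
  | succ L ih =>
    obtain ⟨a, ha⟩ := ih
    refine ⟨r * a + 1, fun χ S hS => ?_⟩
    obtain ⟨x₀, hx₀⟩ := card_pos.1 (by omega : 0 < #S)
    have hcard : #(univ : Finset (Fin r)) * a ≤ #(S.erase x₀) := by
      rw [card_erase_of_mem hx₀, card_univ, Fintype.card_fin]
      omega
    obtain ⟨k, -, hk⟩ := exists_le_card_fiber_of_mul_le_card_of_maps_to
      (f := fun y => χ s(x₀, y)) (fun _ _ => mem_univ _) ⟨χ s(x₀, x₀), mem_univ _⟩ hcard
    obtain ⟨x, κ, hx, hκ⟩ := ha χ _ hk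
    have hx' : ∀ i < L, (x i ≠ x₀ ∧ x i ∈ S) ∧ χ s(x₀, x i) = k := by simpa using hx
    refine ⟨fun i => i.casesOn x₀ x, fun i => i.casesOn k κ, ?_, ?_⟩
    · rintro (_ | i) hi
      · exact hx₀
      · exact (hx' i (by omega)).1.2
    · rintro (_ | i) (_ | j) hij hj
      · omega
      · exact ⟨(hx' j (by omega)).1.1.symm, (hx' j (by omega)).2⟩
      · omega
      · exact hκ i j (by omega) (by omega)

open Finset in
/-- Ramsey's theorem for `r`-colourings of the edges of a complete graph. -/
theorem exists_mono_embedding (r : ℕ) (β : Type*) [Fintype β] (hr : 0 < r) :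
    ∃ a : ℕ, ∀ χ : Sym2 (Fin a) → Fin r,
      ∃ (τ : β ↪ Fin a) (k : Fin r), ∀ u v, u ≠ v → χ s(τ u, τ v) = k := by
  classical
  obtain ⟨a, ha⟩ := exists_endHomogeneous_sequence r (r * Fintype.card β)
  refine ⟨a, fun χ => ?_⟩
  obtain ⟨x, κ, -, hκ⟩ := ha χ univ (by simp)
  obtain ⟨k, -, hk⟩ := exists_le_card_fiber_of_mul_le_card_of_maps_to
    (s := range (r * Fintype.card β)) (t := (univ : Finset (Fin r))) (f := κ)
    (fun _ _ => mem_univ _) ⟨⟨0, hr⟩, mem_univ _⟩ (n := Fintype.card β) (by simp)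
  rw [← Fintype.card_coe] at hk
  obtain ⟨g⟩ := Function.Embedding.nonempty_of_card_le hk
  have hg : ∀ b, (g b : ℕ) < r * Fintype.card β ∧ κ (g b) = k := fun b =>
    ⟨mem_range.1 (mem_filter.1 (g b).2).1, (mem_filter.1 (g b).2).2⟩
  have key : ∀ u v, (g u : ℕ) < g v → x (g u) ≠ x (g v) ∧ χ s(x (g u), x (g v)) = k := by
    intro u v h
    obtain ⟨h1, h2⟩ := hκ _ _ h (hg v).1
    exact ⟨h1, h2.trans (hg u).2⟩
  have hne : ∀ u v, u ≠ v → (g u : ℕ) < g v ∨ (g v : ℕ) < g u := fun u v h =>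
    lt_or_gt_of_ne fun h' => h (g.injective (Subtype.ext h'))
  refine ⟨⟨fun b => x (g b), fun u v h => ?_⟩, k, fun u v h => ?_⟩
  · by_contra huv
    rcases hne u v huv with h' | h'
    · exact (key u v h').1 h
    · exact (key v u h').1 h.symm
  · rcases hne u v h with h' | h'
    · exact (key u v h').2
    · rw [Sym2.eq_swap]
      exact (key v u h').2

/-! ### The partite construction -/

/-- A graph `G` with parts indexed by `P` such that, for every colouring of `G`, one finds all
transversal copies of `H` simultaneously with the colours of the edges between the pairs of parts
in `E` only depending on this pair, and such that the copies of `H` form no short Berge cycle. -/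
structure IsPartiteRamsey {β P V : Type*} (H : SimpleGraph β) (r s : ℕ) (E : Set (Sym2 P))
    (G : SimpleGraph V) (part : V → P) : Prop where
  ne_of_adj : ∀ u v, G.Adj u v → part u ≠ part v
  exists_copies : ∀ c : Sym2 V → Fin r, ∃ χ : Sym2 P → Fin r, ∀ τ : β ↪ P, ∃ f : β → V,
    (∀ b, part (f b) = τ b) ∧ ∀ u v, H.Adj u v → G.Adj (f u) (f v) ∧
      (s(τ u, τ v) ∈ E → c s(f u, f v) = χ s(τ u, τ v))
  shortCycleFree : ShortCycleFree (fun A : CopyHyperedges H G => A.1) s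

theorem ThreeChromaticallyConnected.connected {β : Type*} [Fintype β] {H : SimpleGraph β}
    (hH : ThreeChromaticallyConnected H) : H.Connected := by
  have h := hH.2 ∅ (SimpleGraph.Colorable.of_isEmpty _)
  rw [Set.compl_empty] at h
  exact (SimpleGraph.induceUnivIso H).connected_iff.1 h

/-- A disjoint union of copies of `H`. -/
def disjointCopies {β : Type*} (T : Type*) (H : SimpleGraph β) : SimpleGraph (T × β) where
  Adj x y := x.1 = y.1 ∧ H.Adj x.2 y.2
  symm := ⟨fun _ _ h => ⟨h.1.symm, h.2.symm⟩⟩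
  loopless := ⟨fun _ h => H.ne_of_adj h.2 rfl⟩

theorem copyHyperedge_disjointCopies {β T : Type*} [Finite β] {H : SimpleGraph β}
    (hH : H.Connected) {A : Set (Sym2 (T × β))}
    (hA : A ∈ CopyHyperedges H (disjointCopies T H)) :
    ∃ τ, A = Sym2.map (Prod.mk τ) '' H.edgeSet := by
  obtain ⟨f, hinj, hf, rfl⟩ := hA
  obtain ⟨b₀⟩ := hH.nonempty
  have hconst : ∀ b, (f b).1 = (f b₀).1 := by
    intro b
    obtain ⟨w⟩ := hH.preconnected b b₀
    induction w with
    | nil => rfl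
    | cons hab _ ih => exact (hf _ _ hab).1.trans ih
  have hfst : f = Prod.mk (f b₀).1 ∘ fun b => (f b).2 :=
    funext fun b => Prod.ext (hconst b) rfl
  have hginj : Function.Injective fun b => (f b).2 := by
    rw [hfst] at hinj
    exact hinj.of_comp
  have hsurj : Sym2.map (fun b => (f b).2) '' H.edgeSet = H.edgeSet := by
    refine Set.eq_of_subset_of_ncard_le ?_ ?_ (Set.toFinite _)
    · rintro _ ⟨z, hz, rfl⟩
      induction z with
      | _ a b => exact (hf a b hz).2
    · rw [Set.ncard_image_of_injective _ (Sym2.map.injective hginj)]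
  refine ⟨(f b₀).1, ?_⟩
  conv_lhs => rw [hfst, Sym2.map_comp, Set.image_comp, hsurj]

theorem isPartiteRamsey_disjointCopies {β P : Type*} [Fintype β] {H : SimpleGraph β} {r : ℕ}
    (hr : 0 < r) (s : ℕ) (hH : ThreeChromaticallyConnected H) :
    IsPartiteRamsey H r s (∅ : Set (Sym2 P)) (disjointCopies (β ↪ P) H) fun x => x.1 x.2 where
  ne_of_adj := by
    rintro ⟨τ, u⟩ ⟨_, v⟩ ⟨rfl, h⟩ h'
    exact H.ne_of_adj h (τ.injective h')
  exists_copies c := ⟨fun _ => ⟨0, hr⟩, fun τ => ⟨fun b => (τ, b), fun _ => rfl,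
    fun u v h => ⟨⟨rfl, h⟩, fun h' => h'.elim⟩⟩⟩
  shortCycleFree := by
    intro ℓ h2 _ e v h
    have h01 : e 0 = e 1 := by
      obtain ⟨h0, h1⟩ := h.mem 0 (by omega)
      obtain ⟨τ, hτ⟩ := copyHyperedge_disjointCopies hH.connected (e 0).2
      obtain ⟨τ', hτ'⟩ := copyHyperedge_disjointCopies hH.connected (e 1).2
      simp only [zero_add] at h1
      have hfst : ∀ {σ : β ↪ P} {z}, z ∈ Sym2.map (Prod.mk σ) '' H.edgeSet →
          ∀ x ∈ z, x.1 = σ := by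
        rintro σ _ ⟨z, -, rfl⟩ x hx
        obtain ⟨b, -, rfl⟩ := Sym2.mem_map.1 hx
        rfl
      obtain ⟨x, hx⟩ : ∃ x, x ∈ v 0 := ⟨_, Sym2.out_fst_mem _⟩
      have hττ' : τ = τ' := (hfst (hτ ▸ h0) x hx).symm.trans (hfst (hτ' ▸ h1) x hx)
      exact Subtype.ext (by rw [hτ, hτ', hττ'])
    have := h.injOn_left (show 0 ∈ Set.Iio ℓ by simp; omega) (show 1 ∈ Set.Iio ℓ by simp; omega)
      h01
    omega

theorem IsPartiteRamsey.exists_insert.{u, w} {β : Type w} {P : Type*} {V : Type u} [Fintype β]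
    [Finite V] {H : SimpleGraph β} {r s : ℕ} (hr : 0 < r) (hH : ThreeChromaticallyConnected H)
    {E : Set (Sym2 P)} {G : SimpleGraph V} {part : V → P} (h : IsPartiteRamsey H r s E G part)
    (z : Sym2 P) : ∃ (V' : Type u) (_ : Finite V') (G' : SimpleGraph V') (part' : V' → P),
      IsPartiteRamsey H r s (insert z E) G' part' := by
  classical
  induction z with
  | _ i j =>
  by_cases hij : i = j
  · refine ⟨V, inferInstance, G, part, h.ne_of_adj, fun c => ?_, h.shortCycleFree⟩
    obtain ⟨χ, hχ⟩ := h.exists_copies c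
    refine ⟨χ, fun τ => ?_⟩
    obtain ⟨f, hpart, hf⟩ := hχ τ
    refine ⟨f, hpart, fun u v huv => ⟨(hf u v huv).1, ?_⟩⟩
    rintro (h' | h')
    · have h'' : τ u = τ v := by
        rw [Sym2.eq_iff] at h'
        rcases h' with ⟨h1, h2⟩ | ⟨h1, h2⟩
        · rw [h1, h2, hij]
        · rw [h1, h2, hij]
      exact absurd (τ.injective h'') (H.ne_of_adj huv)
    · exact (hf u v huv).2 h'
  let S : Set V := {v | part v = i ∨ part v = j}
  have hpS : ∀ v : S, (if decide (part v.1 = i) then i else j) = part v.1 := by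
    rintro ⟨v, hv⟩
    rcases hv with hv | hv
    · simp [hv]
    · simp [hv, Ne.symm hij]
  obtain ⟨W', I, _, _, B', q, φ, hB', hfree⟩ := exists_sparse_ramseySystem hr s (G.induce S)
    (fun v => decide (part v.1 = i)) fun x y hxy hp => h.ne_of_adj x.1 y.1 hxy (by
      rw [← hpS x, ← hpS y, hp])
  let part' : W' ⊕ I × ↥(Sᶜ) → P := Sum.elim (fun x => if q x then i else j) fun x => part x.2.1
  have hpart' : ∀ k v, part' (amalgamMap φ k v) = part v := by
    intro k v
    by_cases hv : v ∈ S
    · rw [amalgamMap_of_mem hv]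
      simp only [part', Sum.elim_inl, hB'.map_class]
      exact hpS ⟨v, hv⟩
    · rw [amalgamMap_of_notMem hv]
      rfl
  refine ⟨W' ⊕ I × ↥(Sᶜ), inferInstance, amalgam G B' φ, part', ?_, ?_,
    shortCycleFree_amalgam hH hB'.injective hB'.adj_iff hB'.ne_of_adj h.shortCycleFree hfree⟩
  · rintro _ _ ⟨-, ⟨x, y, rfl, rfl, hxy⟩ | ⟨k, u, v, huv, rfl, rfl⟩⟩
    · have := hB'.ne_of_adj x y hxy
      simp only [part', Sum.elim_inl]
      cases hx : q x <;> cases hy : q y <;> simp_all [Ne.symm hij]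
    · rw [hpart', hpart']
      exact h.ne_of_adj u v huv
  · intro c
    obtain ⟨k, κ, hκ⟩ := hB'.exists_mono (c ∘ Sym2.map Sum.inl)
    obtain ⟨χ, hχ⟩ := h.exists_copies (c ∘ Sym2.map (amalgamMap φ k))
    refine ⟨Function.update χ s(i, j) κ, fun τ => ?_⟩
    obtain ⟨f, hpart, hf⟩ := hχ τ
    refine ⟨amalgamMap φ k ∘ f, fun b => (hpart' k (f b)).trans (hpart b), fun u v huv =>
      ⟨(amalgam_adj_amalgamMap hB'.injective hB'.adj_iff).2 (hf u v huv).1, fun hmem => ?_⟩⟩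
    by_cases hz : s(τ u, τ v) = s(i, j)
    · rw [hz, Function.update_self]
      have hS : f u ∈ S ∧ f v ∈ S := by
        simp only [S, Set.mem_ofPred_eq, hpart]
        rw [Sym2.eq_iff] at hz
        tauto
      have := hκ ⟨f u, hS.1⟩ ⟨f v, hS.2⟩ (hf u v huv).1
      simpa [amalgamMap_of_mem hS.1, amalgamMap_of_mem hS.2] using this
    · rw [Function.update_of_ne hz]
      exact (hf u v huv).2 (hmem.resolve_left hz)

theorem exists_isPartiteRamsey.{u} {β P : Type u} [Fintype β] [Finite P] {H : SimpleGraph β}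
    {r : ℕ} (hr : 0 < r) (s : ℕ) (hH : ThreeChromaticallyConnected H) :
    ∃ (V : Type u) (_ : Finite V) (G : SimpleGraph V) (part : V → P),
      IsPartiteRamsey H r s Set.univ G part := by
  refine Set.Finite.induction_on_subset (motive := fun E _ => ∃ (V : Type u) (_ : Finite V)
    (G : SimpleGraph V) (part : V → P), IsPartiteRamsey H r s E G part) _ (Set.toFinite _) ?_ ?_
  · exact ⟨_, inferInstance, _, _, isPartiteRamsey_disjointCopies hr s hH⟩
  · rintro z E - - - ⟨V, _, G, part, h⟩
    exact h.exists_insert hr hH z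

/-! ### The main theorem -/

theorem ShortCycleFree.of_image_subset {I I' X X' : Type*} {E : I → Set X} {E' : I' → Set X'}
    {s : ℕ} (hE : ShortCycleFree E s) {α : I' → I} {F : X' → X} (hα : Function.Injective α)
    (hF : Function.Injective F) (h : ∀ i, F '' E' i ⊆ E (α i)) : ShortCycleFree E' s := by
  intro ℓ h2 hs e v hc
  exact hE ℓ h2 hs (α ∘ e) (F ∘ v) ⟨hα.comp_injOn hc.injOn_left, hF.comp_injOn hc.injOn_right,
    congrArg α hc.closed, fun t ht => ⟨h _ ⟨_, (hc.mem t ht).1, rfl⟩, h _ ⟨_, (hc.mem t ht).2, rfl⟩⟩⟩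

theorem ShortCycleFree.copyHyperedges_comap {α β V : Type*} {H : SimpleGraph β}
    {G : SimpleGraph V} {s : ℕ} (h : ShortCycleFree (fun A : CopyHyperedges H G => A.1) s)
    {F : α → V} (hF : Function.Injective F) :
    ShortCycleFree (fun A : CopyHyperedges H (G.comap F) => A.1) s := by
  have hmem : ∀ A ∈ CopyHyperedges H (G.comap F), Sym2.map F '' A ∈ CopyHyperedges H G := by
    rintro _ ⟨f, hinj, hf, rfl⟩
    exact ⟨F ∘ f, hF.comp hinj, hf, by rw [Sym2.map_comp, Set.image_comp]⟩
  refine h.of_image_subset (α := fun A => ⟨_, hmem A.1 A.2⟩) (fun A A' hAA' => ?_)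
    (Sym2.map.injective hF) fun A => subset_rfl
  exact Subtype.ext ((Sym2.map.injective hF).image_injective (Subtype.ext_iff.1 hAA'))

/-- The Nešetřil–Rödl theorem: for every `r`, `s` and every `3`-chromatically
connected graph `H`, there is a graph `G` with `G →ᵣ H` such that the
hypergraph `H(G)` of copies of `H` in `G` has girth greater than `s`, i.e. it
has no Berge cycle of length at most `s`. -/
theorem nesetril_rodl (r s : ℕ) {β : Type*} [Fintype β] (H : SimpleGraph β)
    (hH : ThreeChromaticallyConnected H) :
    ∃ (N : ℕ) (G : SimpleGraph (Fin N)),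
      Arrows G H r ∧
      ∀ ℓ : ℕ, ℓ ≤ s → ¬ HasBergeCycle (CopyHyperedges H G) ℓ := by
  rcases Nat.eq_zero_or_pos r with rfl | hr
  · refine ⟨1, ⊥, fun c => (c s(0, 0)).elim0, fun ℓ _ hcycle => ?_⟩
    obtain ⟨h2, e, -, -, -, he, -⟩ := hcycle
    obtain ⟨f, hf, -⟩ := he ⟨0, by omega⟩
    have h1 := Fintype.card_le_of_injective f hf
    have h3 := hH.1
    rw [Fintype.card_fin] at h1
    omega
  obtain ⟨a, ha⟩ := exists_mono_embedding r β hr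
  obtain ⟨V, _, G, part, hG⟩ := exists_isPartiteRamsey (P := ULift (Fin a)) hr s hH
  let F := (Finite.equivFin V).symm
  refine ⟨Nat.card V, G.comap F, fun c => ?_, fun ℓ hs hcycle => ?_⟩
  · obtain ⟨χ, hχ⟩ := hG.exists_copies (c ∘ Sym2.map F.symm)
    obtain ⟨τ, k, hk⟩ := ha (χ ∘ Sym2.map ULift.up)
    obtain ⟨f, hpart, hf⟩ := hχ (τ.trans Equiv.ulift.symm.toEmbedding)
    refine ⟨F.symm ∘ f, F.symm.injective.comp fun u v huv => ?_, k, fun u v huv => ⟨?_, ?_⟩⟩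
    · have := hpart u
      rw [huv, hpart v] at this
      exact (Function.Embedding.injective _ this).symm
    · simpa using (hf u v huv).1
    · exact ((hf u v huv).2 (Set.mem_univ _)).trans (hk u v (H.ne_of_adj huv))
  · obtain ⟨h2, e, v, h⟩ := hcycle.exists_isBergeCycle
    exact hG.shortCycleFree.copyHyperedges_comap F.injective ℓ h2 hs e v h
end
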